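/- Let n ≥ 1 and s ∈ (0,1) with n/s ≥ 2 (i.e. if n = 1 assume s ≤ 1/2). Then there exists a continuous map u : 𝕊ⁿ → 𝕊ⁿ which is NOT homotopic to a constant map, which has finite energy E_{s,n/s}(u) = ∫_{𝕊ⁿ}∫_{𝕊ⁿ} |u(x)−u(y)|^{n/s}/|x−y|^{2n} dμ(x) dμ(y) < ∞, and which satisfies E_{s,n/s}(u) ≤ E_{s,n/s}(v) for every continuous map v : 𝕊ⁿ → 𝕊ⁿ homotopic to u. -/

import Mathlib

open MeasureTheory
open scoped ENNReal

noncomputable section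

/-- The unit sphere `𝕊ᵏ ⊆ ℝ^{k+1}`. -/
abbrev Sph (k : ℕ) : Type _ := ↥(Metric.sphere (0 : EuclideanSpace ℝ (Fin (k + 1))) 1)

/-- `f` and `g` are homotopic maps. -/
def Homotopic {X Y : Type*} [TopologicalSpace X] [TopologicalSpace Y] (f g : X → Y) : Prop :=
  ∃ H : unitInterval × X → Y, Continuous H ∧ (∀ x, H (0, x) = f x) ∧ (∀ x, H (1, x) = g x)

/-- The energy `E_{s,n/s}(u) = ∫∫ |u(x)-u(y)|^{n/s}/|x-y|^{2n} dμ dμ` of a map `𝕊ⁿ → 𝕊ⁿ`,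
with `μ` the `n`-dimensional Hausdorff measure on `𝕊ⁿ`. -/
def sphEnergy (n : ℕ) (s : ℝ) (u : Sph n → Sph n) : ℝ≥0∞ :=
  ∫⁻ x, ∫⁻ y,
    ENNReal.ofReal
      (‖(u x : EuclideanSpace ℝ (Fin (n + 1))) - (u y : EuclideanSpace ℝ (Fin (n + 1)))‖
          ^ ((n : ℝ) / s) / dist x y ^ (2 * (n : ℝ)))
    ∂(μH[(n : ℝ)] : Measure (Sph n)) ∂(μH[(n : ℝ)] : Measure (Sph n))

set_option linter.unusedSectionVars false
set_option linter.unusedVariables false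

/-! ### Homotopy basics -/

/-- null-homotopic -/
def NullH {n : ℕ} (f : Sph n → Sph n) : Prop := ∃ c : Sph n, Homotopic f (fun _ => c)

section hom
variable {X Y Z : Type*} [TopologicalSpace X] [TopologicalSpace Y] [TopologicalSpace Z]

lemma Homotopic.cont_left {f g : X → Y} (h : Homotopic f g) : Continuous f := by
  obtain ⟨H, hH, h0, h1⟩ := h
  have : f = fun x => H (0, x) := funext fun x => (h0 x).symm
  rw [this]; fun_prop

lemma Homotopic.cont_right {f g : X → Y} (h : Homotopic f g) : Continuous g := by
  obtain ⟨H, hH, h0, h1⟩ := h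
  have : g = fun x => H (1, x) := funext fun x => (h1 x).symm
  rw [this]; fun_prop

lemma homotopic_iff {f g : X → Y} (hf : Continuous f) (hg : Continuous g) :
    Homotopic f g ↔ ContinuousMap.Homotopic (⟨f, hf⟩ : C(X, Y)) ⟨g, hg⟩ := by
  constructor
  · rintro ⟨H, hH, h0, h1⟩
    exact ⟨⟨⟨H, hH⟩, h0, h1⟩⟩
  · rintro ⟨H⟩
    exact ⟨H, H.continuous, fun x => H.apply_zero x, fun x => H.apply_one x⟩

lemma Homotopic.refl' {f : X → Y} (hf : Continuous f) : Homotopic f f :=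
  ⟨fun z => f z.2, by fun_prop, fun _ => rfl, fun _ => rfl⟩

lemma Homotopic.symm' {f g : X → Y} (h : Homotopic f g) : Homotopic g f := by
  have hf := h.cont_left
  have hg := h.cont_right
  rw [homotopic_iff hg hf]
  exact ((homotopic_iff hf hg).1 h).symm

lemma Homotopic.trans' {f g k : X → Y} (h : Homotopic f g) (h' : Homotopic g k) :
    Homotopic f k := by
  have hf := h.cont_left
  have hg := h.cont_right
  have hk := h'.cont_right
  rw [homotopic_iff hf hk]
  exact ((homotopic_iff hf hg).1 h).trans ((homotopic_iff hg hk).1 h')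

lemma Homotopic.precomp {f g : X → Y} (h : Homotopic f g) {m : Z → X} (hm : Continuous m) :
    Homotopic (f ∘ m) (g ∘ m) := by
  obtain ⟨H, hH, h0, h1⟩ := h
  exact ⟨fun z => H (z.1, m z.2), by fun_prop, fun x => h0 _, fun x => h1 _⟩

end hom

lemma NullH.congr {n : ℕ} {f g : Sph n → Sph n} (h : Homotopic f g) (hg : NullH g) : NullH f := by
  obtain ⟨c, hc⟩ := hg
  exact ⟨c, h.trans' hc⟩

lemma NullH.of_precomp {n : ℕ} {f : Sph n → Sph n} {M M' : Sph n → Sph n} (hM' : Continuous M')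
    (h : ∀ y, M (M' y) = y) (hf : NullH (f ∘ M)) : NullH f := by
  obtain ⟨c, hc⟩ := hf
  refine ⟨c, ?_⟩
  have := hc.precomp hM'
  have e1 : (f ∘ M) ∘ M' = f := funext fun y => by simp [h]
  rwa [e1] at this

/-! ### radial projection -/

/-- ambient space -/
abbrev Fs (n : ℕ) := EuclideanSpace ℝ (Fin (n + 1))
/-- chart space -/
abbrev Es (n : ℕ) := EuclideanSpace ℝ (Fin n)

/-- the pole -/
def pole (n : ℕ) : Sph n := ⟨EuclideanSpace.single 0 1, by simp⟩

open Classical in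
/-- radial projection to the sphere -/
def prj {n : ℕ} (y : Fs n) : Sph n :=
  if h : y ≠ 0 then ⟨‖y‖⁻¹ • y, by simp [norm_smul, h]⟩ else pole n

lemma prj_val {n : ℕ} {y : Fs n} (h : y ≠ 0) : (prj y : Fs n) = ‖y‖⁻¹ • y := by
  simp [prj, h]

lemma sph_norm {n : ℕ} (y : Sph n) : ‖(y : Fs n)‖ = 1 := by simp

lemma sph_ne {n : ℕ} (y : Sph n) : (y : Fs n) ≠ 0 := by
  intro h; have := sph_norm y; rw [h] at this; simp at this

lemma prj_coe {n : ℕ} (y : Sph n) : prj (y : Fs n) = y := by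
  apply Subtype.ext; rw [prj_val (sph_ne y)]; simp

lemma prj_continuousOn {n : ℕ} : ContinuousOn (prj (n := n)) {y | y ≠ 0} := by
  rw [Topology.IsInducing.subtypeVal.continuousOn_iff]
  have : ContinuousOn (fun y : Fs n => ‖y‖⁻¹ • y) {y | y ≠ 0} := by
    refine ContinuousOn.fun_smul (ContinuousOn.inv₀ continuous_norm.continuousOn ?_) continuousOn_id
    intro x hx; simpa using hx
  exact this.congr fun y hy => prj_val hy

lemma prj_comp_cont {n : ℕ} {X : Type*} [TopologicalSpace X] {w : X → Fs n} (hw : Continuous w)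
    (h : ∀ x, w x ≠ 0) : Continuous (fun x => prj (w x)) :=
  prj_continuousOn.comp_continuous hw h

lemma prj_lip {n : ℕ} {a b : Fs n} (ha : 1 / 2 ≤ ‖a‖) (hb : 1 / 2 ≤ ‖b‖) :
    ‖(prj a : Fs n) - prj b‖ ≤ 4 * ‖a - b‖ := by
  have ha0 : 0 < ‖a‖ := by linarith
  have hb0 : 0 < ‖b‖ := by linarith
  rw [prj_val (norm_pos_iff.1 ha0), prj_val (norm_pos_iff.1 hb0)]
  have e : ‖a‖⁻¹ • a - ‖b‖⁻¹ • b = ‖a‖⁻¹ • (a - b) + (‖a‖⁻¹ * ((‖b‖ - ‖a‖) * ‖b‖⁻¹)) • b := by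
    rw [smul_sub, sub_add, ← sub_smul]
    congr 2
    field_simp; ring
  rw [e]
  have hi : ‖a‖⁻¹ ≤ 2 := by
    rw [inv_le_comm₀ ha0 two_pos]; linarith
  have h1 : |‖b‖ - ‖a‖| ≤ ‖a - b‖ := by rw [abs_sub_comm]; exact abs_norm_sub_norm_le a b
  calc _ ≤ ‖‖a‖⁻¹ • (a - b)‖ + ‖(‖a‖⁻¹ * ((‖b‖ - ‖a‖) * ‖b‖⁻¹)) • b‖ := norm_add_le _ _
    _ = ‖a‖⁻¹ * ‖a - b‖ + ‖a‖⁻¹ * |‖b‖ - ‖a‖| := by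
      rw [norm_smul, norm_smul]; simp only [norm_mul, norm_inv, Real.norm_eq_abs, abs_norm]
      field_simp
    _ ≤ 2 * ‖a - b‖ + 2 * ‖a - b‖ := by gcongr
    _ = _ := by ring

lemma homotopic_prj {n : ℕ} {X : Type*} [TopologicalSpace X] {G : unitInterval × X → Fs n}
    (hG : Continuous G) (h : ∀ z, G z ≠ 0) :
    Homotopic (fun x => prj (G (0, x))) (fun x => prj (G (1, x))) :=
  ⟨fun z => prj (G z), prj_comp_cont hG h, fun _ => rfl, fun _ => rfl⟩

/-- linear homotopy -/
lemma homotopic_prj_lin {n : ℕ} {X : Type*} [TopologicalSpace X] {a b : X → Fs n}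
    (ha : Continuous a) (hb : Continuous b) (h : ∀ x, ‖b x - a x‖ < ‖a x‖) :
    Homotopic (fun x => prj (a x)) (fun x => prj (b x)) := by
  have := homotopic_prj (G := fun z : unitInterval × X => a z.2 + (z.1 : ℝ) • (b z.2 - a z.2))
    (by fun_prop) (by
      rintro ⟨t, x⟩ h0
      have h1 : a x = - ((t : ℝ) • (b x - a x)) := eq_neg_of_add_eq_zero_left h0
      have h2 : ‖a x‖ ≤ ‖b x - a x‖ := by
        rw [h1, norm_neg, norm_smul, ← h1, Real.norm_of_nonneg t.2.1]
        exact mul_le_of_le_one_left (norm_nonneg _) t.2.2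
      exact absurd (h x) (not_lt.2 h2))
  simpa using this

/-! ### Brouwer: the identity is not null-homotopic -/

lemma det_interp {N : ℕ} (s : Finset ℕ) (hs : N + 1 ≤ s.card) (v : ℕ → ℝ) (hv : Set.InjOn v s) (t : ℝ)
    (A : Fs N →L[ℝ] Fs N) (hs' : N + 1 < s.card) :
    (ContinuousLinearMap.id ℝ (Fs N) + t • A).det =
      ∑ i ∈ s, (ContinuousLinearMap.id ℝ (Fs N) + v i • A).det * (Lagrange.basis s v i).eval t := by
  classical
  let b := (EuclideanSpace.basisFun (Fin (N + 1)) ℝ).toBasis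
  let M := LinearMap.toMatrix b b (A : Fs N →ₗ[ℝ] Fs N)
  let Q : Polynomial ℝ := Matrix.det ((Polynomial.X : Polynomial ℝ) • M.map Polynomial.C +
    (1 : Matrix (Fin (N + 1)) (Fin (N + 1)) ℝ).map Polynomial.C)
  have hQ : ∀ r : ℝ, (ContinuousLinearMap.id ℝ (Fs N) + r • A).det = Q.eval r := by
    intro r
    rw [ContinuousLinearMap.det, ← LinearMap.det_toMatrix b]
    have : Q.eval r = (Polynomial.evalRingHom r) Q := rfl
    rw [this, RingHom.map_det]
    congr 1
    ext i j
    simp [M, LinearMap.toMatrix_apply, Matrix.one_apply, Finsupp.single_apply]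
    by_cases h : i = j
    · subst h; simp; ring
    · simp [h, Ne.symm h]; ring
  have hdeg : Q.degree < s.card := by
    refine lt_of_le_of_lt Polynomial.degree_le_natDegree ?_
    have := Polynomial.natDegree_det_X_add_C_le M 1
    simp only [Fintype.card_fin] at this
    exact_mod_cast lt_of_le_of_lt this hs'
  have := Lagrange.eq_interpolate hv hdeg
  simp only [hQ]
  conv_lhs => rw [this]
  rw [Lagrange.interpolate_apply, Polynomial.eval_finsetSum]
  simp

/-- degree theory in one lemma (Milnor-Rogers) -/
lemma integral_det_eq {N : ℕ} {P : Fs N → Fs N} (hP : ContDiff ℝ 1 P)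
    (hout : ∀ x, 3 ≤ ‖x‖ → P x = x) :
    ∫ x in Metric.ball (0 : Fs N) 3, (fderiv ℝ P x).det = (volume (Metric.ball (0 : Fs N) 3)).toReal := by
  set q : Fs N → Fs N := fun x => P x - x with hq
  have hqc : ContDiff ℝ 1 q := hP.sub contDiff_id
  have hqs : HasCompactSupport q := by
    apply HasCompactSupport.of_support_subset_isCompact (isCompact_closedBall (0 : Fs N) 3)
    intro x hx
    by_contra h
    simp only [Metric.mem_closedBall, dist_zero_right, not_le] at h
    exact hx (by simp [hq, hout x h.le])
  obtain ⟨L, hL⟩ := hqc.lipschitzWith_of_hasCompactSupport hqs one_ne_zero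
  have hdq : ∀ x, ‖fderiv ℝ q x‖ ≤ L := fun x => norm_fderiv_le_of_lipschitz ℝ hL
  have hqd : Differentiable ℝ q := hqc.differentiable one_ne_zero
  have hdqc : Continuous (fderiv ℝ q) := hqc.continuous_fderiv one_ne_zero
  obtain ⟨η, hη, hdet⟩ : ∃ η > 0, ∀ B : Fs N →L[ℝ] Fs N, ‖B‖ < η →
      0 < (ContinuousLinearMap.id ℝ (Fs N) + B).det := by
    have hc : Continuous fun B : Fs N →L[ℝ] Fs N => (ContinuousLinearMap.id ℝ (Fs N) + B).det :=
      ContinuousLinearMap.continuous_det.comp (by fun_prop)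
    have h0 : (0 : ℝ) < (ContinuousLinearMap.id ℝ (Fs N) + (0 : Fs N →L[ℝ] Fs N)).det := by
      simp [ContinuousLinearMap.det]
    have := hc.continuousAt.eventually (lt_mem_nhds h0)
    obtain ⟨η, hη, h⟩ := Metric.eventually_nhds_iff.1 this
    exact ⟨η, hη, fun B hB => h (by simpa using hB)⟩
  set t0 : ℝ := min 1 η / (2 * ((L : ℝ) + 1)) with ht0
  have hL0 : (0 : ℝ) ≤ L := L.2
  have ht0p : 0 < t0 := by positivity
  have key : ∀ t : ℝ, 0 ≤ t → t ≤ t0 →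
      ∫ x in Metric.ball (0 : Fs N) 3, (ContinuousLinearMap.id ℝ (Fs N) + t • fderiv ℝ q x).det =
        (volume (Metric.ball (0 : Fs N) 3)).toReal := by
    intro t ht htt
    have htL : t * L ≤ min 1 η / 2 := by
      calc t * L ≤ t0 * (L + 1) := by gcongr; linarith
        _ = _ := by rw [ht0]; field_simp
    have hpos : ∀ x, 0 < (ContinuousLinearMap.id ℝ (Fs N) + t • fderiv ℝ q x).det := by
      intro x
      apply hdet
      rw [norm_smul, Real.norm_of_nonneg ht]
      calc t * ‖fderiv ℝ q x‖ ≤ t * L := by gcongr; exact hdq x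
        _ ≤ min 1 η / 2 := htL
        _ < η := by linarith [min_le_right 1 η]
    set g : Fs N → Fs N := fun x => x + t • q x with hg
    have hgd : ∀ x, HasFDerivAt g (ContinuousLinearMap.id ℝ (Fs N) + t • fderiv ℝ q x) x := by
      intro x
      exact (hasFDerivAt_id x).add ((hqd x).hasFDerivAt.const_smul t)
    have happ : ApproximatesLinearOn g ((ContinuousLinearEquiv.refl ℝ (Fs N)) : Fs N →L[ℝ] Fs N)
        Set.univ (Real.toNNReal (t * L)) := by
      intro x _ y _
      simp only [hg, ContinuousLinearEquiv.coe_refl, ContinuousLinearMap.coe_id', id]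
      have : x + t • q x - (y + t • q y) - (x - y) = t • (q x - q y) := by
        module
      rw [this, norm_smul, Real.norm_of_nonneg ht, Real.coe_toNNReal _ (by positivity), mul_assoc]
      gcongr
      simpa [dist_eq_norm] using hL.dist_le_mul x y
    have hc : Real.toNNReal (t * L) <
        ‖((ContinuousLinearEquiv.refl ℝ (Fs N)).symm : Fs N →L[ℝ] Fs N)‖₊⁻¹ := by
      have h1 : ‖((ContinuousLinearEquiv.refl ℝ (Fs N)).symm : Fs N →L[ℝ] Fs N)‖₊ = 1 := by
        have : ‖ContinuousLinearMap.id ℝ (Fs N)‖ = 1 := ContinuousLinearMap.norm_id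
        apply NNReal.eq
        simp
      rw [h1, inv_one, Real.toNNReal_lt_one]
      linarith [min_le_left 1 η]
    have hinj : Function.Injective g := by
      have := happ.injOn (Or.inr hc)
      rwa [Set.injOn_univ] at this
    have hsurj : Function.Surjective g := happ.surjective (Or.inr hc)
    have hgo : ∀ x, 3 ≤ ‖x‖ → g x = x := by
      intro x hx; simp [hg, hq, hout x hx]
    have himg : g '' Metric.ball 0 3 = Metric.ball 0 3 := by
      ext y
      constructor
      · rintro ⟨x, hx, rfl⟩
        by_contra h
        simp only [Metric.mem_ball, dist_zero_right, not_lt] at h hx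
        have h2 := hinj (hgo _ h)
        rw [h2] at h
        linarith
      · intro hy
        obtain ⟨x, rfl⟩ := hsurj y
        refine ⟨x, ?_, rfl⟩
        by_contra h
        simp only [Metric.mem_ball, dist_zero_right, not_lt] at h hy
        rw [hgo x h] at hy
        linarith
    have := lintegral_image_eq_lintegral_abs_det_fderiv_mul volume measurableSet_ball
      (fun x _ => (hgd x).hasFDerivWithinAt) (hinj.injOn) (s := Metric.ball 0 3) (fun _ => 1)
    rw [himg] at this
    simp only [lintegral_const, MeasurableSet.univ, Measure.restrict_apply, Set.univ_inter, one_mul,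
      mul_one] at this
    rw [this, integral_eq_lintegral_of_nonneg_ae]
    · congr 2
      ext x
      rw [abs_of_pos (hpos x)]
    · exact Filter.Eventually.of_forall fun x => (hpos x).le
    · exact (ContinuousLinearMap.continuous_det.comp (by fun_prop)).aestronglyMeasurable
  set s := Finset.range (N + 2)
  set v : ℕ → ℝ := fun i => t0 / (i + 1)
  have hv : Set.InjOn v s := by
    intro i _ j _ hij
    simp only [v] at hij
    field_simp at hij
    have : (i : ℝ) = j := by linarith
    exact_mod_cast this
  have hPq : ∀ x, fderiv ℝ P x = ContinuousLinearMap.id ℝ (Fs N) + (1 : ℝ) • fderiv ℝ q x := by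
    intro x
    have : fderiv ℝ q x = fderiv ℝ P x - ContinuousLinearMap.id ℝ (Fs N) := by
      rw [hq]
      have h := (((hP.differentiable one_ne_zero) x).hasFDerivAt.sub (hasFDerivAt_id x))
      exact h.fderiv
    rw [this]; simp
  have hIntg : ∀ t : ℝ, IntegrableOn
      (fun x => (ContinuousLinearMap.id ℝ (Fs N) + t • fderiv ℝ q x).det) (Metric.ball 0 3) := by
    intro t
    have hc : Continuous (fun x => (ContinuousLinearMap.id ℝ (Fs N) + t • fderiv ℝ q x).det) :=
      ContinuousLinearMap.continuous_det.comp (by fun_prop)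
    exact (hc.continuousOn.integrableOn_compact (isCompact_closedBall (0 : Fs N) 3)).mono_set
      Metric.ball_subset_closedBall
  have hcard : N + 1 < s.card := by simp [s]
  simp_rw [hPq, fun x => det_interp s hcard.le v hv 1 (fderiv ℝ q x) hcard]
  rw [integral_finsetSum]
  · have h1 : ∀ i ∈ s, ∫ x in Metric.ball (0 : Fs N) 3,
        (ContinuousLinearMap.id ℝ (Fs N) + v i • fderiv ℝ q x).det * (Lagrange.basis s v i).eval 1 =
        (volume (Metric.ball (0 : Fs N) 3)).toReal * (Lagrange.basis s v i).eval 1 := by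
      intro i _
      rw [integral_mul_const, key]
      · positivity
      · apply div_le_self ht0p.le; linarith [(Nat.cast_nonneg i : (0 : ℝ) ≤ i)]
    rw [Finset.sum_congr rfl h1, ← Finset.mul_sum, ← Polynomial.eval_finsetSum,
      Lagrange.sum_basis hv (by simp [s])]
    simp
  · intro i _
    exact (hIntg _).mul_const _

/-- a unit valued `C¹` map has singular derivative -/
lemma det_zero_of_unit {N : ℕ} {P : Fs N → Fs N} {x : Fs N} (hd : DifferentiableAt ℝ P x)
    (h : ∀ᶠ y in nhds x, ‖P y‖ = 1) : (fderiv ℝ P x).det = 0 := by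
  have h1 : (fun y => inner ℝ (P y) (P y)) =ᶠ[nhds x] fun _ => (1 : ℝ) := by
    filter_upwards [h] with y hy
    rw [real_inner_self_eq_norm_sq, hy]; norm_num
  have hx : ‖P x‖ = 1 := h.self_of_nhds
  have h2 := hd.hasFDerivAt.inner ℝ hd.hasFDerivAt
  have h3 := h2.congr_of_eventuallyEq h1.symm
  have h4 := h3.unique (hasFDerivAt_const (1 : ℝ) x)
  by_contra hdet
  have hsurj : Function.Surjective (fderiv ℝ P x) := by
    have := LinearMap.isUnit_iff_isUnit_det ((fderiv ℝ P x : Fs N →L[ℝ] Fs N) : Fs N →ₗ[ℝ] Fs N)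
    have h5 := this.2 (isUnit_iff_ne_zero.2 hdet)
    exact ((Module.End.isUnit_iff _).1 h5).2
  obtain ⟨w, hw⟩ := hsurj (P x)
  have h5 := congrArg (fun A : Fs N →L[ℝ] ℝ => A w) h4
  simp [fderivInnerCLM_apply, hw] at h5
  rw [h5] at hx; simp at hx

lemma exists_smooth_of_null {n : ℕ} (h : NullH (id : Sph n → Sph n)) :
    ∃ G : Fs n → Fs n, ContDiff ℝ 1 G ∧ (∀ x, G x ≠ 0) ∧ ∀ x, 2 ≤ ‖x‖ → G x = x := by
  obtain ⟨c, H, hH, h0, h1⟩ := h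
  set cl : Fs n → unitInterval := fun x => Set.projIcc 0 1 zero_le_one (2 - 2 * ‖x‖) with hcl
  have hclc : Continuous cl := continuous_projIcc.comp (by fun_prop)
  set g : Fs n → Fs n := fun x => if ‖x‖ ≤ 1 / 2 then (c : Fs n) else
    (max 1 ‖x‖) • (H (cl x, prj x) : Fs n) with hg
  have hgc : Continuous g := by
    apply continuous_if_le continuous_norm continuous_const continuousOn_const
    · have : ContinuousOn (fun x : Fs n => H (cl x, prj x)) {x | 1 / 2 ≤ ‖x‖} := by
        apply hH.comp_continuousOn
        apply hclc.continuousOn.prodMk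
        apply prj_continuousOn.mono
        intro x hx hx0
        simp only [Set.mem_ofPred_eq] at hx
        rw [hx0] at hx; norm_num at hx
      exact ContinuousOn.fun_smul (by fun_prop) (continuous_subtype_val.comp_continuousOn this)
    · intro x hx
      have : cl x = 1 := by
        simp only [hcl, hx]; norm_num
      rw [this, h1, hx]; norm_num
  have hgn : ∀ x, 1 ≤ ‖g x‖ := by
    intro x
    simp only [hg]
    split_ifs with hx
    · simp
    · rw [norm_smul, sph_norm, mul_one, Real.norm_of_nonneg (by positivity)]
      exact le_max_left _ _
  have hgo : ∀ x, 1 ≤ ‖x‖ → g x = x := by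
    intro x hx
    have h2 : ¬ ‖x‖ ≤ 1 / 2 := by linarith
    have hx0 : x ≠ 0 := norm_pos_iff.1 (by linarith)
    have h3 : cl x = 0 := by
      simp only [hcl]; rw [Set.projIcc_of_le_left]; · rfl
      linarith
    simp only [hg, if_neg h2, h3, h0, max_eq_right hx, id, prj_val hx0]
    rw [smul_smul, mul_inv_cancel₀ (norm_ne_zero_iff.2 hx0), one_smul]
  obtain ⟨G, hG, hd, he, -⟩ := hgc.exists_contDiff_approx_and_eqOn 1 (ε := fun _ => 1 / 2)
    continuous_const (by norm_num) (S := {x | 2 ≤ ‖x‖}) (U := {x | 1 < ‖x‖})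
    (isClosed_le continuous_const continuous_norm)
    ((isOpen_lt continuous_const continuous_norm).mem_nhdsSet.2 (fun x hx => by
      simp only [Set.mem_ofPred_eq] at *; linarith))
    (contDiffOn_id.congr (fun x hx => hgo x (le_of_lt hx)))
  refine ⟨G, hG, ?_, fun x hx => ?_⟩
  · intro x h
    have h1 := hd x
    rw [h, dist_zero_left] at h1
    linarith [hgn x]
  · rw [he hx, hgo x (by linarith)]

lemma id_not_null {n : ℕ} : ¬ NullH (id : Sph n → Sph n) := by
  intro h
  obtain ⟨G, hG, hG0, hGo⟩ := exists_smooth_of_null h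
  set b : ℝ → ℝ := fun ρ => 1 + (ρ - 1) * Real.smoothTransition (ρ - 2) with hb
  set a : Fs n → ℝ := fun x => b ‖x‖ with ha
  have hac : ContDiff ℝ 1 a := by
    rw [contDiff_iff_contDiffAt]
    intro x
    by_cases hx : x = 0
    · have : a =ᶠ[nhds x] fun _ => 1 := by
        have : ∀ᶠ y in nhds x, ‖y‖ < 2 :=
          continuous_norm.continuousAt.eventually (gt_mem_nhds (by simp [hx]))
        filter_upwards [this] with y hy
        simp [ha, hb, Real.smoothTransition.zero_of_nonpos (x := ‖y‖ - 2) (by linarith)]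
      exact contDiffAt_const.congr_of_eventuallyEq this
    · have h1 : ContDiffAt ℝ 1 (fun y : Fs n => ‖y‖) x := contDiffAt_norm ℝ hx
      have h2 : ContDiff ℝ 1 b := by
        simp only [hb]
        apply contDiff_const.add
        apply (contDiff_id.sub contDiff_const).mul
        exact Real.smoothTransition.contDiff.comp (contDiff_id.sub contDiff_const)
      exact h2.contDiffAt.comp x h1
  have hb2 : ∀ ρ, ρ ≤ 2 → b ρ = 1 := by
    intro ρ hρ
    simp [hb, Real.smoothTransition.zero_of_nonpos (x := ρ - 2) (by linarith)]
  have hb3 : ∀ ρ, 3 ≤ ρ → b ρ = ρ := by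
    intro ρ hρ
    simp [hb, Real.smoothTransition.one_of_one_le (x := ρ - 2) (by linarith)]
  have hbm : StrictMonoOn b (Set.Ioi 2) := by
    intro x hx y hy hxy
    simp only [Set.mem_Ioi] at hx hy
    have h1 := Real.smoothTransition.pos_of_pos (x := x - 2) (by linarith)
    have h2 : Real.smoothTransition (x - 2) ≤ Real.smoothTransition (y - 2) :=
      Real.smoothTransition.monotone (by linarith)
    simp only [hb]
    nlinarith
  set r : Fs n → Fs n := fun x => ‖G x‖⁻¹ • G x with hr
  have hrc : ContDiff ℝ 1 r := by
    refine ContDiff.fun_smul ?_ hG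
    exact (hG.norm ℝ hG0).inv (fun x => norm_ne_zero_iff.2 (hG0 x))
  have hrn : ∀ x, ‖r x‖ = 1 := by
    intro x; simp [hr, norm_smul, hG0 x]
  set P : Fs n → Fs n := fun x => a x • r x with hP
  have hPc : ContDiff ℝ 1 P := hac.smul hrc
  have hPo : ∀ x, 2 ≤ ‖x‖ → P x = (b ‖x‖ * ‖x‖⁻¹) • x := by
    intro x hx
    simp only [hP, hr, ha, hGo x hx, smul_smul]
  have hkey := integral_det_eq hPc (fun x hx => by
    rw [hPo x (by linarith), hb3 _ hx, mul_inv_cancel₀ (by linarith), one_smul])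
  set An : Set (Fs n) := {x | 2 < ‖x‖ ∧ ‖x‖ < 3} with hAn
  have hAm : MeasurableSet An :=
    ((isOpen_lt continuous_const continuous_norm).inter
      (isOpen_lt continuous_norm continuous_const)).measurableSet
  have hdet0 : ∀ x, ‖x‖ < 2 → (fderiv ℝ P x).det = 0 := by
    intro x hx
    apply det_zero_of_unit (hPc.differentiable one_ne_zero x)
    have : ∀ᶠ y in nhds x, ‖y‖ < 2 := continuous_norm.continuousAt.eventually (gt_mem_nhds hx)
    filter_upwards [this] with y hy
    simp only [hP, norm_smul, hrn, ha, hb2 _ hy.le]; simp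
  have hPn : ∀ x, 2 < ‖x‖ → ‖P x‖ = b ‖x‖ := by
    intro x hx
    have : 0 ≤ b ‖x‖ := by
      simp only [hb]
      have := Real.smoothTransition.nonneg (‖x‖ - 2)
      nlinarith
    simp only [hP, norm_smul, hrn, ha, mul_one, Real.norm_of_nonneg this]
  have hinj : Set.InjOn P An := by
    intro x hx y hy hxy
    have h1 : b ‖x‖ = b ‖y‖ := by rw [← hPn x hx.1, ← hPn y hy.1, hxy]
    have h2 : ‖x‖ = ‖y‖ := hbm.injOn hx.1 hy.1 h1
    rw [hPo x hx.1.le, hPo y hy.1.le, ← h2] at hxy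
    have h3 : b ‖x‖ * ‖x‖⁻¹ ≠ 0 := by
      have : 0 < b ‖x‖ := by
        simp only [hb]
        have := Real.smoothTransition.nonneg (‖x‖ - 2)
        nlinarith [hx.1]
      have := hx.1
      positivity
    exact smul_right_injective _ h3 hxy
  have himg : P '' An ⊆ Metric.ball 0 3 \ Metric.ball 0 1 := by
    rintro _ ⟨x, hx, rfl⟩
    have h1 := hPn x hx.1
    have h2 : b ‖x‖ < b 3 := hbm hx.1 (by norm_num) hx.2
    rw [hb3 3 le_rfl] at h2
    have h3 : 1 ≤ b ‖x‖ := by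
      simp only [hb]
      have := Real.smoothTransition.nonneg (‖x‖ - 2)
      nlinarith [hx.1]
    simp [h1, h2, h3]
  have harea := lintegral_image_eq_lintegral_abs_det_fderiv_mul volume hAm
      (fun x _ => ((hPc.differentiable one_ne_zero) x).hasFDerivAt.hasFDerivWithinAt) hinj
      (fun _ => 1)
  simp only [lintegral_const, MeasurableSet.univ, Measure.restrict_apply, Set.univ_inter, one_mul,
      mul_one] at harea
  have hfin : ∀ R, volume (Metric.ball (0 : Fs n) R) ≠ ⊤ := fun R => measure_ball_lt_top.ne
  have hb1 : 0 < volume (Metric.ball (0 : Fs n) 1) := Metric.measure_ball_pos _ _ one_pos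
  have hlt : volume (P '' An) < volume (Metric.ball (0 : Fs n) 3) := by
    refine (measure_mono himg).trans_lt ?_
    rw [measure_sdiff (Metric.ball_subset_ball (by norm_num)) measurableSet_ball.nullMeasurableSet (hfin 1)]
    apply ENNReal.sub_lt_self (hfin 3) _ hb1.ne'
    exact (Metric.measure_ball_pos _ _ (by norm_num)).ne'
  have hcont : Continuous fun x => (fderiv ℝ P x).det :=
    ContinuousLinearMap.continuous_det.comp (hPc.continuous_fderiv one_ne_zero)
  have hle : ∫ x in Metric.ball (0 : Fs n) 3, (fderiv ℝ P x).det ≤ (volume (P '' An)).toReal := by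
    have h1 : ∫ x in Metric.ball (0 : Fs n) 3, (fderiv ℝ P x).det = ∫ x in An, (fderiv ℝ P x).det := by
      apply setIntegral_eq_of_subset_of_ae_sdiff_eq_zero measurableSet_ball.nullMeasurableSet
      · intro x hx; simpa using hx.2
      · have : ∀ᵐ x : Fs n, x ∉ Metric.sphere (0 : Fs n) 2 := by
          rw [ae_iff]; simp only [not_not]
          exact Measure.addHaar_sphere _ _ _
        filter_upwards [this] with x hx hx2
        apply hdet0
        simp only [mem_sphere_iff_norm, sub_zero, Set.mem_diff, Metric.mem_ball, dist_zero_right, hAn,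
          Set.mem_ofPred_eq, not_and, not_lt] at hx hx2
        rcases lt_trichotomy ‖x‖ 2 with h | h | h
        · exact h
        · exact absurd h hx
        · exact absurd hx2.1 (not_lt.2 (hx2.2 h))
    rw [h1, harea]
    calc ∫ x in An, (fderiv ℝ P x).det ≤ ∫ x in An, |(fderiv ℝ P x).det| := by
          have hi : IntegrableOn (fun x => (fderiv ℝ P x).det) An :=
            (hcont.continuousOn.integrableOn_compact (isCompact_closedBall (0 : Fs n) 3)).mono_set
              (fun x hx => by simpa using hx.2.le)
          exact integral_mono hi hi.abs (fun x => le_abs_self _)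
      _ = _ := by
          rw [integral_eq_lintegral_of_nonneg_ae (Filter.Eventually.of_forall fun x => abs_nonneg _)
            hcont.abs.aestronglyMeasurable]
  rw [hkey] at hle
  have := (ENNReal.toReal_lt_toReal (hlt.trans_le le_top).ne (hfin 3)).2 hlt
  linarith

/-! ### Stereographic projection -/

/-- build a vector from first coordinate and the rest -/
def mkv {n : ℕ} (a : ℝ) (x : Es n) : Fs n := WithLp.toLp 2 (Fin.cons a x.ofLp : Fin (n + 1) → ℝ)

/-- tail of a vector -/
def tlv {n : ℕ} (y : Fs n) : Es n := WithLp.toLp 2 (fun i => y i.succ)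

@[simp] lemma mkv_zero {n : ℕ} (a : ℝ) (x : Es n) : (mkv a x) 0 = a := by simp [mkv]

@[simp] lemma tlv_mkv {n : ℕ} (a : ℝ) (x : Es n) : tlv (mkv a x) = x := by
  ext i; simp [mkv, tlv]

lemma mkv_eta {n : ℕ} (y : Fs n) : mkv (y 0) (tlv y) = y := by
  ext i; refine Fin.cases ?_ (fun j => ?_) i <;> simp [mkv, tlv]

lemma mkv_sub {n : ℕ} (a b : ℝ) (x y : Es n) : mkv a x - mkv b y = mkv (a - b) (x - y) := by
  ext i; refine Fin.cases ?_ (fun j => ?_) i <;> simp [mkv]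

lemma mkv_smul {n : ℕ} (a b : ℝ) (x : Es n) : b • mkv a x = mkv (b * a) (b • x) := by
  ext i; refine Fin.cases ?_ (fun j => ?_) i <;> simp [mkv]

lemma mkv_norm_sq {n : ℕ} (a : ℝ) (x : Es n) : ‖mkv a x‖ ^ 2 = a ^ 2 + ‖x‖ ^ 2 := by
  rw [EuclideanSpace.norm_sq_eq, EuclideanSpace.norm_sq_eq, Fin.sum_univ_succ]
  simp [mkv]

lemma vec_norm_sq {n : ℕ} (y : Fs n) : ‖y‖ ^ 2 = (y 0) ^ 2 + ‖tlv y‖ ^ 2 := by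
  rw [← mkv_norm_sq, mkv_eta]

lemma continuous_mkv {n : ℕ} : Continuous (fun z : ℝ × Es n => mkv z.1 z.2) := by
  unfold mkv
  refine (PiLp.continuous_toLp 2 _).comp (continuous_pi fun i => ?_)
  refine Fin.cases ?_ (fun j => ?_) i
  · simpa using continuous_fst
  · simp only [Fin.cons_succ]; fun_prop

lemma continuous_tlv {n : ℕ} : Continuous (tlv (n := n)) := by
  unfold tlv
  refine (PiLp.continuous_toLp 2 _).comp (continuous_pi fun i => ?_)
  fun_prop

/-- conformal factor denominators -/
lemma den_pos {n : ℕ} (x : Es n) : 0 < 1 + ‖x‖ ^ 2 := by positivity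

/-- inverse stereographic projection -/
def sig {n : ℕ} (x : Es n) : Sph n :=
  ⟨mkv ((‖x‖ ^ 2 - 1) / (1 + ‖x‖ ^ 2)) ((2 / (1 + ‖x‖ ^ 2)) • x), by
    have h := den_pos x
    have : ‖mkv ((‖x‖ ^ 2 - 1) / (1 + ‖x‖ ^ 2)) ((2 / (1 + ‖x‖ ^ 2)) • x)‖ ^ 2 = 1 := by
      rw [mkv_norm_sq, norm_smul, Real.norm_of_nonneg (by positivity)]
      field_simp; ring
    rw [mem_sphere_zero_iff_norm]
    exact (pow_eq_one_iff_of_nonneg (norm_nonneg _) two_ne_zero).1 this⟩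

/-- stereographic projection -/
def tau {n : ℕ} (y : Sph n) : Es n := (1 - (y : Fs n) 0)⁻¹ • tlv (y : Fs n)

/-- height -/
def hgt {n : ℕ} (y : Sph n) : ℝ := (y : Fs n) 0

lemma continuous_hgt {n : ℕ} : Continuous (hgt (n := n)) := by unfold hgt; fun_prop

lemma sig_val {n : ℕ} (x : Es n) : (sig x : Fs n) =
  mkv ((‖x‖ ^ 2 - 1) / (1 + ‖x‖ ^ 2)) ((2 / (1 + ‖x‖ ^ 2)) • x) := rfl

lemma hgt_sig {n : ℕ} (x : Es n) : hgt (sig x) = (‖x‖ ^ 2 - 1) / (1 + ‖x‖ ^ 2) := by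
  rw [hgt, sig_val, mkv_zero]

lemma sph_sq {n : ℕ} (y : Sph n) : (hgt y) ^ 2 + ‖tlv (y : Fs n)‖ ^ 2 = 1 := by
  rw [hgt, ← vec_norm_sq, sph_norm]; norm_num

lemma pole_val {n : ℕ} : (pole n : Fs n) = mkv 1 0 := by
  ext i; refine Fin.cases ?_ (fun j => ?_) i <;> simp [mkv, pole]

lemma hgt_pole {n : ℕ} : hgt (pole n) = 1 := by rw [hgt, pole_val, mkv_zero]

lemma hgt_lt {n : ℕ} {y : Sph n} (hy : y ≠ pole n) : hgt y < 1 := by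
  have h1 := sph_sq y
  by_contra h
  push Not at h
  have h2 : hgt y = 1 := by nlinarith [sq_nonneg ‖tlv (y : Fs n)‖]
  have h3 : ‖tlv (y : Fs n)‖ = 0 := by rw [h2] at h1; nlinarith
  apply hy; apply Subtype.ext
  rw [pole_val, ← mkv_eta (y : Fs n), norm_eq_zero.1 h3]
  congr 1

lemma sig_ne_pole {n : ℕ} (x : Es n) : sig x ≠ pole n := by
  intro h
  have := hgt_sig x
  rw [h, hgt_pole, eq_div_iff (den_pos x).ne'] at this
  linarith

lemma tau_sig {n : ℕ} (x : Es n) : tau (sig x) = x := by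
  have h := den_pos x
  have h1 := hgt_sig x
  rw [tau]
  change (1 - hgt (sig x))⁻¹ • _ = _
  rw [h1, sig_val, tlv_mkv, smul_smul]
  have : (1 - (‖x‖ ^ 2 - 1) / (1 + ‖x‖ ^ 2))⁻¹ * (2 / (1 + ‖x‖ ^ 2)) = 1 := by
    have : 1 - (‖x‖ ^ 2 - 1) / (1 + ‖x‖ ^ 2) = 2 / (1 + ‖x‖ ^ 2) := by field_simp; ring
    rw [this]; field_simp
  rw [this, one_smul]

lemma norm_tau_sq {n : ℕ} {y : Sph n} (hy : y ≠ pole n) :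
    ‖tau y‖ ^ 2 = (1 + hgt y) / (1 - hgt y) := by
  have h := hgt_lt hy
  have h1 := sph_sq y
  have h0 : 0 < 1 - hgt y := by linarith
  change ‖(1 - hgt y)⁻¹ • _‖ ^ 2 = _
  rw [norm_smul, Real.norm_of_nonneg (by positivity), mul_pow]
  have : ‖tlv (y : Fs n)‖ ^ 2 = (1 + hgt y) * (1 - hgt y) := by linarith
  rw [this]; field_simp

lemma sig_tau {n : ℕ} {y : Sph n} (hy : y ≠ pole n) : sig (tau y) = y := by
  have h := hgt_lt hy
  have h0 : 0 < 1 - hgt y := by linarith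
  apply Subtype.ext
  rw [sig_val, norm_tau_sq hy]
  conv_rhs => rw [← mkv_eta (y : Fs n)]
  congr 1
  · change _ = hgt y
    field_simp; ring
  · change _ • (1 - hgt y)⁻¹ • _ = _
    rw [smul_smul]
    have : 2 / (1 + (1 + hgt y) / (1 - hgt y)) * (1 - hgt y)⁻¹ = 1 := by
      field_simp; ring
    rw [this, one_smul]

lemma continuous_sig {n : ℕ} : Continuous (sig (n := n)) := by
  apply Continuous.subtype_mk
  refine continuous_mkv.comp (Continuous.prodMk ?_ ?_)
  · exact Continuous.div (by fun_prop) (by fun_prop) (fun x => (den_pos x).ne')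
  · exact Continuous.smul (Continuous.div (by fun_prop) (by fun_prop) (fun x => (den_pos x).ne')) continuous_id

lemma continuousOn_tau {n : ℕ} : ContinuousOn (tau (n := n)) {y | y ≠ pole n} := by
  unfold tau
  refine ContinuousOn.fun_smul (ContinuousOn.inv₀ (by fun_prop) ?_)
    (continuous_tlv.comp continuous_subtype_val).continuousOn
  intro y hy
  have := hgt_lt hy
  unfold hgt at this
  linarith

lemma sig_injective {n : ℕ} : Function.Injective (sig (n := n)) :=
  Function.LeftInverse.injective tau_sig

lemma sig_measEmb {n : ℕ} : MeasurableEmbedding (sig (n := n)) :=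
  continuous_sig.measurableEmbedding sig_injective

lemma sig_range {n : ℕ} : Set.range (sig (n := n)) = {pole n}ᶜ := by
  ext y; constructor
  · rintro ⟨x, rfl⟩; exact sig_ne_pole x
  · intro hy; exact ⟨tau y, sig_tau hy⟩

/-- conformal weight -/
def wgt {n : ℕ} (x : Es n) : ℝ := 2 / (1 + ‖x‖ ^ 2)

lemma wgt_pos {n : ℕ} (x : Es n) : 0 < wgt x := by unfold wgt; positivity

lemma continuous_wgt {n : ℕ} : Continuous (wgt (n := n)) :=
  Continuous.div (by fun_prop) (by fun_prop) (fun x => (den_pos x).ne')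

lemma dist_sig_sq {n : ℕ} (x y : Es n) : dist (sig x) (sig y) ^ 2 = wgt x * wgt y * dist x y ^ 2 := by
  have hx := den_pos x
  have hy := den_pos y
  rw [Subtype.dist_eq, dist_eq_norm, dist_eq_norm, sig_val, sig_val, mkv_sub, mkv_norm_sq,
    norm_sub_sq_real, norm_sub_sq_real, real_inner_smul_left, real_inner_smul_right, norm_smul,
    norm_smul, Real.norm_of_nonneg (by positivity), Real.norm_of_nonneg (by positivity), wgt, wgt]
  generalize inner ℝ x y = I
  field_simp
  ring

lemma dist_sig {n : ℕ} (x y : Es n) : dist (sig x) (sig y) = √(wgt x * wgt y) * dist x y := by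
  rw [← Real.sqrt_sq (dist_nonneg (x := sig x)), dist_sig_sq, Real.sqrt_mul
    (mul_pos (wgt_pos x) (wgt_pos y)).le, Real.sqrt_sq dist_nonneg]

lemma dist_sig_pole_sq {n : ℕ} (x : Es n) : dist (sig x) (pole n) ^ 2 = 4 / (1 + ‖x‖ ^ 2) := by
  have hx := den_pos x
  rw [Subtype.dist_eq, dist_eq_norm, sig_val, pole_val, mkv_sub, mkv_norm_sq, sub_zero, norm_smul,
    Real.norm_of_nonneg (by positivity)]
  field_simp; ring

/-- the isometry (reflection) exchanging `sig 0` and `q` -/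
def rotF {n : ℕ} (q : Sph n) : Fs n ≃ₗᵢ[ℝ] Fs n :=
  (Submodule.span ℝ {((sig 0 : Sph n) : Fs n) - (q : Fs n)})ᗮ.reflection

/-- on the sphere -/
def rot {n : ℕ} (q : Sph n) (y : Sph n) : Sph n := ⟨rotF q y, by simp⟩

lemma rot_rot {n : ℕ} (q y : Sph n) : rot q (rot q y) = y := by
  apply Subtype.ext; simp [rot, rotF]

lemma rot_zero {n : ℕ} (q : Sph n) : rot q (sig 0) = q := by
  apply Subtype.ext
  simp only [rot, rotF]
  exact Submodule.reflection_sub (by simp)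

lemma rot_dist {n : ℕ} (q y z : Sph n) : dist (rot q y) (rot q z) = dist y z := by
  rw [Subtype.dist_eq, Subtype.dist_eq]; exact (rotF q).dist_map _ _

/-- rotation as an isometry equivalence -/
def rotE {n : ℕ} (q : Sph n) : Sph n ≃ᵢ Sph n :=
  ⟨⟨rot q, rot q, rot_rot q, rot_rot q⟩, Isometry.of_dist_eq (rot_dist q)⟩

/-! ### Measures -/

/-- Hausdorff measure on the chart space -/
def muE (n : ℕ) : Measure (Es n) := μH[(n : ℝ)]
/-- Hausdorff measure on the sphere -/
def muS (n : ℕ) : Measure (Sph n) := μH[(n : ℝ)]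

instance muE_haar (n : ℕ) : (muE n).IsAddHaarMeasure := by
  have := isAddHaarMeasure_hausdorffMeasure (E := Es n)
  rw [finrank_euclideanSpace_fin] at this
  exact this

lemma muS_pole (n : ℕ) (hn : 1 ≤ n) (q : Sph n) : muS n {q} = 0 := by
  have := Measure.nullSingletonClass_hausdorff (Sph n) (d := (n : ℝ)) (by exact_mod_cast hn)
  exact measure_singleton (μ := μH[(n : ℝ)]) q

/-- weight -/
def Wn {n : ℕ} (x : Es n) : ℝ≥0∞ := ENNReal.ofReal (wgt x) ^ (n : ℝ)

lemma measurable_Wn {n : ℕ} : Measurable (Wn (n := n)) :=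
  (ENNReal.measurable_ofReal.comp continuous_wgt.measurable).pow_const _

lemma Wn_lt_top {n : ℕ} (x : Es n) : Wn x < ⊤ :=
  ENNReal.rpow_lt_top_of_nonneg (by positivity) ENNReal.ofReal_ne_top

lemma meas_le_of_pieces {X : Type*} [MeasurableSpace X] (a b : Measure X) (c : ℝ≥0∞)
    (P : ℤ → Set X) (hP : ∀ i, MeasurableSet (P i)) (hd : Pairwise (Function.onFun Disjoint P))
    (hu : ∀ x, ∃ i, x ∈ P i)
    (h : ∀ i D, MeasurableSet D → D ⊆ P i → a D ≤ c * b D) (D : Set X) (hD : MeasurableSet D) :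
    a D ≤ c * b D := by
  have e : D = ⋃ i, D ∩ P i := by
    rw [← Set.inter_iUnion, Set.iUnion_eq_univ_iff.2 hu, Set.inter_univ]
  have hd' : Pairwise (Function.onFun Disjoint fun i => D ∩ P i) := fun i j hij =>
    (hd hij).mono Set.inter_subset_right Set.inter_subset_right
  rw [e, measure_iUnion hd' (fun i => hD.inter (hP i)), measure_iUnion hd' (fun i => hD.inter (hP i)),
    ← ENNReal.tsum_mul_left]
  exact ENNReal.tsum_le_tsum fun i => h i _ (hD.inter (hP i)) Set.inter_subset_right

lemma le_of_forall_t {a b : ℝ≥0∞} (n : ℕ) (h : ∀ t : ℝ, 1 < t → a ≤ ENNReal.ofReal t ^ (n : ℝ) * b) :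
    a ≤ b := by
  have h1 : Filter.Tendsto (fun t : ℝ => ENNReal.ofReal t ^ (n : ℝ) * b) (nhdsWithin 1 (Set.Ioi 1))
      (nhds (1 * b)) := by
    apply ENNReal.Tendsto.mul_const _ (Or.inl one_ne_zero)
    have : Filter.Tendsto (fun t : ℝ => ENNReal.ofReal t ^ (n : ℝ)) (nhds 1)
        (nhds (ENNReal.ofReal 1 ^ (n : ℝ))) :=
      ((ENNReal.continuous_rpow_const).comp ENNReal.continuous_ofReal).tendsto 1
    simp only [ENNReal.ofReal_one, ENNReal.one_rpow] at this
    exact this.mono_left nhdsWithin_le_nhds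
  rw [one_mul] at h1
  exact ge_of_tendsto h1 (Filter.eventually_of_mem self_mem_nhdsWithin h)

section
variable {n : ℕ}

lemma piece_upper {a b : ℝ} (ha : 0 < a) (hb : 0 < b) {D : Set (Es n)} (hD : ∀ x ∈ D, a ≤ wgt x ∧ wgt x ≤ b) :
    muS n (sig '' D) ≤ ENNReal.ofReal b ^ (n : ℝ) * muE n D := by
  have : LipschitzOnWith (Real.toNNReal b) (sig (n := n)) D := by
    apply LipschitzOnWith.of_dist_le_mul
    intro x hx y hy
    rw [dist_sig, Real.coe_toNNReal _ hb.le]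
    gcongr
    rw [Real.sqrt_le_left hb.le, sq]
    exact mul_le_mul (hD x hx).2 (hD y hy).2 (wgt_pos _).le hb.le
  exact this.hausdorffMeasure_image_le (by positivity)

lemma piece_lower {a b : ℝ} (ha : 0 < a) {D : Set (Es n)} (hD : ∀ x ∈ D, a ≤ wgt x ∧ wgt x ≤ b) :
    muE n D ≤ ENNReal.ofReal a⁻¹ ^ (n : ℝ) * muS n (sig '' D) := by
  have : LipschitzOnWith (Real.toNNReal a⁻¹) (tau (n := n)) (sig '' D) := by
    apply LipschitzOnWith.of_dist_le_mul
    rintro _ ⟨x, hx, rfl⟩ _ ⟨y, hy, rfl⟩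
    rw [tau_sig, tau_sig, dist_sig, Real.coe_toNNReal _ (by positivity), ← mul_assoc]
    have : a ≤ √(wgt x * wgt y) := by
      apply Real.le_sqrt_of_sq_le
      rw [sq]
      exact mul_le_mul (hD x hx).1 (hD y hy).1 ha.le (wgt_pos _).le
    refine le_mul_of_one_le_left dist_nonneg ?_
    rw [inv_mul_eq_div, one_le_div ha]; exact this
  have h2 := this.hausdorffMeasure_image_le (d := (n : ℝ)) (by positivity)
  have e : tau '' (sig '' D) = D := by
    rw [← Set.image_comp]
    have : (tau ∘ sig : Es n → Es n) = id := funext tau_sig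
    rw [this, Set.image_id]
  rw [e] at h2
  exact h2

/-- pieces -/
def piece (n : ℕ) (t : ℝ) (i : ℤ) : Set (Es n) := {x | t ^ i ≤ wgt x ∧ wgt x < t ^ (i + 1)}

lemma piece_meas (t : ℝ) (i : ℤ) : MeasurableSet (piece n t i) :=
  (measurableSet_le measurable_const continuous_wgt.measurable).inter
    (measurableSet_lt continuous_wgt.measurable measurable_const)

lemma piece_disj {t : ℝ} (ht : 1 < t) : Pairwise (Function.onFun Disjoint (piece n t)) := by
  have key : ∀ i j : ℤ, i < j → Disjoint (piece n t i) (piece n t j) := by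
    intro i j hij
    rw [Set.disjoint_left]
    rintro x ⟨-, h2⟩ ⟨h3, -⟩
    have : t ^ (i + 1) ≤ t ^ j := zpow_le_zpow_right₀ ht.le (by omega)
    linarith
  intro i j hij
  rcases lt_or_gt_of_ne hij with h | h
  · exact key i j h
  · exact (key j i h).symm

lemma muS_sig_image (D : Set (Es n)) (hD : MeasurableSet D) :
    muS n (sig '' D) = ∫⁻ x in D, Wn x ∂(muE n) := by
  have e1 : ∀ D, muS n (sig '' D) = (Measure.comap sig (muS n)) D := fun D =>
    (sig_measEmb.comap_apply (muS n) D).symm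
  have e2 : ∀ D : Set (Es n), MeasurableSet D → ∫⁻ x in D, Wn x ∂(muE n) = ((muE n).withDensity Wn) D :=
    fun D hD => (withDensity_apply _ hD).symm
  have hcov : ∀ t : ℝ, 1 < t → ∀ x : Es n, ∃ i, x ∈ piece n t i := fun t ht x =>
    exists_mem_Ico_zpow (wgt_pos x) ht
  have hz : ∀ t : ℝ, 1 < t → ∀ i : ℤ, ENNReal.ofReal (t ^ (i + 1)) ^ (n : ℝ) =
      ENNReal.ofReal t ^ (n : ℝ) * ENNReal.ofReal (t ^ i) ^ (n : ℝ) := by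
    intro t ht i
    have h0 : 0 < t := by linarith
    rw [← ENNReal.mul_rpow_of_nonneg _ _ (by positivity), ← ENNReal.ofReal_mul h0.le, zpow_add_one₀ h0.ne',
      mul_comm]
  apply le_antisymm
  · apply le_of_forall_t n
    intro t ht
    have h0 : 0 < t := by linarith
    rw [e1, e2 D hD]
    refine meas_le_of_pieces _ _ _ (piece n t) (piece_meas t) (piece_disj ht) (hcov t ht) ?_ D hD
    intro i D hD hDi
    rw [← e1, ← e2 D hD]
    refine (piece_upper (a := t ^ i) (b := t ^ (i + 1)) (by positivity) (by positivity)
      (fun x hx => ⟨(hDi hx).1, (hDi hx).2.le⟩)).trans ?_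
    rw [hz t ht, mul_assoc]
    gcongr
    rw [← setLIntegral_const]
    refine setLIntegral_mono measurable_Wn fun x hx => ?_
    exact ENNReal.rpow_le_rpow (ENNReal.ofReal_le_ofReal (hDi hx).1) (by positivity)
  · apply le_of_forall_t n
    intro t ht
    have h0 : 0 < t := by linarith
    rw [e1, e2 D hD]
    refine meas_le_of_pieces _ _ _ (piece n t) (piece_meas t) (piece_disj ht) (hcov t ht) ?_ D hD
    intro i D hD hDi
    rw [← e1, ← e2 D hD]
    have h3 : ∫⁻ x in D, Wn x ∂(muE n) ≤ ENNReal.ofReal (t ^ (i + 1)) ^ (n : ℝ) * muE n D := by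
      rw [← setLIntegral_const]
      refine setLIntegral_mono measurable_const fun x hx => ?_
      exact ENNReal.rpow_le_rpow (ENNReal.ofReal_le_ofReal (hDi hx).2.le) (by positivity)
    refine h3.trans ?_
    rw [hz t ht, mul_assoc]
    gcongr
    have h4 := piece_lower (a := t ^ i) (b := t ^ (i + 1)) (by positivity)
      (fun x hx => ⟨(hDi hx).1, (hDi hx).2.le⟩)
    calc _ ≤ ENNReal.ofReal (t ^ i) ^ (n : ℝ) * (ENNReal.ofReal (t ^ i)⁻¹ ^ (n : ℝ) * muS n (sig '' D)) := by
          gcongr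
      _ = _ := by
          rw [← mul_assoc, ← ENNReal.mul_rpow_of_nonneg _ _ (by positivity), ← ENNReal.ofReal_mul (by positivity),
            mul_inv_cancel₀ (by positivity)]
          simp

lemma muS_eq_map (hn : 1 ≤ n) : muS n = Measure.map sig ((muE n).withDensity Wn) := by
  ext B hB
  rw [sig_measEmb.map_apply, withDensity_apply _ (continuous_sig.measurable hB), ← muS_sig_image _
    (continuous_sig.measurable hB), Set.image_preimage_eq_inter_range, sig_range]
  apply le_antisymm
  · calc muS n B ≤ muS n ((B ∩ {pole n}ᶜ) ∪ {pole n}) := measure_mono (by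
          intro y hy
          by_cases h : y = pole n
          · right; exact h
          · left; exact ⟨hy, h⟩)
      _ ≤ _ := measure_union_le _ _
      _ = _ := by rw [muS_pole n hn, add_zero]
  · exact measure_mono Set.inter_subset_left

lemma lintegral_muS (hn : 1 ≤ n) (g : Sph n → ℝ≥0∞) :
    ∫⁻ y, g y ∂(muS n) = ∫⁻ x, Wn x * g (sig x) ∂(muE n) := by
  rw [muS_eq_map hn, sig_measEmb.lintegral_map,
    lintegral_withDensity_eq_lintegral_mul_non_measurable _ measurable_Wn
      (Filter.Eventually.of_forall Wn_lt_top)]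
  rfl

lemma muS_finite (hn : 1 ≤ n) : muS n Set.univ < ⊤ := by
  have h0 : muS n Set.univ = ∫⁻ y, 1 ∂(muS n) := by simp
  rw [h0, lintegral_muS hn]
  have hi := integrable_rpow_neg_one_add_norm_sq (E := Es n) (μ := muE n) (r := 2 * n) (by
    rw [finrank_euclideanSpace_fin]
    have : (1 : ℝ) ≤ n := by exact_mod_cast hn
    linarith)
  have := (hi.const_mul ((2 : ℝ) ^ (n : ℝ))).lintegral_lt_top
  refine lt_of_le_of_lt (le_of_eq (lintegral_congr fun x => ?_)) this
  rw [mul_one, Wn, ENNReal.ofReal_rpow_of_nonneg (wgt_pos x).le (by positivity), wgt,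
    Real.div_rpow (by norm_num) (den_pos x).le, div_eq_mul_inv, ← Real.rpow_neg (den_pos x).le]
  congr 3
  ring

lemma muS_rot (q : Sph n) : MeasurePreserving (rot q) (muS n) (muS n) :=
  (rotE q).measurePreserving_hausdorffMeasure _

lemma rot_emb (q : Sph n) : MeasurableEmbedding (rot q) :=
  (rotE q).toHomeomorph.measurableEmbedding

end

/-! ### Kernels and energies -/

section
variable {n : ℕ} {X : Type*} [MetricSpace X]

/-- the singular kernel -/
def Dk (n : ℕ) {X : Type*} [MetricSpace X] (x y : X) : ℝ≥0∞ :=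
  ENNReal.ofReal ((dist x y ^ (2 * (n : ℝ)))⁻¹)

/-- the energy density -/
def ker {n : ℕ} {X : Type*} [MetricSpace X] (p : ℝ) (f : X → Fs n) (x y : X) : ℝ≥0∞ :=
  ENNReal.ofReal (‖f x - f y‖ ^ p) * Dk n x y

lemma Dk_comm (x y : X) : Dk n x y = Dk n y x := by rw [Dk, Dk, dist_comm]

lemma ker_comm (p : ℝ) (f : X → Fs n) (x y : X) : ker p f x y = ker p f y x := by
  rw [ker, ker, Dk_comm, norm_sub_rev]

variable [MeasurableSpace X] [BorelSpace X] [SecondCountableTopology X]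

lemma measurable_Dk : Measurable (fun z : X × X => Dk n z.1 z.2) := by
  unfold Dk
  exact ENNReal.measurable_ofReal.comp ((measurable_dist.pow_const _).inv)

lemma measurable_ker {p : ℝ} {f : X → Fs n} (hf : Measurable f) :
    Measurable (fun z : X × X => ker p f z.1 z.2) := by
  unfold ker
  refine Measurable.mul ?_ measurable_Dk
  exact ENNReal.measurable_ofReal.comp
    ((((hf.comp measurable_fst).sub (hf.comp measurable_snd)).norm).pow_const _)

/-- mutual energy -/
def en (μ : Measure X) (p : ℝ) (f : X → Fs n) (A B : Set X) : ℝ≥0∞ :=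
  ∫⁻ x in A, ∫⁻ y in B, ker p f x y ∂μ ∂μ

/-- energy measure -/
def nu (μ : Measure X) (p : ℝ) (f : X → Fs n) (A : Set X) : ℝ≥0∞ :=
  ∫⁻ x in A, ∫⁻ y, ker p f x y ∂μ ∂μ

lemma nu_eq_en (μ : Measure X) (p : ℝ) (f : X → Fs n) (A : Set X) :
    nu μ p f A = en μ p f A Set.univ := by
  simp [nu, en]

lemma en_comm (μ : Measure X) [SFinite μ] (p : ℝ) {f : X → Fs n} (hf : Measurable f) (A B : Set X) :
    en μ p f A B = en μ p f B A := by
  unfold en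
  rw [lintegral_lintegral_swap]
  · simp only [ker_comm p f]
  · exact (measurable_ker hf).aemeasurable

lemma en_mono (μ : Measure X) (p : ℝ) (f : X → Fs n) {A A' B B' : Set X} (h : A ⊆ A') (h' : B ⊆ B') :
    en μ p f A B ≤ en μ p f A' B' := by
  unfold en
  exact (lintegral_mono_set h).trans (lintegral_mono fun x => lintegral_mono_set h')

lemma nu_mono (μ : Measure X) (p : ℝ) (f : X → Fs n) {A A' : Set X} (h : A ⊆ A') :
    nu μ p f A ≤ nu μ p f A' := by
  rw [nu_eq_en, nu_eq_en]; exact en_mono μ p f h subset_rfl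

lemma en_le_nu (μ : Measure X) (p : ℝ) (f : X → Fs n) (A B : Set X) :
    en μ p f A B ≤ nu μ p f A := by
  rw [nu_eq_en]; exact en_mono μ p f subset_rfl (Set.subset_univ _)

lemma en_union_left (μ : Measure X) (p : ℝ) (f : X → Fs n) {A A' : Set X} (hA : MeasurableSet A')
    (hd : Disjoint A A') (B : Set X) :
    en μ p f (A ∪ A') B = en μ p f A B + en μ p f A' B := by
  unfold en; rw [lintegral_union hA hd]

lemma en_union_right (μ : Measure X) [SFinite μ] (p : ℝ) {f : X → Fs n} (hf : Measurable f) {B B' : Set X}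
    (hB : MeasurableSet B')
    (hd : Disjoint B B') (A : Set X) :
    en μ p f A (B ∪ B') = en μ p f A B + en μ p f A B' := by
  rw [en_comm μ p hf, en_union_left μ p f hB hd, en_comm μ p hf, en_comm μ p hf B']

lemma en_union_le (μ : Measure X) (p : ℝ) (f : X → Fs n) (A A' B : Set X) :
    en μ p f (A ∪ A') B ≤ en μ p f A B + en μ p f A' B := by
  unfold en
  exact lintegral_union_le _ _ _

lemma nu_union_le (μ : Measure X) (p : ℝ) (f : X → Fs n) (A A' : Set X) :
    nu μ p f (A ∪ A') ≤ nu μ p f A + nu μ p f A' := by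
  unfold nu
  exact lintegral_union_le _ _ _

lemma nu_union (μ : Measure X) (p : ℝ) (f : X → Fs n) {A A' : Set X} (hA : MeasurableSet A')
    (hd : Disjoint A A') :
    nu μ p f (A ∪ A') = nu μ p f A + nu μ p f A' := by
  unfold nu; rw [lintegral_union hA hd]

lemma nu_compl (μ : Measure X) (p : ℝ) (f : X → Fs n) {A : Set X} (hA : MeasurableSet A) :
    nu μ p f A + nu μ p f Aᶜ = nu μ p f Set.univ := by
  rw [← nu_union μ p f hA.compl disjoint_compl_right, Set.union_compl_self]

lemma measurable_inner {μ : Measure X} [SFinite μ] {p : ℝ} {f : X → Fs n} (hf : Measurable f) :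
    Measurable (fun x => ∫⁻ y, ker p f x y ∂μ) :=
  (measurable_ker hf).lintegral_prod_right'

end

/-! ### Conformal covariance -/

section
variable {n : ℕ}

/-- coercion of maps -/
def cv {X : Type*} (f : X → Sph n) (x : X) : Fs n := f x

lemma setLIntegral_muS (hn : 1 ≤ n) (g : Sph n → ℝ≥0∞) {B : Set (Sph n)} (hB : MeasurableSet B) :
    ∫⁻ y in B, g y ∂(muS n) = ∫⁻ x in sig ⁻¹' B, Wn x * g (sig x) ∂(muE n) := by
  rw [← lintegral_indicator hB, lintegral_muS hn, ← lintegral_indicator (continuous_sig.measurable hB)]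
  refine lintegral_congr fun x => ?_
  by_cases h : sig x ∈ B
  · simp [Set.indicator, h]
  · simp [Set.indicator, h]

lemma Wn_Dk (x y : Es n) (hxy : x ≠ y) : Wn x * (Wn y * Dk n (sig x) (sig y)) = Dk n x y := by
  have hx := wgt_pos x
  have hy := wgt_pos y
  have hd := dist_pos.2 hxy
  rw [Dk, Dk, Wn, Wn, ENNReal.ofReal_rpow_of_pos hx, ENNReal.ofReal_rpow_of_pos hy,
    ← ENNReal.ofReal_mul (by positivity), ← ENNReal.ofReal_mul (by positivity), Real.rpow_mul dist_nonneg,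
    Real.rpow_mul dist_nonneg, Real.rpow_two, Real.rpow_two, dist_sig_sq]
  congr 1
  rw [Real.mul_rpow (by positivity) (by positivity), Real.mul_rpow (by positivity) (by positivity)]
  field_simp

lemma ker_sig {p : ℝ} (hp : 0 < p) (g : Sph n → Fs n) (x y : Es n) :
    Wn x * (Wn y * ker p g (sig x) (sig y)) = ker p (g ∘ sig) x y := by
  by_cases h : x = y
  · subst h; simp [ker, Real.zero_rpow hp.ne']
  · rw [ker, ker, ← Wn_Dk x y h]
    simp only [Function.comp]
    ring

lemma en_sig (hn : 1 ≤ n) {p : ℝ} (hp : 0 < p) (g : Sph n → Fs n) {A B : Set (Sph n)}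
    (hA : MeasurableSet A) (hB : MeasurableSet B) :
    en (muS n) p g A B = en (muE n) p (g ∘ sig) (sig ⁻¹' A) (sig ⁻¹' B) := by
  unfold en
  rw [setLIntegral_muS hn _ hA]
  refine lintegral_congr fun x => ?_
  rw [setLIntegral_muS hn _ hB, ← lintegral_const_mul' _ _ (Wn_lt_top x).ne]
  exact lintegral_congr fun y => ker_sig hp g x y

lemma nu_sig (hn : 1 ≤ n) {p : ℝ} (hp : 0 < p) (g : Sph n → Fs n) {A : Set (Sph n)}
    (hA : MeasurableSet A) :
    nu (muS n) p g A = nu (muE n) p (g ∘ sig) (sig ⁻¹' A) := by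
  rw [nu_eq_en, nu_eq_en, en_sig hn hp g hA MeasurableSet.univ, Set.preimage_univ]

/-- affine maps -/
def mob (a : Es n) (ρ : ℝ) (x : Es n) : Es n := a + ρ • x

lemma continuous_mob (a : Es n) (ρ : ℝ) : Continuous (mob a ρ) := by unfold mob; fun_prop

lemma mob_inv (a : Es n) {ρ : ℝ} (hρ : 0 < ρ) (x : Es n) :
    mob a ρ (mob (-(ρ⁻¹ • a)) ρ⁻¹ x) = x := by
  simp [mob, smul_smul, hρ.ne']

lemma mob_inv2 (a : Es n) {ρ : ℝ} (hρ : 0 < ρ) (x : Es n) :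
    mob (-(ρ⁻¹ • a)) ρ⁻¹ (mob a ρ x) = x := by
  simp [mob, smul_smul, hρ.ne']

lemma mob_dist (a : Es n) {ρ : ℝ} (hρ : 0 < ρ) (x y : Es n) :
    dist (mob a ρ x) (mob a ρ y) = ρ * dist x y := by
  simp [mob, dist_smul₀, abs_of_pos hρ]

lemma lintegral_mob (a : Es n) {ρ : ℝ} (hρ : 0 < ρ) (g : Es n → ℝ≥0∞) :
    ∫⁻ x, g x ∂(muE n) = ∫⁻ x, ENNReal.ofReal (ρ ^ n) * g (mob a ρ x) ∂(muE n) := by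
  rw [lintegral_const_mul' _ _ ENNReal.ofReal_ne_top]
  have h1 : ∫⁻ x, g (mob a ρ x) ∂(muE n) = ∫⁻ x, g (a + x) ∂(Measure.map (ρ • ·) (muE n)) := by
    have : MeasurableEmbedding (fun x : Es n => ρ • x) :=
      (Homeomorph.smulOfNeZero ρ hρ.ne').measurableEmbedding
    rw [this.lintegral_map]; rfl
  rw [h1, Measure.map_addHaar_smul _ hρ.ne', lintegral_smul_measure, finrank_euclideanSpace_fin,
    lintegral_add_left_eq_self g a, smul_eq_mul, ← mul_assoc, ← ENNReal.ofReal_mul (by positivity),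
    abs_of_pos (by positivity), mul_inv_cancel₀ (by positivity)]
  simp

lemma setLIntegral_mob (a : Es n) {ρ : ℝ} (hρ : 0 < ρ) (g : Es n → ℝ≥0∞) {B : Set (Es n)} (hB : MeasurableSet B) :
    ∫⁻ x in B, g x ∂(muE n) = ∫⁻ x in mob a ρ ⁻¹' B, ENNReal.ofReal (ρ ^ n) * g (mob a ρ x) ∂(muE n) := by
  rw [← lintegral_indicator hB, lintegral_mob a hρ, ← lintegral_indicator ((continuous_mob a ρ).measurable hB)]
  refine lintegral_congr fun x => ?_
  by_cases h : mob a ρ x ∈ B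
  · simp [Set.indicator, h]
  · simp [Set.indicator, h]

lemma en_mob {p : ℝ} (f : Es n → Fs n) (a : Es n) {ρ : ℝ} (hρ : 0 < ρ) {A B : Set (Es n)}
    (hA : MeasurableSet A) (hB : MeasurableSet B) :
    en (muE n) p f A B = en (muE n) p (f ∘ mob a ρ) (mob a ρ ⁻¹' A) (mob a ρ ⁻¹' B) := by
  unfold en
  rw [setLIntegral_mob a hρ _ hA]
  refine lintegral_congr fun x => ?_
  rw [setLIntegral_mob a hρ _ hB, ← lintegral_const_mul' _ _ ENNReal.ofReal_ne_top]
  refine lintegral_congr fun y => ?_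
  simp only [ker, Function.comp]
  have : ENNReal.ofReal (ρ ^ n) * (ENNReal.ofReal (ρ ^ n) * Dk n (mob a ρ x) (mob a ρ y)) = Dk n x y := by
    rw [Dk, Dk, mob_dist a hρ, Real.mul_rpow hρ.le dist_nonneg, ← ENNReal.ofReal_mul (by positivity),
      ← ENNReal.ofReal_mul (by positivity)]
    congr 1
    have e : ρ ^ (2 * (n : ℝ)) = ρ ^ n * ρ ^ n := by
      rw [two_mul, Real.rpow_add hρ, Real.rpow_natCast]
    rw [e]
    have : ρ ^ n ≠ 0 := by positivity
    rw [mul_inv, mul_inv]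
    field_simp
  rw [← this]; ring

lemma nu_mob {p : ℝ} (f : Es n → Fs n) (a : Es n) {ρ : ℝ} (hρ : 0 < ρ) {A : Set (Es n)}
    (hA : MeasurableSet A) :
    nu (muE n) p f A = nu (muE n) p (f ∘ mob a ρ) (mob a ρ ⁻¹' A) := by
  rw [nu_eq_en, nu_eq_en, en_mob f a hρ hA MeasurableSet.univ, Set.preimage_univ]

lemma nu_rot {p : ℝ} (f : Sph n → Fs n) (q : Sph n) {A : Set (Sph n)} (hA : MeasurableSet A) :
    nu (muS n) p f A = nu (muS n) p (f ∘ rot q) (rot q ⁻¹' A) := by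
  unfold nu
  rw [← (muS_rot q).setLIntegral_comp_preimage_emb (rot_emb q)]
  refine lintegral_congr fun x => ?_
  rw [← (muS_rot q).lintegral_comp_emb (rot_emb q)]
  refine lintegral_congr fun y => ?_
  simp only [ker, Function.comp, Dk, rot_dist]

/-! ### Möbius maps on the sphere and extension -/

open Classical in
/-- Möbius map -/
def mobS (a : Es n) (ρ : ℝ) (y : Sph n) : Sph n := if y = pole n then pole n else sig (mob a ρ (tau y))

lemma mobS_sig (a : Es n) (ρ : ℝ) (x : Es n) : mobS a ρ (sig x) = sig (mob a ρ x) := by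
  rw [mobS, if_neg (sig_ne_pole x), tau_sig]

lemma mobS_inv (a : Es n) {ρ : ℝ} (hρ : 0 < ρ) (y : Sph n) :
    mobS a ρ (mobS (-(ρ⁻¹ • a)) ρ⁻¹ y) = y := by
  by_cases h : y = pole n
  · simp [mobS, h]
  · rw [← sig_tau h, mobS_sig, mobS_sig, mob_inv a hρ]

lemma isOpen_ne_pole : IsOpen {y : Sph n | y ≠ pole n} := isOpen_compl_singleton

lemma continuous_mobS (a : Es n) {ρ : ℝ} (hρ : 0 < ρ) : Continuous (mobS a ρ) := by
  rw [continuous_iff_continuousAt]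
  intro y
  by_cases h : y = pole n
  · subst h
    have key : ∀ y : Sph n, dist (mobS a ρ y) (pole n) ≤
        √(1 + 2 * (ρ⁻¹) ^ 2 * (1 + ‖a‖ ^ 2)) * dist y (pole n) := by
      intro y
      by_cases h : y = pole n
      · simp [mobS, h]
      rw [← sig_tau h, mobS_sig]
      generalize tau y = x
      apply le_of_sq_le_sq _ (by positivity)
      rw [mul_pow, Real.sq_sqrt (by positivity), dist_sig_pole_sq, dist_sig_pole_sq]
      rw [mul_div_assoc', div_le_div_iff₀ (den_pos _) (den_pos _)]
      have hx : ‖x‖ ≤ ρ⁻¹ * (‖mob a ρ x‖ + ‖a‖) := by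
        have : x = ρ⁻¹ • (mob a ρ x - a) := by simp [mob, smul_smul, hρ.ne']
        calc ‖x‖ = ‖ρ⁻¹ • (mob a ρ x - a)‖ := by rw [← this]
          _ = ρ⁻¹ * ‖mob a ρ x - a‖ := by rw [norm_smul, Real.norm_of_nonneg (by positivity)]
          _ ≤ _ := by gcongr; exact norm_sub_le _ _
      have hr : 0 < ρ⁻¹ := by positivity
      generalize ρ⁻¹ = r at *
      have hz := norm_nonneg (mob a ρ x)
      have ha := norm_nonneg a
      generalize ‖mob a ρ x‖ = z at *
      generalize ‖a‖ = α at *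
      have h2 : ‖x‖ ^ 2 ≤ r ^ 2 * (z + α) ^ 2 := by
        rw [← mul_pow]; exact pow_le_pow_left₀ (norm_nonneg _) hx 2
      have h3 : (z + α) ^ 2 ≤ 2 * (1 + α ^ 2) * (1 + z ^ 2) := by
        nlinarith [sq_nonneg (z - α), mul_nonneg (sq_nonneg z) (sq_nonneg α)]
      have h4 : r ^ 2 * (z + α) ^ 2 ≤ r ^ 2 * (2 * (1 + α ^ 2) * (1 + z ^ 2)) := by gcongr
      nlinarith [sq_nonneg z]
    have e : mobS a ρ (pole n) = pole n := by simp [mobS]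
    rw [ContinuousAt, e, tendsto_iff_dist_tendsto_zero]
    refine squeeze_zero (fun _ => dist_nonneg) key ?_
    have : Continuous fun y : Sph n => √(1 + 2 * (ρ⁻¹) ^ 2 * (1 + ‖a‖ ^ 2)) * dist y (pole n) := by fun_prop
    simpa using this.tendsto (pole n)
  · have h1 : ContinuousOn (fun y : Sph n => sig (mob a ρ (tau y))) {y | y ≠ pole n} :=
      (continuous_sig.comp (continuous_mob a ρ)).comp_continuousOn continuousOn_tau
    refine (h1.continuousAt (isOpen_ne_pole.mem_nhds h)).congr ?_
    filter_upwards [isOpen_ne_pole.mem_nhds h] with z hz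
    rw [mobS, if_neg hz]

open Classical in
/-- extension of a map on the chart -/
def ext {Y : Type*} (c : Y) (g : Es n → Y) (y : Sph n) : Y := if y = pole n then c else g (tau y)

lemma ext_sig {Y : Type*} (c : Y) (g : Es n → Y) (x : Es n) : ext c g (sig x) = g x := by
  rw [ext, if_neg (sig_ne_pole x), tau_sig]

lemma ext_pole {Y : Type*} (c : Y) (g : Es n → Y) : ext c g (pole n) = c := by
  rw [ext, if_pos rfl]

lemma nhds_pole (R : ℝ) : ∀ᶠ y : Sph n in nhds (pole n), y = pole n ∨ R ≤ ‖tau y‖ := by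
  have : ∀ᶠ y : Sph n in nhds (pole n), (R ^ 2 - 1) / (1 + R ^ 2) < hgt y := by
    apply continuous_hgt.continuousAt.eventually (lt_mem_nhds _)
    rw [hgt_pole, div_lt_one (by positivity)]; linarith
  filter_upwards [this] with y hy
  by_cases h : y = pole n
  · exact Or.inl h
  right
  apply le_of_sq_le_sq _ (norm_nonneg _)
  have h1 := hgt_lt h
  rw [norm_tau_sq h, le_div_iff₀ (by linarith)]
  rw [div_lt_iff₀ (by positivity)] at hy
  nlinarith

lemma continuous_ext {X Y : Type*} [TopologicalSpace X] [TopologicalSpace Y] {g : X × Es n → Y}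
    (hg : Continuous g) {h : X × Sph n → Y} (hh : Continuous h) (R : ℝ)
    (hgh : ∀ t x, R ≤ ‖x‖ → g (t, x) = h (t, sig x)) :
    Continuous (fun z : X × Sph n => ext (h (z.1, pole n)) (fun x => g (z.1, x)) z.2) := by
  rw [continuous_iff_continuousAt]
  rintro ⟨t, y⟩
  by_cases hy : y = pole n
  · subst hy
    refine hh.continuousAt.congr ?_
    have := (continuous_snd.tendsto (t, pole n)).eventually (nhds_pole (n := n) R)
    filter_upwards [this] with z hz
    rcases z with ⟨t', y'⟩
    by_cases h : y' = pole n
    · subst h; simp [ext]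
    · simp only [h, false_or] at hz
      simp only [ext, h, if_false]
      rw [hgh _ _ hz, sig_tau h]
  · have h1 : ContinuousOn (fun z : X × Sph n => g (z.1, tau z.2)) {z | z.2 ≠ pole n} := by
      refine hg.comp_continuousOn (continuous_fst.continuousOn.prodMk ?_)
      exact continuousOn_tau.comp continuous_snd.continuousOn (fun z hz => hz)
    have ho : IsOpen {z : X × Sph n | z.2 ≠ pole n} := isOpen_ne_pole.preimage continuous_snd
    refine (h1.continuousAt (ho.mem_nhds hy)).congr ?_
    filter_upwards [ho.mem_nhds hy] with z hz
    have hz' : z.2 ≠ pole n := hz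
    simp [ext, hz']

end

section
variable {n : ℕ}

lemma sphEnergy_eq (s : ℝ) (u : Sph n → Sph n) :
    sphEnergy n s u = nu (muS n) ((n : ℝ) / s) (cv u) Set.univ := by
  unfold sphEnergy nu
  rw [Measure.restrict_univ]
  refine lintegral_congr fun x => lintegral_congr fun y => ?_
  rw [ker, Dk, ← ENNReal.ofReal_mul (by positivity), div_eq_mul_inv]
  rfl

/-- basic constant -/
def Jc (n : ℕ) (p : ℝ) : ℝ≥0∞ := ∫⁻ y : Es n, ENNReal.ofReal (min 1 ‖y‖ ^ p) * Dk n 0 y ∂(muE n)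

lemma Jc_lt_top (hn : 1 ≤ n) {p : ℝ} (hp : (n : ℝ) < p) : Jc n p < ⊤ := by
  have : Nontrivial (Es n) := by
    have : Nonempty (Fin n) := ⟨⟨0, hn⟩⟩
    infer_instance
  set φ : ℝ → ℝ := fun r => min 1 r ^ p * (r ^ (2 * (n : ℝ)))⁻¹ with hφ
  have hi : Integrable (fun x : Es n => φ ‖x‖) (muE n) := by
    rw [integrable_fun_norm_addHaar, finrank_euclideanSpace_fin]
    rw [← Set.Ioc_union_Ioi_eq_Ioi (zero_le_one' ℝ)]
    have hpow : ∀ y : ℝ, 0 < y → y ^ (n - 1) = y ^ ((n : ℝ) - 1) := by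
      intro y hy
      rw [← Real.rpow_natCast, Nat.cast_sub hn, Nat.cast_one]
    apply IntegrableOn.union
    · have h1 : IntegrableOn (fun y : ℝ => y ^ (p - n - 1)) (Set.Ioc 0 1) := by
        rw [← intervalIntegrable_iff_integrableOn_Ioc_of_le zero_le_one]
        exact intervalIntegral.intervalIntegrable_rpow' (by linarith)
      refine h1.congr_fun ?_ measurableSet_Ioc
      intro y hy
      simp only [hφ, smul_eq_mul]
      rw [min_eq_right hy.2, hpow y hy.1, ← Real.rpow_neg hy.1.le, ← Real.rpow_add hy.1, ← Real.rpow_add hy.1]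
      congr 1; ring
    · have h1 : IntegrableOn (fun y : ℝ => y ^ (-(n : ℝ) - 1)) (Set.Ioi 1) := by
        apply integrableOn_Ioi_rpow_of_lt _ one_pos
        have : (1 : ℝ) ≤ n := by exact_mod_cast hn
        linarith
      refine h1.congr_fun ?_ measurableSet_Ioi
      intro y hy
      have hy1 : 1 < y := hy
      have hy0 : 0 < y := by linarith
      simp only [hφ, smul_eq_mul]
      rw [min_eq_left hy1.le, hpow y hy0, ← Real.rpow_neg hy0.le, Real.one_rpow, one_mul, ← Real.rpow_add hy0]
      congr 1; ring
  refine lt_of_le_of_lt (le_of_eq (lintegral_congr fun x => ?_)) hi.lintegral_lt_top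
  rw [Dk, ← ENNReal.ofReal_mul (by positivity), dist_zero_left]

lemma Jc_translate (p : ℝ) (x : Es n) :
    ∫⁻ y : Es n, ENNReal.ofReal (min 1 (dist x y) ^ p) * Dk n x y ∂(muE n) = Jc n p := by
  unfold Jc
  rw [← lintegral_add_left_eq_self (μ := muE n) _ x]
  refine lintegral_congr fun y => ?_
  simp [Dk]

lemma id_inner (hn : 1 ≤ n) {p : ℝ} (hp : (n : ℝ) < p) (x : Sph n) :
    ∫⁻ y, ker p (cv (id : Sph n → Sph n)) x y ∂(muS n) ≤ ENNReal.ofReal (2 ^ p) * Jc n p := by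
  have hp0 : 0 < p := lt_of_le_of_lt (by positivity) hp
  have hn1 : (1 : ℝ) ≤ n := by exact_mod_cast hn
  rw [← (muS_rot x).lintegral_comp_emb (rot_emb x)]
  have e : ∀ y, ker p (cv (id : Sph n → Sph n)) x (rot x y) = ker p (cv (id : Sph n → Sph n)) (sig 0) y := by
    intro y
    conv_lhs => rw [← rot_zero x]
    rw [ker, ker, Dk, Dk, rot_zero]
    have : dist x (rot x y) = dist (sig 0) y := by
      conv_lhs => enter [1]; rw [← rot_zero x]
      rw [rot_dist]
    rw [this]
    congr 2
    have h1 : ‖cv id x - cv id (rot x y)‖ = dist x (rot x y) := by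
      rw [Subtype.dist_eq, dist_eq_norm]; rfl
    have h2 : ‖cv id (sig 0) - cv id y‖ = dist (sig 0) y := by
      rw [Subtype.dist_eq, dist_eq_norm]; rfl
    rw [h1, h2, this]
  simp_rw [e]
  rw [lintegral_muS hn, Jc, ← lintegral_const_mul' _ _ ENNReal.ofReal_ne_top]
  refine lintegral_mono fun y => ?_
  by_cases hy : (0 : Es n) = y
  · subst hy
    simp [ker, Real.zero_rpow hp0.ne']
  rw [← Wn_Dk 0 y hy, ker]
  have hW : 1 ≤ Wn (0 : Es n) := by
    rw [Wn, wgt]; simp only [norm_zero]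
    apply ENNReal.one_le_rpow _ (by linarith)
    norm_num
  have hd : ‖cv id (sig 0) - cv id (sig y)‖ ≤ 2 * min 1 ‖y‖ := by
    have h2 : ‖cv id (sig 0) - cv id (sig y)‖ = dist (sig 0) (sig y) := by
      rw [Subtype.dist_eq, dist_eq_norm]; rfl
    rw [h2]
    apply le_of_sq_le_sq _ (by positivity)
    rw [dist_sig_sq, wgt, wgt, dist_zero_left, norm_zero]
    rcases le_total 1 ‖y‖ with h | h
    · rw [min_eq_left h]
      have := den_pos y
      norm_num
      rw [mul_div_assoc', div_mul_eq_mul_div, div_le_iff₀ this]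
      nlinarith
    · rw [min_eq_right h]
      have h1 : 2 / (1 + ‖y‖ ^ 2) ≤ 2 := by
        rw [div_le_iff₀ (den_pos y)]; nlinarith [sq_nonneg ‖y‖]
      calc _ ≤ 2 / (1 + 0 ^ 2) * 2 * ‖y‖ ^ 2 := by gcongr
        _ = _ := by norm_num; ring
  have hd2 : ENNReal.ofReal (‖cv id (sig 0) - cv id (sig y)‖ ^ p) ≤
      ENNReal.ofReal (2 ^ p) * ENNReal.ofReal (min 1 ‖y‖ ^ p) := by
    rw [← ENNReal.ofReal_mul (by positivity), ← Real.mul_rpow (by norm_num) (by positivity)]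
    exact ENNReal.ofReal_le_ofReal (Real.rpow_le_rpow (norm_nonneg _) hd hp0.le)
  calc _ ≤ Wn y * ((ENNReal.ofReal (2 ^ p) * ENNReal.ofReal (min 1 ‖y‖ ^ p)) * Dk n (sig 0) (sig y)) := by
        gcongr
    _ = 1 * (Wn y * ((ENNReal.ofReal (2 ^ p) * ENNReal.ofReal (min 1 ‖y‖ ^ p)) * Dk n (sig 0) (sig y))) := by
        rw [one_mul]
    _ ≤ Wn (0 : Es n) * (Wn y * ((ENNReal.ofReal (2 ^ p) * ENNReal.ofReal (min 1 ‖y‖ ^ p)) * Dk n (sig 0) (sig y))) := by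
        gcongr
    _ = _ := by ring

lemma id_energy (hn : 1 ≤ n) {p : ℝ} (hp : (n : ℝ) < p) :
    nu (muS n) p (cv (id : Sph n → Sph n)) Set.univ < ⊤ := by
  unfold nu
  rw [Measure.restrict_univ]
  refine lt_of_le_of_lt (lintegral_mono fun x => id_inner hn hp x) ?_
  rw [lintegral_const]
  exact ENNReal.mul_lt_top (ENNReal.mul_lt_top ENNReal.ofReal_lt_top (Jc_lt_top hn hp)) (muS_finite hn)

end

/-! ### Mean value lemmas -/

section
variable {n : ℕ} {X : Type*} [MeasurableSpace X]

lemma ofReal_norm_rpow {V : Type*} [SeminormedAddCommGroup V] (v : V) {p : ℝ} (hp : 0 ≤ p) :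
    ENNReal.ofReal (‖v‖ ^ p) = ‖v‖ₑ ^ p := by
  rw [← ENNReal.ofReal_rpow_of_nonneg (norm_nonneg _) hp, ofReal_norm]

lemma jensen_enorm {Q : Measure X} [IsProbabilityMeasure Q] {G : X → Fs n}
    (hG : AEStronglyMeasurable G Q) {p : ℝ} (hp : 1 ≤ p) :
    ‖∫ y, G y ∂Q‖ₑ ^ p ≤ ∫⁻ y, ‖G y‖ₑ ^ p ∂Q := by
  have h1 : ‖∫ y, G y ∂Q‖ₑ ≤ ∫⁻ y, ‖G y‖ₑ ∂Q := enorm_integral_le_lintegral_enorm _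
  have h2 := eLpNorm'_le_eLpNorm'_of_exponent_le one_pos hp Q hG
  simp only [eLpNorm', ENNReal.rpow_one, div_one] at h2
  calc _ ≤ ((∫⁻ y, ‖G y‖ₑ ^ p ∂Q) ^ (1 / p)) ^ p :=
        ENNReal.rpow_le_rpow (h1.trans h2) (by linarith)
    _ = _ := by rw [← ENNReal.rpow_mul, one_div_mul_cancel (by linarith), ENNReal.rpow_one]

lemma mean_one {Q : Measure X} [IsProbabilityMeasure Q] {f : X → Fs n} (hf : Integrable f Q)
    {p : ℝ} (hp : 1 ≤ p) (a : Fs n) :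
    ‖a - ∫ y, f y ∂Q‖ₑ ^ p ≤ ∫⁻ y, ‖a - f y‖ₑ ^ p ∂Q := by
  have : a - ∫ y, f y ∂Q = ∫ y, (a - f y) ∂Q := by
    rw [integral_sub (integrable_const _) hf]; simp
  rw [this]
  exact jensen_enorm (aestronglyMeasurable_const.sub hf.1) hp

lemma mean_two {P Q : Measure X} [IsProbabilityMeasure P] [IsProbabilityMeasure Q] {f : X → Fs n}
    (hfP : Integrable f P) (hf : Integrable f Q) {p : ℝ} (hp : 1 ≤ p) :
    ‖∫ x, f x ∂P - ∫ y, f y ∂Q‖ₑ ^ p ≤ ∫⁻ x, ∫⁻ y, ‖f x - f y‖ₑ ^ p ∂Q ∂P := by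
  rw [← enorm_neg, neg_sub]
  refine (mean_one hfP hp _).trans (lintegral_mono fun x => ?_)
  rw [← enorm_neg, neg_sub]
  exact mean_one hf hp _

lemma mean_unit {P : Measure X} [IsProbabilityMeasure P] {f : X → Fs n}
    (hfP : Integrable f P) (hu : ∀ x, ‖f x‖ = 1) {p : ℝ} (hp : 1 ≤ p) :
    ENNReal.ofReal (1 - ‖∫ x, f x ∂P‖) ^ p ≤ ∫⁻ x, ∫⁻ y, ‖f x - f y‖ₑ ^ p ∂P ∂P := by
  calc ENNReal.ofReal (1 - ‖∫ x, f x ∂P‖) ^ p = ∫⁻ x, ENNReal.ofReal (1 - ‖∫ x, f x ∂P‖) ^ p ∂P := by simp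
    _ ≤ ∫⁻ x, ‖f x - ∫ y, f y ∂P‖ₑ ^ p ∂P := by
        refine lintegral_mono fun x => ENNReal.rpow_le_rpow ?_ (by linarith)
        rw [← ofReal_norm]
        apply ENNReal.ofReal_le_ofReal
        have := norm_sub_norm_le (f x) (∫ y, f y ∂P)
        rw [hu] at this; exact this
    _ ≤ _ := lintegral_mono fun x => mean_one hfP hp _

variable [MetricSpace X]

lemma pw_le_ker {p : ℝ} (hp : 0 < p) (f : X → Fs n) {d : ℝ} {x y : X} (h : dist x y ≤ d) :
    ‖f x - f y‖ₑ ^ p ≤ ENNReal.ofReal (d ^ (2 * (n : ℝ))) * ker p f x y := by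
  by_cases hxy : x = y
  · subst hxy; simp [hp]
  have hd := dist_pos.2 hxy
  have hd0 : 0 < d := hd.trans_le h
  rw [ker, ← ofReal_norm_rpow _ hp.le, Dk, mul_left_comm, ← ENNReal.ofReal_mul (by positivity)]
  refine le_mul_of_one_le_right (zero_le) ?_
  rw [← ENNReal.ofReal_one]
  apply ENNReal.ofReal_le_ofReal
  rw [← div_eq_mul_inv, one_le_div (by positivity)]
  exact Real.rpow_le_rpow hd.le h (by positivity)

variable [BorelSpace X] [SecondCountableTopology X]

lemma dbl_le_en {μ : Measure X} {p : ℝ} (hp : 0 < p) {f : X → Fs n} {P Q : Measure X} {a b : ℝ≥0∞}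
    {A B : Set X} (hA : MeasurableSet A) (hB : MeasurableSet B) (hP : P ≤ a • μ.restrict A)
    (hQ : Q ≤ b • μ.restrict B) {d : ℝ} (hd : ∀ x ∈ A, ∀ y ∈ B, dist x y ≤ d) (hb : b ≠ ⊤) :
    ∫⁻ x, ∫⁻ y, ‖f x - f y‖ₑ ^ p ∂Q ∂P ≤ a * (b * (ENNReal.ofReal (d ^ (2 * (n : ℝ))) * en μ p f A B)) := by
  calc _ ≤ ∫⁻ x, ∫⁻ y, ‖f x - f y‖ₑ ^ p ∂(b • μ.restrict B) ∂(a • μ.restrict A) :=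
        (lintegral_mono' hP fun x => (lintegral_mono' hQ le_rfl))
    _ = a * ∫⁻ x in A, b * ∫⁻ y in B, ‖f x - f y‖ₑ ^ p ∂μ ∂μ := by
        rw [lintegral_smul_measure]; simp only [lintegral_smul_measure, smul_eq_mul]
    _ ≤ a * ∫⁻ x in A, b * (ENNReal.ofReal (d ^ (2 * (n : ℝ))) * ∫⁻ y in B, ker p f x y ∂μ) ∂μ := by
        gcongr a * ?_
        refine setLIntegral_mono' hA fun x hx => ?_
        gcongr
        rw [← lintegral_const_mul' _ _ ENNReal.ofReal_ne_top]
        exact setLIntegral_mono' hB fun y hy => pw_le_ker hp f (hd x hx y hy)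
    _ = _ := by
        rw [lintegral_const_mul' _ _ hb, lintegral_const_mul' _ _ ENNReal.ofReal_ne_top]; rfl

end

/-! ### The cut lemma: mollification -/

section
variable {n : ℕ}

/-- cutoff radius -/
def phi (x : Es n) : ℝ := max 0 (min (1 / 2) (min ((‖x‖ - 1) / 2) ((8 - ‖x‖) / 2)))

/-- annulus -/
def Ann (n : ℕ) : Set (Es n) := {x | 1 < ‖x‖ ∧ ‖x‖ ≤ 8}

lemma Ann_meas : MeasurableSet (Ann n) :=
  (measurableSet_lt measurable_const measurable_norm).inter
    (measurableSet_le measurable_norm measurable_const)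

lemma continuous_phi : Continuous (phi (n := n)) := by unfold phi; fun_prop

lemma phi_nonneg (x : Es n) : 0 ≤ phi x := le_max_left _ _

lemma phi_lip (x y : Es n) : |phi x - phi y| ≤ 1 / 2 * dist x y := by
  have h0 : |‖x‖ - ‖y‖| ≤ dist x y := by rw [dist_eq_norm]; exact abs_norm_sub_norm_le x y
  have hd := dist_nonneg (x := x) (y := y)
  have h1 : |(‖x‖ - 1) / 2 - (‖y‖ - 1) / 2| ≤ 1 / 2 * dist x y := by
    have : (‖x‖ - 1) / 2 - (‖y‖ - 1) / 2 = (‖x‖ - ‖y‖) / 2 := by ring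
    rw [this, abs_div, abs_two]; linarith
  have h2 : |(8 - ‖x‖) / 2 - (8 - ‖y‖) / 2| ≤ 1 / 2 * dist x y := by
    have : (8 - ‖x‖) / 2 - (8 - ‖y‖) / 2 = -((‖x‖ - ‖y‖) / 2) := by ring
    rw [this, abs_neg, abs_div, abs_two]; linarith
  unfold phi
  refine (abs_max_sub_max_le_max _ _ _ _).trans (max_le (by simp) ?_)
  refine (abs_min_sub_min_le_max _ _ _ _).trans (max_le (by simp) ?_)
  exact (abs_min_sub_min_le_max _ _ _ _).trans (max_le h1 h2)

lemma phi_le_half (x : Es n) : phi x ≤ 1 / 2 := by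
  unfold phi
  exact max_le (by norm_num) (min_le_left _ _)

lemma phi_of_mem {x : Es n} (hx : x ∈ Ann n) : phi x ≤ (‖x‖ - 1) / 2 ∧ phi x ≤ (8 - ‖x‖) / 2 := by
  obtain ⟨h1, h2⟩ := hx
  unfold phi
  refine ⟨max_le (by linarith) ?_, max_le (by linarith) ?_⟩
  · exact (min_le_right _ _).trans (min_le_left _ _)
  · exact (min_le_right _ _).trans (min_le_right _ _)

lemma phi_of_not_mem {x : Es n} (hx : x ∉ Ann n) : phi x = 0 := by
  unfold phi
  apply max_eq_left
  by_contra h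
  push Not at h
  have h1 := h.trans_le ((min_le_right _ _).trans (min_le_left _ _))
  have h2 := h.trans_le ((min_le_right _ _).trans (min_le_right _ _))
  exact hx ⟨by linarith, by linarith⟩

lemma phi_mid {x : Es n} (h2 : 2 ≤ ‖x‖) (h7 : ‖x‖ ≤ 7) : phi x = 1 / 2 := by
  unfold phi
  rw [min_eq_left, max_eq_right (by norm_num)]
  exact le_min (by linarith) (by linarith)

lemma ball_sub_Ann {x : Es n} {r : ℝ} (hr : 0 < r) (hrx : r ≤ phi x) : Metric.ball x r ⊆ Ann n := by
  have hx : x ∈ Ann n := by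
    by_contra h; rw [phi_of_not_mem h] at hrx; linarith
  obtain ⟨h1, h2⟩ := phi_of_mem hx
  intro y hy
  rw [Metric.mem_ball, dist_eq_norm] at hy
  have h3 := norm_sub_norm_le x y
  rw [norm_sub_rev] at h3
  have h4 := norm_sub_norm_le y x
  have := hx.1
  have := hx.2
  exact ⟨by linarith, by linarith⟩

/-- displacement map -/
def Phi (z x : Es n) : Es n := x + phi x • z

lemma continuous_Phi : Continuous (fun q : Es n × Es n => Phi q.1 q.2) := by
  unfold Phi
  exact continuous_snd.add ((continuous_phi.comp continuous_snd).smul continuous_fst)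

lemma Phi_mem (z x : Es n) (hz : ‖z‖ ≤ 1) : Phi z x ∈ Ann n ↔ x ∈ Ann n := by
  by_cases hx : x ∈ Ann n
  · simp only [hx, iff_true]
    obtain ⟨h1, h2⟩ := phi_of_mem hx
    have h3 := phi_nonneg x
    have h4 : ‖phi x • z‖ ≤ phi x := by
      rw [norm_smul, Real.norm_of_nonneg h3]; exact mul_le_of_le_one_right h3 hz
    have h5 : ‖Phi z x‖ ≤ ‖x‖ + ‖phi x • z‖ := norm_add_le _ _
    have h6 : ‖x‖ - ‖phi x • z‖ ≤ ‖Phi z x‖ := by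
      have := norm_sub_norm_le x (-(phi x • z))
      rw [norm_neg, sub_neg_eq_add] at this; exact this
    have := hx.1
    have := hx.2
    exact ⟨by linarith, by linarith⟩
  · rw [Phi, phi_of_not_mem hx, zero_smul, add_zero]

lemma Phi_sub (z x y : Es n) (hz : ‖z‖ ≤ 1) : ‖(phi x - phi y) • z‖ ≤ 1 / 2 * dist x y := by
  rw [norm_smul]
  exact (mul_le_of_le_one_right (norm_nonneg _) hz).trans (phi_lip x y)

lemma Phi_upper (z x y : Es n) (hz : ‖z‖ ≤ 1) : dist (Phi z x) (Phi z y) ≤ 3 / 2 * dist x y := by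
  have h := Phi_sub z x y hz
  have e : Phi z x - Phi z y = (x - y) + (phi x - phi y) • z := by
    rw [Phi, Phi, sub_smul]; abel
  rw [dist_eq_norm, e]
  have := norm_add_le (x - y) ((phi x - phi y) • z)
  rw [← dist_eq_norm] at this
  linarith

lemma Phi_lower (z x y : Es n) (hz : ‖z‖ ≤ 1) : dist x y ≤ 2 * dist (Phi z x) (Phi z y) := by
  have h := Phi_sub z x y hz
  have e : x - y = (Phi z x - Phi z y) - (phi x - phi y) • z := by
    rw [Phi, Phi, sub_smul]; abel
  have := norm_sub_le (Phi z x - Phi z y) ((phi x - phi y) • z)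
  rw [← e, ← dist_eq_norm, ← dist_eq_norm] at this
  linarith

lemma lintegral_Phi (z : Es n) (hz : ‖z‖ ≤ 1) {g : Es n → ℝ≥0∞} (hg : Measurable g) :
    ∫⁻ x, g (Phi z x) ∂(muE n) ≤ 2 ^ n * ∫⁻ x, g x ∂(muE n) := by
  have hm : Measurable (Phi z) := (continuous_Phi.comp (Continuous.prodMk_right z)).measurable
  have ha : AntilipschitzWith 2 (Phi z) := AntilipschitzWith.of_le_mul_dist fun x y => Phi_lower z x y hz
  have hle : Measure.map (Phi z) (muE n) ≤ (2 : ℝ≥0∞) ^ n • muE n := by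
    rw [Measure.le_iff]
    intro s hs
    rw [Measure.map_apply hm hs]
    have := ha.hausdorffMeasure_preimage_le (d := (n : ℝ)) (by positivity) s
    simpa [muE] using this
  calc _ = ∫⁻ x, g x ∂(Measure.map (Phi z) (muE n)) := (lintegral_map hg hm).symm
    _ ≤ ∫⁻ x, g x ∂((2 : ℝ≥0∞) ^ n • muE n) := lintegral_mono' hle le_rfl
    _ = _ := by rw [lintegral_smul_measure]; rfl

lemma setLIntegral_Phi (z : Es n) (hz : ‖z‖ ≤ 1) {g : Es n → ℝ≥0∞} (hg : Measurable g) :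
    ∫⁻ x in Ann n, g (Phi z x) ∂(muE n) ≤ 2 ^ n * ∫⁻ x in Ann n, g x ∂(muE n) := by
  have := lintegral_Phi z hz (hg.indicator (Ann_meas (n := n)))
  rw [lintegral_indicator Ann_meas] at this
  refine le_trans (le_of_eq ?_) this
  rw [← lintegral_indicator Ann_meas]
  refine lintegral_congr fun x => ?_
  by_cases hx : x ∈ Ann n
  · simp [Set.indicator, hx, (Phi_mem z x hz).2 hx]
  · simp [Set.indicator, hx, mt (Phi_mem z x hz).1 hx]

lemma Dk_Phi (z x y : Es n) (hz : ‖z‖ ≤ 1) :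
    Dk n x y ≤ ENNReal.ofReal ((3 / 2) ^ (2 * (n : ℝ))) * Dk n (Phi z x) (Phi z y) := by
  by_cases hxy : x = y
  · subst hxy
    rcases Nat.eq_zero_or_pos n with h0 | h0
    · subst h0; simp [Dk]
    · have : (2 * (n : ℝ)) ≠ 0 := by positivity
      simp [Dk, Real.zero_rpow this]
  have hd := dist_pos.2 hxy
  have h1 := Phi_upper z x y hz
  have h2 := Phi_lower z x y hz
  have h3 : 0 < dist (Phi z x) (Phi z y) := by linarith
  rw [Dk, Dk, ← ENNReal.ofReal_mul (by positivity)]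
  apply ENNReal.ofReal_le_ofReal
  rw [← div_eq_mul_inv, le_div_iff₀ (by positivity), inv_mul_le_iff₀ (by positivity),
    ← Real.mul_rpow dist_nonneg (by norm_num)]
  exact Real.rpow_le_rpow h3.le (by linarith) (by positivity)

/-! averaging measure -/

/-- volume of the unit ball -/
def om (n : ℕ) : ℝ≥0∞ := muE n (Metric.ball 0 1)

lemma om_pos : om n ≠ 0 := (Metric.measure_ball_pos _ _ one_pos).ne'
lemma om_fin : om n ≠ ⊤ := measure_ball_lt_top.ne
lemma omi_fin : (om n)⁻¹ ≠ ⊤ := ENNReal.inv_ne_top.2 om_pos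

/-- normalized measure on the unit ball -/
def bB (n : ℕ) : Measure (Es n) := (om n)⁻¹ • (muE n).restrict (Metric.ball 0 1)

instance : IsProbabilityMeasure (bB n) := ⟨by
  simp only [bB, Measure.smul_apply, smul_eq_mul, MeasurableSet.univ, Measure.restrict_apply, Set.univ_inter]
  exact ENNReal.inv_mul_cancel om_pos om_fin⟩

lemma bB_ae : ∀ᵐ z ∂(bB n), ‖z‖ ≤ 1 := by
  apply Measure.ae_smul_measure
  filter_upwards [ae_restrict_mem measurableSet_ball] with z hz
  simpa using (le_of_lt (by simpa using hz))

lemma cont_avg {X : Type*} [TopologicalSpace X] [FirstCountableTopology X] {F : X × Es n → Fs n}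
    (hF : Continuous F) (hb : ∀ z, ‖F z‖ ≤ 1) : Continuous (fun x => ∫ z, F (x, z) ∂(bB n)) := by
  refine continuous_of_dominated (bound := fun _ => 1) ?_ ?_ (integrable_const _) ?_
  · intro x
    exact (hF.comp (Continuous.prodMk_right x)).aestronglyMeasurable
  · intro x; exact Filter.Eventually.of_forall fun z => hb _
  · exact Filter.Eventually.of_forall fun z => hF.comp (Continuous.prodMk_left z)

/-- mollification -/
def Us (u : Es n → Fs n) (t : ℝ) (x : Es n) : Fs n := ∫ z, u (x + (t * phi x) • z) ∂(bB n)

lemma integrable_unit {X : Type*} [TopologicalSpace X] [MeasurableSpace X] [BorelSpace X]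
    {Q : Measure X} [IsFiniteMeasure Q] {u : X → Fs n} (hc : Continuous u) (hu : ∀ x, ‖u x‖ = 1) : Integrable u Q :=
  Integrable.of_bound (hc.measurable.aestronglyMeasurable) 1 (Filter.Eventually.of_forall fun x => (hu x).le)

lemma Us_cont {u : Es n → Fs n} (hc : Continuous u) (hu : ∀ x, ‖u x‖ = 1) :
    Continuous (fun q : ℝ × Es n => Us u q.1 q.2) := by
  unfold Us
  refine cont_avg (F := fun q : (ℝ × Es n) × Es n => u (q.1.2 + (q.1.1 * phi q.1.2) • q.2)) ?_
    (fun z => (hu _).le)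
  have := continuous_phi (n := n)
  fun_prop

lemma Us_off {u : Es n → Fs n} (t : ℝ) {x : Es n} (hx : x ∉ Ann n) : Us u t x = u x := by
  simp [Us, phi_of_not_mem hx]

lemma Us_zero {u : Es n → Fs n} (x : Es n) : Us u 0 x = u x := by
  simp [Us]

lemma Us_one (u : Es n → Fs n) (x : Es n) : Us u 1 x = ∫ z, u (Phi z x) ∂(bB n) := by
  simp [Us, Phi]

/-- constant -/
def C1 (n : ℕ) : ℝ≥0∞ := (om n)⁻¹ * ((om n)⁻¹ * ENNReal.ofReal (2 ^ (2 * (n : ℝ))))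

lemma C1_fin : C1 n ≠ ⊤ := by
  unfold C1
  exact ENNReal.mul_ne_top omi_fin (ENNReal.mul_ne_top omi_fin ENNReal.ofReal_ne_top)

lemma Us_unit {u : Es n → Fs n} (hc : Continuous u) (hu : ∀ x, ‖u x‖ = 1) {p : ℝ} (hp : 1 ≤ p)
    {t : ℝ} (h0 : 0 ≤ t) (h1 : t ≤ 1) (x : Es n) :
    ENNReal.ofReal (1 - ‖Us u t x‖) ^ p ≤ C1 n * nu (muE n) p u (Ann n) := by
  have hr0 : 0 ≤ t * phi x := mul_nonneg h0 (phi_nonneg x)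
  rcases hr0.eq_or_lt with h | h
  · have : Us u t x = u x := by simp [Us, ← h]
    rw [this, hu, sub_self, ENNReal.ofReal_zero, ENNReal.zero_rpow_of_pos (by linarith)]; exact zero_le
  set r := t * phi x with hr
  have e : Us u t x = ∫ z, (u ∘ mob x r) z ∂(bB n) := rfl
  have hc' : Continuous (u ∘ mob x r) := hc.comp (continuous_mob _ _)
  rw [e]
  refine (mean_unit (integrable_unit hc' fun _ => hu _) (fun _ => hu _) hp).trans ?_
  refine (dbl_le_en (μ := muE n) (by linarith) measurableSet_ball measurableSet_ball le_rfl le_rfl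
    (d := 2) ?_ omi_fin).trans ?_
  · intro a ha b hb
    have := dist_triangle a 0 b
    rw [Metric.mem_ball] at ha hb
    rw [dist_comm 0 b] at this
    linarith
  rw [C1, mul_assoc, mul_assoc]
  gcongr
  have hb : mob x r ⁻¹' (Metric.ball x r) = Metric.ball 0 1 := by
    ext z
    simp [mob, norm_smul, abs_of_pos h, h]
  have := en_mob (p := p) u x h (A := Metric.ball x r) (B := Metric.ball x r) measurableSet_ball measurableSet_ball
  rw [hb] at this
  rw [← this]
  refine (en_le_nu _ _ _ _ _).trans (nu_mono _ _ _ ?_)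
  exact ball_sub_Ann h (mul_le_of_le_one_left (phi_nonneg x) h1)

/-- mean over the annulus -/
def bA (n : ℕ) : Measure (Es n) := (muE n (Ann n))⁻¹ • (muE n).restrict (Ann n)

lemma Ann_fin : muE n (Ann n) ≠ ⊤ :=
  ((measure_mono (fun x hx => by simpa using hx.2 : Ann n ⊆ Metric.closedBall 0 8)).trans_lt
    measure_closedBall_lt_top).ne

lemma exists_norm (hn : 1 ≤ n) (r : ℝ) (hr : 0 ≤ r) : ∃ x : Es n, ‖x‖ = r :=
  ⟨EuclideanSpace.single ⟨0, hn⟩ r, by simp [abs_of_nonneg hr]⟩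

lemma Ann_pos (hn : 1 ≤ n) : muE n (Ann n) ≠ 0 := by
  obtain ⟨x, hx⟩ := exists_norm hn 3 (by norm_num)
  have hs : Metric.ball x (1 / 2) ⊆ Ann n :=
    ball_sub_Ann (by norm_num) (by rw [phi_mid (by linarith) (by linarith)])
  exact ((Metric.measure_ball_pos (muE n) x (by norm_num)).trans_le (measure_mono hs)).ne'

lemma bA_prob (hn : 1 ≤ n) : IsProbabilityMeasure (bA n) := ⟨by
  simp only [bA, Measure.smul_apply, smul_eq_mul, MeasurableSet.univ, Measure.restrict_apply, Set.univ_inter]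
  exact ENNReal.inv_mul_cancel (Ann_pos hn) Ann_fin⟩

/-- mean -/
def c0 (u : Es n → Fs n) : Fs n := ∫ y, u y ∂(bA n)

lemma map_bB (x : Es n) {r : ℝ} (h : 0 < r) :
    Measure.map (mob x r) (bB n) ≤ ((om n)⁻¹ * (ENNReal.ofReal (r ^ n))⁻¹) • (muE n).restrict (Metric.ball x r) := by
  rw [Measure.le_iff]
  intro s hs
  have hm := (continuous_mob x r).measurable
  have hb : mob x r ⁻¹' (Metric.ball x r) = Metric.ball 0 1 := by
    ext z
    simp [mob, norm_smul, abs_of_pos h, h]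
  rw [Measure.map_apply hm hs, bB, Measure.smul_apply, Measure.smul_apply, smul_eq_mul, smul_eq_mul,
    Measure.restrict_apply (hm hs), Measure.restrict_apply hs, mul_assoc, ← hb, ← Set.preimage_inter]
  gcongr
  have hs' : MeasurableSet (s ∩ Metric.ball x r) := hs.inter measurableSet_ball
  have := setLIntegral_mob x h (fun _ => 1) hs'
  simp only [lintegral_const, MeasurableSet.univ, Measure.restrict_apply, Set.univ_inter, one_mul, mul_one] at this
  rw [this, ← mul_assoc, ENNReal.inv_mul_cancel, one_mul]
  · simpa using (by positivity : 0 < r ^ n)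
  · exact ENNReal.ofReal_ne_top

/-- constant -/
def C2 (n : ℕ) : ℝ≥0∞ := ((om n)⁻¹ * (ENNReal.ofReal ((1 / 2) ^ n))⁻¹) * ((muE n (Ann n))⁻¹ *
  ENNReal.ofReal (16 ^ (2 * (n : ℝ))))

lemma C2_fin (hn : 1 ≤ n) : C2 n ≠ ⊤ := by
  unfold C2
  refine ENNReal.mul_ne_top (ENNReal.mul_ne_top omi_fin (ENNReal.inv_ne_top.2 ?_))
    (ENNReal.mul_ne_top (ENNReal.inv_ne_top.2 (Ann_pos hn)) ENNReal.ofReal_ne_top)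
  simp

lemma Ann_dist {x y : Es n} (hx : x ∈ Ann n) (hy : y ∈ Ann n) : dist x y ≤ 16 := by
  have := dist_triangle x 0 y
  rw [dist_zero_right, dist_zero_left] at this
  linarith [hx.2, hy.2]

lemma Us_c0 (hn : 1 ≤ n) {u : Es n → Fs n} (hc : Continuous u) (hu : ∀ x, ‖u x‖ = 1) {p : ℝ} (hp : 1 ≤ p)
    {x : Es n} (h2 : 2 ≤ ‖x‖) (h7 : ‖x‖ ≤ 7) :
    ‖Us u 1 x - c0 u‖ₑ ^ p ≤ C2 n * nu (muE n) p u (Ann n) := by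
  have := bA_prob hn
  have hm := (continuous_mob x (1 / 2)).measurable
  have hP : IsProbabilityMeasure (Measure.map (mob x (1 / 2)) (bB n)) :=
    Measure.isProbabilityMeasure_map hm.aemeasurable
  have e : Us u 1 x = ∫ y, u y ∂(Measure.map (mob x (1 / 2)) (bB n)) := by
    rw [integral_map hm.aemeasurable hc.aestronglyMeasurable]
    rw [Us, phi_mid h2 h7, one_mul]; rfl
  rw [e, c0]
  have hs : Metric.ball x (1 / 2) ⊆ Ann n :=
    ball_sub_Ann (by norm_num) (by rw [phi_mid h2 h7])
  refine (mean_two (integrable_unit hc hu) (integrable_unit hc hu) hp).trans ?_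
  refine (dbl_le_en (μ := muE n) (by linarith) measurableSet_ball Ann_meas (map_bB x (by norm_num)) le_rfl
    (d := 16) ?_ (ENNReal.inv_ne_top.2 (Ann_pos hn))).trans ?_
  · intro a ha b hb
    exact Ann_dist (hs ha) hb
  rw [C2, mul_assoc _ (_ * _) (nu _ _ _ _), mul_assoc (muE n (Ann n))⁻¹]
  gcongr
  exact (en_le_nu _ _ _ _ _).trans (nu_mono _ _ _ hs)

end

section
variable {n : ℕ}

lemma measurable_Us {u : Es n → Fs n} (hc : Continuous u) (hu : ∀ x, ‖u x‖ = 1) : Continuous (Us u 1) :=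
  (Us_cont hc hu).comp (Continuous.prodMk_right (1 : ℝ))

instance : SFinite (muE n) := inferInstance

lemma Dk_ne_top {X : Type*} [MetricSpace X] {x y : X} : Dk n x y ≠ ⊤ := by
  unfold Dk; exact ENNReal.ofReal_ne_top

lemma measurable_ker_right {X : Type*} [MetricSpace X] [MeasurableSpace X] [BorelSpace X] [SecondCountableTopology X]
    {p : ℝ} {f : X → Fs n} (hf : Measurable f) (x : X) : Measurable (fun y => ker p f x y) := by
  have h1 : Measurable (fun y : X => (x, y)) := by fun_prop
  have h2 := (measurable_ker (p := p) hf).comp h1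
  exact h2

/-- energy of the mollification -/
lemma Us_energy {u : Es n → Fs n} (hc : Continuous u) (hu : ∀ x, ‖u x‖ = 1) {p : ℝ} (hp : 1 ≤ p) :
    nu (muE n) p (Us u 1) (Ann n) ≤
      ENNReal.ofReal ((3 / 2) ^ (2 * (n : ℝ))) * (2 ^ n * (2 ^ n * nu (muE n) p u (Ann n))) := by
  set c := ENNReal.ofReal ((3 / 2) ^ (2 * (n : ℝ))) with hcc
  have hcf : c ≠ ⊤ := ENNReal.ofReal_ne_top
  have hk : Measurable (fun q : Es n × Es n => ker p u q.1 q.2) := measurable_ker hc.measurable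
  have hPhi := (continuous_Phi (n := n)).measurable
  -- pointwise
  have h1 : ∀ x y, ker p (Us u 1) x y ≤ ∫⁻ z, c * ker p u (Phi z x) (Phi z y) ∂(bB n) := by
    intro x y
    have hcx : ∀ x, Continuous fun z => u (Phi z x) := fun x =>
      hc.comp (continuous_Phi.comp (Continuous.prodMk_left x))
    rw [ker, ofReal_norm_rpow _ (by linarith), Us_one, Us_one,
      ← integral_sub (integrable_unit (hcx x) fun _ => hu _) (integrable_unit (hcx y) fun _ => hu _)]
    calc _ ≤ (∫⁻ z, ‖u (Phi z x) - u (Phi z y)‖ₑ ^ p ∂(bB n)) * Dk n x y := by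
          gcongr
          exact jensen_enorm ((hcx x).sub (hcx y)).aestronglyMeasurable hp
      _ = ∫⁻ z, ‖u (Phi z x) - u (Phi z y)‖ₑ ^ p * Dk n x y ∂(bB n) := by
          rw [lintegral_mul_const' _ _ Dk_ne_top]
      _ ≤ _ := by
          refine lintegral_mono_ae ?_
          filter_upwards [bB_ae] with z hz
          rw [ker, ofReal_norm_rpow _ (by linarith), mul_left_comm]
          gcongr
          exact Dk_Phi z x y hz
  have hK3 : Measurable (fun q : (Es n × Es n) × Es n => ker p u (Phi q.1.2 q.1.1) (Phi q.1.2 q.2)) := by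
    refine hk.comp (f := fun q : (Es n × Es n) × Es n => (Phi q.1.2 q.1.1, Phi q.1.2 q.2)) ?_
    refine Measurable.prodMk ?_ ?_
    · exact hPhi.comp (f := fun q : (Es n × Es n) × Es n => (q.1.2, q.1.1)) (by fun_prop)
    · exact hPhi.comp (f := fun q : (Es n × Es n) × Es n => (q.1.2, q.2)) (by fun_prop)
  calc nu (muE n) p (Us u 1) (Ann n)
      ≤ ∫⁻ x in Ann n, ∫⁻ y, ∫⁻ z, c * ker p u (Phi z x) (Phi z y) ∂(bB n) ∂(muE n) ∂(muE n) := by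
        exact lintegral_mono fun x => lintegral_mono fun y => h1 x y
    _ = ∫⁻ x in Ann n, ∫⁻ z, ∫⁻ y, c * ker p u (Phi z x) (Phi z y) ∂(muE n) ∂(bB n) ∂(muE n) := by
        refine lintegral_congr fun x => ?_
        refine lintegral_lintegral_swap (f := fun y z => c * ker p u (Phi z x) (Phi z y)) ?_
        have hm : Measurable (fun q : Es n × Es n => ker p u (Phi q.2 x) (Phi q.2 q.1)) :=
          hK3.comp (f := fun q : Es n × Es n => ((x, q.2), q.1)) (by fun_prop)
        exact (hm.const_mul c).aemeasurable
    _ = ∫⁻ z, ∫⁻ x in Ann n, ∫⁻ y, c * ker p u (Phi z x) (Phi z y) ∂(muE n) ∂(muE n) ∂(bB n) := by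
        refine lintegral_lintegral_swap (f := fun x z => ∫⁻ y, c * ker p u (Phi z x) (Phi z y) ∂(muE n)) ?_
        have hm := hK3.const_mul c
        have hm2 : Measurable (fun q : Es n × Es n => ∫⁻ y, c * ker p u (Phi q.2 q.1) (Phi q.2 y) ∂(muE n)) :=
          hm.lintegral_prod_right'
        exact hm2.aemeasurable
    _ ≤ ∫⁻ z, c * (2 ^ n * (2 ^ n * nu (muE n) p u (Ann n))) ∂(bB n) := by
        refine lintegral_mono_ae ?_
        filter_upwards [bB_ae] with z hz
        simp_rw [lintegral_const_mul' _ _ hcf]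
        gcongr
        calc _ ≤ ∫⁻ x in Ann n, 2 ^ n * ∫⁻ y, ker p u (Phi z x) y ∂(muE n) ∂(muE n) := by
              refine lintegral_mono fun x => ?_
              exact lintegral_Phi z hz (g := fun y => ker p u (Phi z x) y) (measurable_ker_right hc.measurable _)
          _ = 2 ^ n * ∫⁻ x in Ann n, ∫⁻ y, ker p u (Phi z x) y ∂(muE n) ∂(muE n) := by
              rw [lintegral_const_mul' _ _ (by finiteness)]
          _ ≤ _ := by
              gcongr
              exact setLIntegral_Phi z hz (g := fun x => ∫⁻ y, ker p u x y ∂(muE n)) hk.lintegral_prod_right'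
    _ = _ := by simp

/-- constant -/
def C3 (n : ℕ) : ℝ≥0∞ := (muE n (Ann n))⁻¹ * ENNReal.ofReal (16 ^ (2 * (n : ℝ)))

lemma C3_fin (hn : 1 ≤ n) : C3 n ≠ ⊤ :=
  ENNReal.mul_ne_top (ENNReal.inv_ne_top.2 (Ann_pos hn)) ENNReal.ofReal_ne_top

lemma Us_poinc (hn : 1 ≤ n) {u : Es n → Fs n} (hc : Continuous u) (hu : ∀ x, ‖u x‖ = 1) {p : ℝ} (hp : 1 ≤ p) :
    ∫⁻ x in Ann n, ‖Us u 1 x - c0 u‖ₑ ^ p ∂(muE n) ≤ 2 ^ n * (C3 n * nu (muE n) p u (Ann n)) := by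
  have := bA_prob hn
  have hm : Measurable (fun x => ‖u x - c0 u‖ₑ ^ p) := by
    exact ((hc.sub continuous_const).measurable.enorm).pow_const _
  have hPhi := (continuous_Phi (n := n)).measurable
  calc _ ≤ ∫⁻ x in Ann n, ∫⁻ z, ‖u (Phi z x) - c0 u‖ₑ ^ p ∂(bB n) ∂(muE n) := by
        refine lintegral_mono fun x => ?_
        have hcx : Continuous fun z => u (Phi z x) := hc.comp (continuous_Phi.comp (Continuous.prodMk_left x))
        have := mean_one (Q := bB n) (integrable_unit hcx fun _ => hu _) hp (c0 u)
        simp only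
        rw [Us_one, ← enorm_neg, neg_sub]
        refine this.trans (le_of_eq (lintegral_congr fun z => ?_))
        rw [← enorm_neg, neg_sub]
    _ = ∫⁻ z, ∫⁻ x in Ann n, ‖u (Phi z x) - c0 u‖ₑ ^ p ∂(muE n) ∂(bB n) := by
        rw [lintegral_lintegral_swap]
        exact (hm.comp (hPhi.comp (f := fun q : Es n × Es n => (q.2, q.1)) (by fun_prop))).aemeasurable
    _ ≤ ∫⁻ z, 2 ^ n * ∫⁻ x in Ann n, ‖u x - c0 u‖ₑ ^ p ∂(muE n) ∂(bB n) := by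
        refine lintegral_mono_ae ?_
        filter_upwards [bB_ae] with z hz
        exact setLIntegral_Phi z hz hm
    _ = 2 ^ n * ∫⁻ x in Ann n, ‖u x - c0 u‖ₑ ^ p ∂(muE n) := by simp
    _ ≤ _ := by
        gcongr
        calc _ ≤ ∫⁻ x in Ann n, ∫⁻ y, ‖u x - u y‖ₑ ^ p ∂(bA n) ∂(muE n) :=
              lintegral_mono fun x => mean_one (integrable_unit hc hu) hp _
          _ ≤ 1 * ((muE n (Ann n))⁻¹ * (ENNReal.ofReal (16 ^ (2 * (n : ℝ))) * en (muE n) p u (Ann n) (Ann n))) := by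
              refine dbl_le_en (by linarith) Ann_meas Ann_meas (by rw [one_smul]) le_rfl
                (fun x hx y hy => Ann_dist hx hy) (ENNReal.inv_ne_top.2 (Ann_pos hn))
          _ ≤ _ := by
              rw [one_mul, C3, mul_assoc]
              gcongr
              exact en_le_nu _ _ _ _ _

/-- cutoff -/
def eta (x : Es n) : ℝ := max 0 (min 1 (min (‖x‖ - 2) (7 - ‖x‖)))

lemma continuous_eta : Continuous (eta (n := n)) := by unfold eta; fun_prop
lemma eta_nonneg (x : Es n) : 0 ≤ eta x := le_max_left _ _
lemma eta_le (x : Es n) : eta x ≤ 1 := max_le (by norm_num) (min_le_left _ _)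

lemma eta_lip (x y : Es n) : |eta x - eta y| ≤ min 1 (dist x y) := by
  have h0 : |‖x‖ - ‖y‖| ≤ dist x y := by rw [dist_eq_norm]; exact abs_norm_sub_norm_le x y
  refine le_min ?_ ?_
  · rw [abs_le]; constructor <;> linarith [eta_nonneg x, eta_nonneg y, eta_le x, eta_le y]
  have h1 : |(‖x‖ - 2) - (‖y‖ - 2)| ≤ dist x y := by
    have : (‖x‖ - 2) - (‖y‖ - 2) = (‖x‖ - ‖y‖) := by ring
    rw [this]; exact h0
  have h2 : |(7 - ‖x‖) - (7 - ‖y‖)| ≤ dist x y := by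
    have : (7 - ‖x‖) - (7 - ‖y‖) = -(‖x‖ - ‖y‖) := by ring
    rw [this, abs_neg]; exact h0
  unfold eta
  refine (abs_max_sub_max_le_max _ _ _ _).trans (max_le (by simp) ?_)
  refine (abs_min_sub_min_le_max _ _ _ _).trans (max_le (by simp) ?_)
  exact (abs_min_sub_min_le_max _ _ _ _).trans (max_le h1 h2)

lemma eta_off {x : Es n} (h : ¬ (2 ≤ ‖x‖ ∧ ‖x‖ ≤ 7)) : eta x = 0 := by
  unfold eta
  apply max_eq_left
  by_contra h'
  push Not at h'
  have h1 := h'.trans_le ((min_le_right _ _).trans (min_le_left _ _))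
  have h2 := h'.trans_le ((min_le_right _ _).trans (min_le_right _ _))
  exact h ⟨by linarith, by linarith⟩

lemma eta_mid {x : Es n} (h3 : 3 ≤ ‖x‖) (h6 : ‖x‖ ≤ 6) : eta x = 1 := by
  unfold eta
  rw [min_eq_left, max_eq_right (by norm_num)]
  exact le_min (by linarith) (by linarith)

/-- interpolation -/
def Vs (u : Es n → Fs n) (t : ℝ) (x : Es n) : Fs n := Us u 1 x + (t * eta x) • (c0 u - Us u 1 x)

lemma Vs_cont {u : Es n → Fs n} (hc : Continuous u) (hu : ∀ x, ‖u x‖ = 1) :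
    Continuous (fun q : ℝ × Es n => Vs u q.1 q.2) := by
  have := measurable_Us hc hu
  have := continuous_eta (n := n)
  unfold Vs
  fun_prop

/-- constant -/
def C4 (n : ℕ) (p : ℝ) : ℝ≥0∞ := 2 ^ (p - 1) * (ENNReal.ofReal ((3 / 2) ^ (2 * (n : ℝ))) * (2 ^ n * 2 ^ n) +
  2 ^ n * C3 n * Jc n p)

lemma C4_fin (hn : 1 ≤ n) {p : ℝ} (hp1 : 1 ≤ p) (hp : (n : ℝ) < p) : C4 n p ≠ ⊤ := by
  unfold C4
  refine ENNReal.mul_ne_top (ENNReal.rpow_ne_top_of_nonneg (by linarith) (by norm_num)) ?_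
  refine ENNReal.add_ne_top.2 ⟨ENNReal.mul_ne_top ENNReal.ofReal_ne_top (by finiteness), ?_⟩
  exact ENNReal.mul_ne_top (ENNReal.mul_ne_top (by finiteness) (C3_fin hn)) (Jc_lt_top hn hp).ne

lemma Vs_energy (hn : 1 ≤ n) {u : Es n → Fs n} (hc : Continuous u) (hu : ∀ x, ‖u x‖ = 1) {p : ℝ} (hp : 1 ≤ p) :
    nu (muE n) p (Vs u 1) (Ann n) ≤ C4 n p * nu (muE n) p u (Ann n) := by
  have hUc := measurable_Us hc hu
  have hp0 : 0 ≤ p := by linarith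
  have h1 : ∀ x y, ker p (Vs u 1) x y ≤ 2 ^ (p - 1) * (ker p (Us u 1) x y +
      ‖Us u 1 x - c0 u‖ₑ ^ p * (ENNReal.ofReal (min 1 (dist x y) ^ p) * Dk n x y)) := by
    intro x y
    have e : Vs u 1 x - Vs u 1 y = (1 - eta y) • (Us u 1 x - Us u 1 y) + (eta x - eta y) • (c0 u - Us u 1 x) := by
      simp only [Vs, one_mul]; module
    have h2 : ‖Vs u 1 x - Vs u 1 y‖ₑ ≤ ‖Us u 1 x - Us u 1 y‖ₑ + ‖Us u 1 x - c0 u‖ₑ * ENNReal.ofReal (min 1 (dist x y)) := by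
      rw [e]
      refine (enorm_add_le _ _).trans ?_
      rw [enorm_smul, enorm_smul]
      have e1 : ‖c0 u - Us u 1 x‖ₑ = ‖Us u 1 x - c0 u‖ₑ := by rw [← enorm_neg, neg_sub]
      rw [e1, mul_comm ‖eta x - eta y‖ₑ]
      gcongr
      · refine mul_le_of_le_one_left zero_le ?_
        rw [← ofReal_norm, ← ENNReal.ofReal_one]
        apply ENNReal.ofReal_le_ofReal
        rw [Real.norm_eq_abs, abs_le]; constructor <;> linarith [eta_nonneg y, eta_le y]
      · rw [← ofReal_norm]
        exact ENNReal.ofReal_le_ofReal (eta_lip x y)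
    rw [ker, ofReal_norm_rpow _ hp0, ker, ofReal_norm_rpow _ hp0]
    calc _ ≤ (‖Us u 1 x - Us u 1 y‖ₑ + ‖Us u 1 x - c0 u‖ₑ * ENNReal.ofReal (min 1 (dist x y))) ^ p * Dk n x y := by
          gcongr
      _ ≤ (2 ^ (p - 1) * (‖Us u 1 x - Us u 1 y‖ₑ ^ p + (‖Us u 1 x - c0 u‖ₑ * ENNReal.ofReal (min 1 (dist x y))) ^ p)) *
            Dk n x y := by
          gcongr
          exact ENNReal.rpow_add_le_mul_rpow_add_rpow _ _ hp
      _ = _ := by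
          rw [ENNReal.mul_rpow_of_nonneg _ _ hp0, ENNReal.ofReal_rpow_of_nonneg (by positivity) hp0]
          ring
  have h2f : (2 : ℝ≥0∞) ^ (p - 1) ≠ ⊤ := ENNReal.rpow_ne_top_of_nonneg (by linarith) (by norm_num)
  have hk := measurable_ker (p := p) hUc.measurable
  calc nu (muE n) p (Vs u 1) (Ann n) ≤ ∫⁻ x in Ann n, ∫⁻ y, 2 ^ (p - 1) * (ker p (Us u 1) x y +
      ‖Us u 1 x - c0 u‖ₑ ^ p * (ENNReal.ofReal (min 1 (dist x y) ^ p) * Dk n x y)) ∂(muE n) ∂(muE n) :=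
        lintegral_mono fun x => lintegral_mono fun y => h1 x y
    _ = 2 ^ (p - 1) * ∫⁻ x in Ann n, (∫⁻ y, ker p (Us u 1) x y ∂(muE n) + ‖Us u 1 x - c0 u‖ₑ ^ p * Jc n p) ∂(muE n) := by
        rw [← lintegral_const_mul' _ _ h2f]
        refine lintegral_congr fun x => ?_
        rw [lintegral_const_mul' _ _ h2f, lintegral_add_left (measurable_ker_right hUc.measurable x),
          lintegral_const_mul' _ _ (ENNReal.rpow_ne_top_of_nonneg hp0 enorm_ne_top), Jc_translate]
    _ = 2 ^ (p - 1) * (nu (muE n) p (Us u 1) (Ann n) + (∫⁻ x in Ann n, ‖Us u 1 x - c0 u‖ₑ ^ p ∂(muE n)) * Jc n p) := by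
        have hmm : Measurable fun x => ‖Us u 1 x - c0 u‖ₑ ^ p :=
          ((hUc.sub continuous_const).measurable.enorm).pow_const _
        rw [lintegral_add_left (measurable_inner hUc.measurable), lintegral_mul_const _ hmm]
        rfl
    _ ≤ 2 ^ (p - 1) * (ENNReal.ofReal ((3 / 2) ^ (2 * (n : ℝ))) * (2 ^ n * (2 ^ n * nu (muE n) p u (Ann n))) +
          (2 ^ n * (C3 n * nu (muE n) p u (Ann n))) * Jc n p) := by
        gcongr
        · exact Us_energy hc hu hp
        · exact Us_poinc hn hc hu hp
    _ = _ := by rw [C4]; ring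

/-- smallness threshold -/
lemma exists_eps0 (hn : 1 ≤ n) {p : ℝ} (hp : 1 ≤ p) : ∃ ε : ℝ≥0∞, 0 < ε ∧ ∀ a ≤ ε,
    C1 n * a ≤ ENNReal.ofReal (1 / 4) ^ p ∧ C2 n * a ≤ ENNReal.ofReal (1 / 4) ^ p := by
  have hq : ENNReal.ofReal (1 / 4) ^ p ≠ 0 := by
    refine (ENNReal.rpow_pos ?_ ENNReal.ofReal_ne_top).ne'
    simp
  have hC : C1 n + C2 n ≠ ⊤ := ENNReal.add_ne_top.2 ⟨C1_fin, C2_fin hn⟩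
  refine ⟨ENNReal.ofReal (1 / 4) ^ p / (C1 n + C2 n), ENNReal.div_pos hq hC, fun a ha => ?_⟩
  have h1 : (C1 n + C2 n) * a ≤ ENNReal.ofReal (1 / 4) ^ p := by
    calc _ ≤ (C1 n + C2 n) * (ENNReal.ofReal (1 / 4) ^ p / (C1 n + C2 n)) := by gcongr
      _ ≤ _ := ENNReal.mul_div_le
  exact ⟨le_trans (by gcongr; exact le_self_add) h1, le_trans (by gcongr; exact le_add_self) h1⟩

lemma Us_lower {u : Es n → Fs n} (hc : Continuous u) (hu : ∀ x, ‖u x‖ = 1) {p : ℝ} (hp : 1 ≤ p)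
    (hε : C1 n * nu (muE n) p u (Ann n) ≤ ENNReal.ofReal (1 / 4) ^ p) {t : ℝ} (h0 : 0 ≤ t) (h1 : t ≤ 1) (x : Es n) :
    3 / 4 ≤ ‖Us u t x‖ := by
  have h := (Us_unit hc hu hp h0 h1 x).trans hε
  rw [ENNReal.rpow_le_rpow_iff (by linarith), ENNReal.ofReal_le_ofReal_iff (by norm_num)] at h
  linarith

lemma Vs_lower (hn : 1 ≤ n) {u : Es n → Fs n} (hc : Continuous u) (hu : ∀ x, ‖u x‖ = 1) {p : ℝ} (hp : 1 ≤ p)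
    (hε : C1 n * nu (muE n) p u (Ann n) ≤ ENNReal.ofReal (1 / 4) ^ p)
    (hε2 : C2 n * nu (muE n) p u (Ann n) ≤ ENNReal.ofReal (1 / 4) ^ p) {t : ℝ} (h0 : 0 ≤ t) (h1 : t ≤ 1) (x : Es n) :
    1 / 2 ≤ ‖Vs u t x‖ := by
  have hU := Us_lower hc hu hp hε zero_le_one le_rfl x
  by_cases hx : 2 ≤ ‖x‖ ∧ ‖x‖ ≤ 7
  · have h := (Us_c0 hn hc hu hp hx.1 hx.2).trans hε2
    rw [ENNReal.rpow_le_rpow_iff (by linarith), ← ofReal_norm, ENNReal.ofReal_le_ofReal_iff (by norm_num)] at h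
    have h2 : ‖(t * eta x) • (c0 u - Us u 1 x)‖ ≤ 1 / 4 := by
      rw [norm_smul, norm_sub_rev]
      refine (mul_le_of_le_one_left (norm_nonneg _) ?_).trans h
      rw [Real.norm_of_nonneg (mul_nonneg h0 (eta_nonneg x))]
      exact mul_le_one₀ h1 (eta_nonneg x) (eta_le x)
    have := norm_sub_norm_le (Us u 1 x) (-((t * eta x) • (c0 u - Us u 1 x)))
    rw [sub_neg_eq_add, norm_neg] at this
    rw [Vs]; linarith
  · rw [Vs, eta_off hx]; simp; linarith

end

section
variable {n : ℕ}

lemma cv_cont {f : Sph n → Sph n} (hf : Continuous f) : Continuous (cv f) := continuous_subtype_val.comp hf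

lemma cv_norm (f : Sph n → Sph n) (x : Sph n) : ‖cv f x‖ = 1 := sph_norm (f x)

/-- the map modified on the annulus -/
lemma cut_map (hn : 1 ≤ n) {f : Sph n → Sph n} (hf : Continuous f) {p : ℝ} (hp : 1 ≤ p)
    (hε : C1 n * nu (muE n) p (cv f ∘ sig) (Ann n) ≤ ENNReal.ofReal (1 / 4) ^ p)
    (hε2 : C2 n * nu (muE n) p (cv f ∘ sig) (Ann n) ≤ ENNReal.ofReal (1 / 4) ^ p) :
    ∃ (v : Sph n → Sph n) (c : Sph n), Continuous v ∧ Homotopic f v ∧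
      (∀ x, x ∉ Ann n → v (sig x) = f (sig x)) ∧ (∀ x : Es n, 3 ≤ ‖x‖ → ‖x‖ ≤ 6 → v (sig x) = c) ∧
      nu (muE n) p (cv v ∘ sig) (Ann n) ≤ 4 ^ p * (C4 n p * nu (muE n) p (cv f ∘ sig) (Ann n)) := by
  set u := cv f ∘ sig with hu
  have hc : Continuous u := (cv_cont hf).comp continuous_sig
  have hu1 : ∀ x, ‖u x‖ = 1 := fun x => cv_norm f _
  have far : ∀ x : Es n, 9 ≤ ‖x‖ → x ∉ Ann n := fun x hx h => by linarith [h.2]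
  have off1 : ∀ t, ∀ x : Es n, x ∉ Ann n → Us u t x = u x := fun t x hx => Us_off t hx
  have off2 : ∀ t, ∀ x : Es n, x ∉ Ann n → Vs u t x = u x := by
    intro t x hx
    rw [Vs, eta_off, mul_zero, zero_smul, add_zero, Us_off 1 hx]
    rintro ⟨h2, h7⟩
    exact hx ⟨by linarith, by linarith⟩
  let h : unitInterval × Sph n → Fs n := fun z => cv f z.2
  have hh : Continuous h := (cv_cont hf).comp continuous_snd
  let g1 : unitInterval × Es n → Fs n := fun z => Us u z.1 z.2
  have hg1 : Continuous g1 := (Us_cont hc hu1).comp (f := fun z : unitInterval × Es n => ((z.1 : ℝ), z.2)) (by fun_prop)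
  let g2 : unitInterval × Es n → Fs n := fun z => Vs u z.1 z.2
  have hg2 : Continuous g2 := (Vs_cont hc hu1).comp (f := fun z : unitInterval × Es n => ((z.1 : ℝ), z.2)) (by fun_prop)
  have k1 := continuous_ext hg1 hh 9 (fun t x hx => off1 _ x (far x hx))
  have k2 := continuous_ext hg2 hh 9 (fun t x hx => off2 _ x (far x hx))
  have hpole : cv f (pole n) ≠ 0 := by
    intro h0
    have := cv_norm f (pole n)
    rw [h0, norm_zero] at this
    norm_num at this
  have key : ∀ (g : Es n → Fs n), (∀ x, 1 / 2 ≤ ‖g x‖) → ∀ y : Sph n, ext (cv f (pole n)) g y ≠ 0 := by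
    intro g hg y
    unfold ext
    split_ifs with hy
    · exact hpole
    · intro h0
      have := hg (tau y)
      rw [h0, norm_zero] at this
      norm_num at this
  have H1 := homotopic_prj k1 (fun z => key _ (fun x => by
    have := Us_lower hc hu1 hp hε z.1.2.1 z.1.2.2 x
    simp only [g1]; linarith) z.2)
  have H2 := homotopic_prj k2 (fun z => key _ (fun x =>
    Vs_lower hn hc hu1 hp hε hε2 z.1.2.1 z.1.2.2 x) z.2)
  simp only [h, g1, g2] at H1 H2
  have e0 : (fun x : Sph n => prj (ext (cv f (pole n)) (fun x => Us u ((0 : unitInterval) : ℝ) x) x)) = f := by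
    funext y
    have : ext (cv f (pole n)) (fun x => Us u ((0 : unitInterval) : ℝ) x) y = (f y : Fs n) := by
      unfold ext
      split_ifs with hy
      · rw [hy]; rfl
      · simp only [Set.Icc.coe_zero]
        rw [Us_zero, hu]
        simp only [Function.comp, sig_tau hy]; rfl
    rw [this, prj_coe]
  have e1 : (fun x => Vs u ((0 : unitInterval) : ℝ) x) = (fun x => Us u ((1 : unitInterval) : ℝ) x) := by
    funext x
    simp [Vs]
  rw [e0] at H1
  rw [e1] at H2
  have H := H1.trans' H2
  simp only [Set.Icc.coe_one] at H
  set v : Sph n → Sph n := fun x => prj (ext (cv f (pole n)) (fun x => Vs u 1 x) x) with hv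
  have hvs : ∀ x, v (sig x) = prj (Vs u 1 x) := by
    intro x; simp only [hv]; rw [ext_sig]
  refine ⟨v, prj (c0 u), H.cont_right, H, ?_, ?_, ?_⟩
  · intro x hx
    rw [hvs, off2 _ _ hx, hu]
    exact prj_coe _
  · intro x h3 h6
    rw [hvs, Vs, eta_mid h3 h6]
    congr 1
    module
  · calc nu (muE n) p (cv v ∘ sig) (Ann n) ≤ ∫⁻ x in Ann n, ∫⁻ y, 4 ^ p * ker p (Vs u 1) x y ∂(muE n) ∂(muE n) := by
          unfold nu
          refine lintegral_mono fun x => lintegral_mono fun y => ?_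
          simp only
          rw [ker, ofReal_norm_rpow _ (by linarith), ker, ofReal_norm_rpow _ (by linarith), ← mul_assoc,
            ← ENNReal.mul_rpow_of_nonneg _ _ (by linarith)]
          gcongr
          have h1 := prj_lip (Vs_lower hn hc hu1 hp hε hε2 zero_le_one le_rfl x) (Vs_lower hn hc hu1 hp hε hε2 zero_le_one le_rfl y)
          simp only [Function.comp, cv, hvs]
          rw [← ofReal_norm, ← ofReal_norm]
          refine (ENNReal.ofReal_le_ofReal h1).trans ?_
          rw [ENNReal.ofReal_mul (by norm_num)]
          simp
      _ = 4 ^ p * nu (muE n) p (Vs u 1) (Ann n) := by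
          have h4 : (4 : ℝ≥0∞) ^ p ≠ ⊤ := ENNReal.rpow_ne_top_of_nonneg (by linarith) (by norm_num)
          unfold nu
          simp_rw [lintegral_const_mul' _ _ h4]
      _ ≤ _ := by
          gcongr
          exact Vs_energy hn hc hu1 hp

end

/-! energy bookkeeping -/
section
variable {n : ℕ}

lemma en_congr (μ : Measure (Es n)) (p : ℝ) {f g : Es n → Fs n} {A B : Set (Es n)}
    (hA : MeasurableSet A) (hB : MeasurableSet B) (h : ∀ x ∈ A, f x = g x) (h' : ∀ x ∈ B, f x = g x) :
    en μ p f A B = en μ p g A B := by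
  unfold en
  refine setLIntegral_congr_fun hA fun x hx => ?_
  refine setLIntegral_congr_fun hB fun y hy => ?_
  simp only [ker, h x hx, h' y hy]

lemma ker_self (p : ℝ) (hp : 0 < p) {f : Es n → Fs n} {x y : Es n} (h : f x = f y) : ker p f x y = 0 := by
  simp [ker, h, Real.zero_rpow hp.ne']

lemma en_const (μ : Measure (Es n)) (p : ℝ) (hp : 0 < p) {f : Es n → Fs n} {A B : Set (Es n)} (c : Fs n)
    (hA : MeasurableSet A) (hB : MeasurableSet B) (h : ∀ x ∈ A, f x = c) (h' : ∀ x ∈ B, f x = c) :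
    en μ p f A B = 0 := by
  unfold en
  rw [setLIntegral_congr_fun (g := fun _ => 0) hA, lintegral_zero]
  intro x hx
  simp only
  rw [setLIntegral_congr_fun (g := fun _ => 0) hB, lintegral_zero]
  intro y hy
  exact ker_self p hp (by rw [h x hx, h' y hy])

lemma en_dom (μ : Measure (Es n)) [SFinite μ] (p : ℝ) (hp : 0 < p) {f : Es n → Fs n} {A M N : Set (Es n)} (c : Fs n)
    (hA : MeasurableSet A) (hM : MeasurableSet M) (hN : MeasurableSet N)
    (hcM : ∀ x ∈ M, f x = c) (hcN : ∀ x ∈ N, f x = c) {K : ℝ≥0∞} (hKf : K ≠ ⊤)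
    (hK : ∀ x ∈ A, ∫⁻ y in N, Dk n x y ∂μ ≤ K * ∫⁻ y in M, Dk n x y ∂μ) :
    en μ p f A N ≤ K * en μ p f A M := by
  unfold en
  rw [← lintegral_const_mul' _ _ hKf]
  refine setLIntegral_mono' hA fun x hx => ?_
  have e : ∀ B : Set (Es n), MeasurableSet B → (∀ x ∈ B, f x = c) → ∫⁻ y in B, ker p f x y ∂μ =
      ENNReal.ofReal (‖f x - c‖ ^ p) * ∫⁻ y in B, Dk n x y ∂μ := by
    intro B hB hc
    rw [← lintegral_const_mul' _ _ ENNReal.ofReal_ne_top]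
    refine setLIntegral_congr_fun hB fun y hy => ?_
    simp only [ker, hc y hy]
  rw [e M hM hcM, e N hN hcN, mul_left_comm]
  gcongr
  exact hK x hx

lemma en_total (μ : Measure (Es n)) [SFinite μ] (p : ℝ) (hp : 0 < p) {f : Es n → Fs n} (hf : Measurable f)
    {A M N : Set (Es n)} (c : Fs n)
    (hA : MeasurableSet A) (hM : MeasurableSet M) (hN : MeasurableSet N) (hU : A ∪ (M ∪ N) = Set.univ)
    (hcM : ∀ x ∈ M, f x = c) (hcN : ∀ x ∈ N, f x = c) {K : ℝ≥0∞} (hKf : K ≠ ⊤)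
    (hK : ∀ x ∈ A, ∫⁻ y in N, Dk n x y ∂μ ≤ K * ∫⁻ y in M, Dk n x y ∂μ) :
    nu μ p f Set.univ ≤ en μ p f A A + 2 * ((1 + K) * en μ p f A M) := by
  have h1 : ∀ B, en μ p f B (A ∪ (M ∪ N)) ≤ en μ p f B A + (en μ p f B M + en μ p f B N) := by
    intro B
    rw [en_comm μ p hf B (A ∪ (M ∪ N)), en_comm μ p hf B A, en_comm μ p hf B M, en_comm μ p hf B N]
    exact (en_union_le _ _ _ _ _ _).trans (by gcongr; exact en_union_le _ _ _ _ _ _)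
  have h2 : nu μ p f Set.univ = en μ p f (A ∪ (M ∪ N)) (A ∪ (M ∪ N)) := by rw [nu_eq_en, hU]
  have hd := en_dom μ p hp c hA hM hN hcM hcN hKf hK
  have h3 : en μ p f A (M ∪ N) ≤ (1 + K) * en μ p f A M := by
    rw [en_comm μ p hf, one_add_mul]
    refine (en_union_le _ _ _ _ _ _).trans ?_
    rw [en_comm μ p hf M, en_comm μ p hf N]
    gcongr
  have h4 : en μ p f (M ∪ N) (M ∪ N) = 0 :=
    en_const μ p hp c (hM.union hN) (hM.union hN) (by rintro x (h | h); exacts [hcM x h, hcN x h])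
      (by rintro x (h | h); exacts [hcM x h, hcN x h])
  rw [h2]
  calc _ ≤ en μ p f A (A ∪ (M ∪ N)) + en μ p f (M ∪ N) (A ∪ (M ∪ N)) := en_union_le _ _ _ _ _ _
    _ ≤ (en μ p f A A + en μ p f A (M ∪ N)) + (en μ p f A (M ∪ N) + 0) := by
        rw [en_comm μ p hf A (A ∪ (M ∪ N)), en_comm μ p hf (M ∪ N) (A ∪ (M ∪ N)), ← h4]
        refine add_le_add ((en_union_le _ _ _ _ _ _).trans ?_) (en_union_le _ _ _ _ _ _)
        rw [en_comm μ p hf (M ∪ N) A]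
    _ ≤ (en μ p f A A + (1 + K) * en μ p f A M) + ((1 + K) * en μ p f A M + 0) := by gcongr
    _ = _ := by ring

/-- the shape of both cut estimates -/
lemma cut_energy (μ : Measure (Es n)) [SFinite μ] (p : ℝ) (hp : 0 < p) {u v w : Es n → Fs n} (hv : Measurable v) (hw : Measurable w)
    {A A' M N R : Set (Es n)} (c : Fs n)
    (hA : MeasurableSet A) (hM : MeasurableSet M) (hN : MeasurableSet N) (hA' : MeasurableSet A')
    (hU : A ∪ (M ∪ N) = Set.univ)
    (hcM : ∀ x ∈ M, w x = c) (hcN : ∀ x ∈ N, w x = c) {K : ℝ≥0∞} (hKf : K ≠ ⊤)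
    (hK : ∀ x ∈ A, ∫⁻ y in N, Dk n x y ∂μ ≤ K * ∫⁻ y in M, Dk n x y ∂μ)
    (hwA : ∀ x ∈ A, w x = v x) (hwM : ∀ x ∈ M, w x = v x) (hMR : M ⊆ R) (hAR : A ⊆ A' ∪ R)
    (huv : ∀ x ∈ A', v x = u x) :
    nu μ p w Set.univ ≤ en μ p u A' A' + (4 + 2 * K) * nu μ p v R := by
  refine (en_total μ p hp hw c hA hM hN hU hcM hcN hKf hK).trans ?_
  rw [en_congr μ p hA hA hwA hwA, en_congr μ p hA hM hwA hwM, ← en_congr μ p hA' hA' huv huv]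
  have h1 : en μ p v A M ≤ nu μ p v R := by
    rw [en_comm μ p hv]
    exact (en_le_nu _ _ _ _ _).trans (nu_mono _ _ _ hMR)
  have h2 : en μ p v A A ≤ en μ p v A' A' + (nu μ p v R + nu μ p v R) := by
    calc en μ p v A A ≤ en μ p v (A' ∪ R) (A' ∪ R) := en_mono _ _ _ hAR hAR
      _ ≤ en μ p v A' (A' ∪ R) + en μ p v R (A' ∪ R) := en_union_le _ _ _ _ _ _
      _ ≤ (en μ p v A' A' + en μ p v R A') + nu μ p v R := by
          gcongr
          · rw [en_comm μ p hv]; exact en_union_le _ _ _ _ _ _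
          · exact en_le_nu _ _ _ _ _
      _ ≤ (en μ p v A' A' + nu μ p v R) + nu μ p v R := by
          gcongr
          exact en_le_nu _ _ _ _ _
      _ = _ := by ring
  calc _ ≤ (en μ p v A' A' + (nu μ p v R + nu μ p v R)) + 2 * ((1 + K) * nu μ p v R) := by gcongr
    _ = _ := by ring

end

section
variable {n : ℕ}

/-- inner ball -/
def B3 (n : ℕ) : Set (Es n) := {x | ‖x‖ ≤ 3}
/-- middle -/
def M36 (n : ℕ) : Set (Es n) := {x | 3 < ‖x‖ ∧ ‖x‖ ≤ 6}
/-- outer -/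
def O6 (n : ℕ) : Set (Es n) := {x | 6 < ‖x‖}

lemma B3_meas : MeasurableSet (B3 n) := measurableSet_le measurable_norm measurable_const
lemma O6_meas : MeasurableSet (O6 n) := measurableSet_lt measurable_const measurable_norm
lemma M36_meas : MeasurableSet (M36 n) :=
  (measurableSet_lt measurable_const measurable_norm).inter
    (measurableSet_le measurable_norm measurable_const)

lemma M36_sub : M36 n ⊆ Ann n := fun x hx => ⟨by linarith [hx.1], by linarith [hx.2]⟩
lemma M36_fin : muE n (M36 n) ≠ ⊤ := ne_top_of_le_ne_top Ann_fin (measure_mono M36_sub)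
lemma B3_fin : muE n (B3 n) ≠ ⊤ :=
  ((measure_mono (fun x hx => by simpa using (show ‖x‖ ≤ 3 from hx) : B3 n ⊆ Metric.closedBall 0 3)).trans_lt
    measure_closedBall_lt_top).ne

lemma M36_pos (hn : 1 ≤ n) : muE n (M36 n) ≠ 0 := by
  obtain ⟨x, hx⟩ := exists_norm hn 4 (by norm_num)
  have hs : Metric.ball x 1 ⊆ M36 n := by
    intro y hy
    rw [Metric.mem_ball, dist_eq_norm] at hy
    have h3 := norm_sub_norm_le x y
    rw [norm_sub_rev] at h3
    have h4 := norm_sub_norm_le y x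
    exact ⟨by linarith, by linarith⟩
  exact ((Metric.measure_ball_pos (muE n) x (by norm_num)).trans_le (measure_mono hs)).ne'

lemma Dk_comp {x y x' y' : Es n} {d : ℝ} (hd : 0 < d) (h0 : 0 < dist x' y') (h : dist x' y' ≤ d * dist x y) :
    Dk n x y ≤ ENNReal.ofReal (d ^ (2 * (n : ℝ))) * Dk n x' y' := by
  have h1 : 0 < dist x y := by
    by_contra h'
    have : dist x y = 0 := le_antisymm (not_lt.1 h') dist_nonneg
    rw [this, mul_zero] at h; linarith
  rw [Dk, Dk, ← ENNReal.ofReal_mul (by positivity)]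
  apply ENNReal.ofReal_le_ofReal
  rw [← div_eq_mul_inv, le_div_iff₀ (by positivity), inv_mul_le_iff₀ (by positivity),
    ← Real.mul_rpow dist_nonneg hd.le]
  refine Real.rpow_le_rpow h0.le (by linarith) (by positivity)

/-- constant -/
def K1 (n : ℕ) (p : ℝ) : ℝ≥0∞ := Jc n p * (ENNReal.ofReal (9 ^ (2 * (n : ℝ))) * (muE n (M36 n))⁻¹)
/-- constant -/
def K2 (n : ℕ) : ℝ≥0∞ := muE n (B3 n) * (ENNReal.ofReal (4 ^ (2 * (n : ℝ))) * (muE n (M36 n))⁻¹)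

lemma K1_fin (hn : 1 ≤ n) {p : ℝ} (hp : (n : ℝ) < p) : K1 n p ≠ ⊤ :=
  ENNReal.mul_ne_top (Jc_lt_top hn hp).ne (ENNReal.mul_ne_top ENNReal.ofReal_ne_top (ENNReal.inv_ne_top.2 (M36_pos hn)))
lemma K2_fin (hn : 1 ≤ n) : K2 n ≠ ⊤ :=
  ENNReal.mul_ne_top B3_fin (ENNReal.mul_ne_top ENNReal.ofReal_ne_top (ENNReal.inv_ne_top.2 (M36_pos hn)))

lemma avg_ge (hn : 1 ≤ n) {x : Es n} {a C : ℝ≥0∞} (hC : C ≠ ⊤) (h : ∀ y ∈ M36 n, a ≤ C * Dk n x y) :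
    a ≤ (C * (muE n (M36 n))⁻¹) * ∫⁻ y in M36 n, Dk n x y ∂(muE n) := by
  have h1 : a * muE n (M36 n) ≤ C * ∫⁻ y in M36 n, Dk n x y ∂(muE n) := by
    rw [← lintegral_const_mul' _ _ hC, ← setLIntegral_const]
    exact setLIntegral_mono' M36_meas h
  rw [mul_right_comm, ← div_eq_mul_inv, ENNReal.le_div_iff_mul_le (Or.inl (M36_pos hn)) (Or.inl M36_fin)]
  exact h1

lemma K1_prop (hn : 1 ≤ n) {p : ℝ} {x : Es n} (hx : x ∈ B3 n) :
    ∫⁻ y in O6 n, Dk n x y ∂(muE n) ≤ K1 n p * ∫⁻ y in M36 n, Dk n x y ∂(muE n) := by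
  have hx' : ‖x‖ ≤ 3 := hx
  have h1 : ∫⁻ y in O6 n, Dk n x y ∂(muE n) ≤ Jc n p := by
    rw [← Jc_translate p x]
    refine le_trans (setLIntegral_mono' O6_meas fun y hy => ?_) (setLIntegral_le_lintegral _ _)
    have hy' : 6 < ‖y‖ := hy
    have : 1 ≤ dist x y := by
      rw [dist_comm, dist_eq_norm]; linarith [norm_sub_norm_le y x]
    rw [min_eq_left this]; simp
  have h2 : 1 ≤ (ENNReal.ofReal (9 ^ (2 * (n : ℝ))) * (muE n (M36 n))⁻¹) * ∫⁻ y in M36 n, Dk n x y ∂(muE n) := by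
    refine avg_ge hn ENNReal.ofReal_ne_top fun y hy => ?_
    have h3 : 0 < dist x y := by
      rw [dist_comm, dist_eq_norm]; linarith [norm_sub_norm_le y x, hy.1]
    have h9 : dist x y ≤ 9 := by
      rw [dist_eq_norm]; linarith [norm_sub_le x y, hy.2]
    rw [Dk, ← ENNReal.ofReal_mul (by positivity), ← ENNReal.ofReal_one]
    apply ENNReal.ofReal_le_ofReal
    rw [← div_eq_mul_inv, le_div_iff₀ (by positivity), one_mul]
    exact Real.rpow_le_rpow h3.le h9 (by positivity)
  calc _ ≤ Jc n p * 1 := by rw [mul_one]; exact h1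
    _ ≤ _ := by rw [K1, mul_assoc]; gcongr

lemma K2_prop (hn : 1 ≤ n) {x : Es n} (hx : x ∈ O6 n) :
    ∫⁻ y in B3 n, Dk n x y ∂(muE n) ≤ K2 n * ∫⁻ y in M36 n, Dk n x y ∂(muE n) := by
  have hx' : 6 < ‖x‖ := hx
  rw [K2, mul_assoc, mul_comm (muE n (B3 n)), ← setLIntegral_const]
  refine setLIntegral_mono' B3_meas fun y hy => ?_
  have hy' : ‖y‖ ≤ 3 := hy
  refine avg_ge hn ENNReal.ofReal_ne_top fun z hz => ?_
  refine Dk_comp (by norm_num) ?_ ?_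
  · rw [dist_eq_norm]; linarith [norm_sub_norm_le x z, hz.2]
  · rw [dist_eq_norm, dist_eq_norm]; linarith [norm_sub_norm_le x y, norm_sub_le x z, hz.2]


/-! gluing -/

open Classical in
/-- inner piece -/
def vin (v : Sph n → Sph n) (c : Sph n) : Sph n → Sph n := ext c (fun x => if ‖x‖ ≤ 3 then v (sig x) else c)
open Classical in
/-- outer piece -/
def vout (v : Sph n → Sph n) (c : Sph n) : Sph n → Sph n :=
  ext (v (pole n)) (fun x => if ‖x‖ ≤ 3 then c else v (sig x))

lemma cont_if {X Y : Type*} [TopologicalSpace X] [TopologicalSpace Y] {f g : X × Es n → Y}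
    (hf : Continuous f) (hg : Continuous g) (h : ∀ t, ∀ x : Es n, ‖x‖ = 3 → f (t, x) = g (t, x)) :
    Continuous (fun z : X × Es n => if ‖z.2‖ ≤ 3 then f z else g z) :=
  Continuous.if_le hf hg (by fun_prop) continuous_const (fun z hz => h z.1 z.2 hz)

lemma vin_cont {v : Sph n → Sph n} (hv : Continuous v) {c : Sph n}
    (hc : ∀ x : Es n, 3 ≤ ‖x‖ → ‖x‖ ≤ 6 → v (sig x) = c) : Continuous (vin v c) := by
  have h1 : Continuous (fun z : Unit × Es n => if ‖z.2‖ ≤ 3 then v (sig z.2) else c) :=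
    cont_if (f := fun z : Unit × Es n => v (sig z.2)) (g := fun _ => c) (hv.comp (continuous_sig.comp continuous_snd))
      continuous_const (fun t x hx => hc x (by linarith) (by linarith))
  have := continuous_ext h1 (h := fun _ => c) continuous_const 4 (fun t x hx => by
    rw [if_neg]; linarith)
  exact this.comp (Continuous.prodMk_right ())

lemma vout_cont {v : Sph n → Sph n} (hv : Continuous v) {c : Sph n}
    (hc : ∀ x : Es n, 3 ≤ ‖x‖ → ‖x‖ ≤ 6 → v (sig x) = c) : Continuous (vout v c) := by
  have h1 : Continuous (fun z : Unit × Es n => if ‖z.2‖ ≤ 3 then c else v (sig z.2)) :=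
    cont_if (g := fun z : Unit × Es n => v (sig z.2)) (f := fun _ => c) continuous_const (hv.comp (continuous_sig.comp continuous_snd))
      (fun t x hx => (hc x (by linarith) (by linarith)).symm)
  have := continuous_ext h1 (h := fun z => v z.2) (hv.comp continuous_snd) 4 (fun t x hx => by
    rw [if_neg]; linarith)
  exact this.comp (Continuous.prodMk_right ())

/-- radial parameter -/
def lam (x : Es n) : unitInterval := Set.projIcc 0 1 zero_le_one ((‖x‖ - 3) / 3)

lemma lam_cont : Continuous (lam (n := n)) := continuous_projIcc.comp (by fun_prop)
lemma lam_zero {x : Es n} (h : ‖x‖ = 3) : lam x = 0 := by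
  unfold lam; rw [h]; exact Set.projIcc_of_le_left _ (by norm_num)
lemma lam_one {x : Es n} (h : 6 ≤ ‖x‖) : lam x = 1 := by
  unfold lam; exact Set.projIcc_of_right_le _ (by linarith)

lemma glue {v : Sph n → Sph n} (hv : Continuous v) {c : Sph n}
    (hc : ∀ x : Es n, 3 ≤ ‖x‖ → ‖x‖ ≤ 6 → v (sig x) = c) (hout : NullH (vout v c)) (hin : NullH (vin v c)) :
    NullH v := by
  obtain ⟨d, H, hH, H0, H1⟩ := hout
  have Hb : ∀ x : Es n, ‖x‖ ≤ 6 → H (0, sig x) = c := by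
    intro x hx
    rw [H0, vout, ext_sig]
    split_ifs with h
    · rfl
    · exact hc x (by linarith) hx
  let F : unitInterval → ℝ → Es n → Sph n := fun α β x => if ‖x‖ ≤ 3 then v (sig x) else H (α * lam x, sig (β • x))
  -- one stage
  have stage : ∀ (α : unitInterval → unitInterval) (β : unitInterval → ℝ) (h : unitInterval × Sph n → Sph n),
      Continuous α → Continuous β → (∀ t, |β t| ≤ 1) → Continuous h →
      (∀ t, ∀ x : Es n, 6 ≤ ‖x‖ → H (α t, sig (β t • x)) = h (t, sig x)) →
      Homotopic (ext (h (0, pole n)) (F (α 0) (β 0))) (ext (h (1, pole n)) (F (α 1) (β 1))) := by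
    intro α β h hα hβ hb hh hfar
    have hl := lam_cont (n := n)
    have hs := continuous_sig (n := n)
    have h1 : Continuous (fun z : unitInterval × Es n => F (α z.1) (β z.1) z.2) := by
      refine cont_if (f := fun z : unitInterval × Es n => v (sig z.2))
        (g := fun z => H (α z.1 * lam z.2, sig (β z.1 • z.2))) (by fun_prop) (by fun_prop) ?_
      intro t x hx
      simp only
      rw [lam_zero hx, mul_zero, Hb, hc x (by linarith) (by linarith)]
      rw [norm_smul, Real.norm_eq_abs, hx]
      linarith [hb t]
    have h2 := continuous_ext h1 hh 6 (fun t x hx => by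
      simp only [F]
      rw [if_neg (by linarith), lam_one hx, mul_one, hfar t x hx])
    exact ⟨_, h2, fun x => rfl, fun x => rfl⟩
  have S1 := stage (fun t => t) (fun _ => 1) (fun z => H z) continuous_id continuous_const (by simp) hH
    (by intro t x hx; rw [one_smul])
  have S2 := stage (fun _ => 1) (fun t => 1 - (t : ℝ)) (fun _ => d) continuous_const (by fun_prop)
    (fun t => by rw [abs_le]; constructor <;> linarith [t.2.1, t.2.2]) continuous_const
    (by intro t x hx; rw [H1])
  have S3 := stage (fun t => unitInterval.symm t) (fun _ => 0) (fun z => H (unitInterval.symm z.1, sig 0))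
    (by fun_prop) continuous_const (by simp) (by fun_prop) (by intro t x hx; rw [zero_smul])
  simp only [H1, unitInterval.symm_zero, unitInterval.symm_one, Set.Icc.coe_zero, Set.Icc.coe_one, sub_zero,
    sub_self] at S1 S2 S3
  have e0 : ext (H (0, pole n)) (F 0 1) = v := by
    funext y
    by_cases hy : y = pole n
    · rw [hy, ext_pole, H0, vout, ext_pole]
    · rw [← sig_tau hy, ext_sig]
      simp only [F]
      split_ifs with h
      · rfl
      · rw [zero_mul, one_smul, H0, vout, ext_sig, if_neg h]
  have e1 : ext (H (0, sig 0)) (F 0 0) = vin v c := by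
    unfold vin
    congr 1
    · exact Hb 0 (by simp)
    · funext x
      simp only [F, zero_mul, zero_smul]
      rw [Hb 0 (by simp)]
  rw [e0] at S1
  rw [e1] at S3
  exact NullH.congr ((S1.trans' S2).trans' S3) hin

/-- the cut lemma -/
lemma cut (hn : 1 ≤ n) {p : ℝ} (hp1 : 1 ≤ p) (hp : (n : ℝ) < p) : ∃ ε C : ℝ≥0∞, 0 < ε ∧ C ≠ ⊤ ∧
    ∀ f : Sph n → Sph n, Continuous f → ¬ NullH f → nu (muE n) p (cv f ∘ sig) (Ann n) ≤ ε →
    ∃ g : Sph n → Sph n, Continuous g ∧ ¬ NullH g ∧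
      (nu (muE n) p (cv g ∘ sig) Set.univ ≤ en (muE n) p (cv f ∘ sig) {x | ‖x‖ ≤ 1} {x | ‖x‖ ≤ 1} +
          C * nu (muE n) p (cv f ∘ sig) (Ann n) ∨
        nu (muE n) p (cv g ∘ sig) Set.univ ≤ en (muE n) p (cv f ∘ sig) {x | 8 < ‖x‖} {x | 8 < ‖x‖} +
          C * nu (muE n) p (cv f ∘ sig) (Ann n)) := by
  obtain ⟨ε, hε, hεa⟩ := exists_eps0 hn hp1
  have hp0 : 0 < p := by linarith
  refine ⟨ε, (4 + 2 * (K1 n p + K2 n)) * (4 ^ p * C4 n p), hε, ?_, ?_⟩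
  · have h1 := K1_fin hn hp
    have h2 := K2_fin hn
    have h3 := C4_fin hn hp1 hp
    have h4 : (4 : ℝ≥0∞) ^ p ≠ ⊤ := ENNReal.rpow_ne_top_of_nonneg (by linarith) (by norm_num)
    finiteness
  intro f hf hnull hfe
  obtain ⟨v, c, hvc, hfv, hoff, hmid, hen⟩ := cut_map hn hf hp1 (hεa _ hfe).1 (hεa _ hfe).2
  have hvn : ¬ NullH v := fun h => hnull (NullH.congr hfv h)
  have hci := vin_cont hvc hmid
  have hco := vout_cont hvc hmid
  have hvm : Measurable (cv v ∘ sig) := ((cv_cont hvc).comp continuous_sig).measurable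
  by_cases hi : NullH (vin v c)
  · have ho : ¬ NullH (vout v c) := fun h => hvn (glue hvc hmid h hi)
    refine ⟨_, hco, ho, Or.inr ?_⟩
    have e : ∀ x, (cv (vout v c) ∘ sig) x = if ‖x‖ ≤ 3 then (c : Fs n) else (cv v ∘ sig) x := by
      intro x
      simp only [Function.comp, cv, vout, ext_sig]
      split_ifs <;> rfl
    have := cut_energy (muE n) p hp0 (u := cv f ∘ sig) (v := cv v ∘ sig) (w := cv (vout v c) ∘ sig) hvm
      ((cv_cont hco).comp continuous_sig).measurable (A := O6 n) (M := M36 n) (N := B3 n) (A' := {x | 8 < ‖x‖})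
      (R := Ann n) (c : Fs n) O6_meas M36_meas B3_meas (measurableSet_lt measurable_const measurable_norm)
      (by
        ext x
        simp only [O6, M36, B3, Set.mem_union, Set.mem_ofPred_eq, Set.mem_univ, iff_true]
        by_cases h3 : ‖x‖ ≤ 3
        · simp [h3]
        · by_cases h6 : 6 < ‖x‖
          · simp [h6]
          · right; left; constructor <;> linarith)
      (by
        intro x hx
        rw [e, if_neg (by linarith [hx.1])]
        simp only [Function.comp, cv, hmid x hx.1.le hx.2])
      (by intro x hx; rw [e, if_pos (show ‖x‖ ≤ 3 from hx)]) (K2_fin hn) (fun x hx => K2_prop hn hx)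
      (by
        intro x hx
        have : 6 < ‖x‖ := hx
        rw [e, if_neg (by linarith)])
      (by intro x hx; rw [e, if_neg (by linarith [hx.1])]) M36_sub
      (by
        intro x hx
        have : 6 < ‖x‖ := hx
        by_cases h8 : 8 < ‖x‖
        · left; exact h8
        · right; constructor <;> linarith)
      (by
        intro x hx
        simp only [Function.comp, cv]
        rw [hoff x (fun h => by have : 8 < ‖x‖ := hx; linarith [h.2])])
    refine this.trans ?_
    rw [mul_assoc, mul_assoc]
    gcongr
    exact le_add_self
  · refine ⟨_, hci, hi, Or.inl ?_⟩
    have e : ∀ x, (cv (vin v c) ∘ sig) x = if ‖x‖ ≤ 3 then (cv v ∘ sig) x else (c : Fs n) := by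
      intro x
      simp only [Function.comp, cv, vin, ext_sig]
      split_ifs <;> rfl
    have := cut_energy (muE n) p hp0 (u := cv f ∘ sig) (v := cv v ∘ sig) (w := cv (vin v c) ∘ sig) hvm
      ((cv_cont hci).comp continuous_sig).measurable (A := B3 n) (M := M36 n) (N := O6 n) (A' := {x | ‖x‖ ≤ 1})
      (R := Ann n) (c : Fs n) B3_meas M36_meas O6_meas (measurableSet_le measurable_norm measurable_const)
      (by
        ext x
        simp only [O6, M36, B3, Set.mem_union, Set.mem_ofPred_eq, Set.mem_univ, iff_true]
        by_cases h3 : ‖x‖ ≤ 3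
        · simp [h3]
        · by_cases h6 : 6 < ‖x‖
          · simp [h6]
          · right; left; constructor <;> linarith)
      (by intro x hx; rw [e, if_neg (by linarith [hx.1])])
      (by
        intro x hx
        have : 6 < ‖x‖ := hx
        rw [e, if_neg (by linarith)]) (K1_fin hn hp) (fun x hx => K1_prop hn hx)
      (by intro x hx; rw [e, if_pos (show ‖x‖ ≤ 3 from hx)])
      (by
        intro x hx
        rw [e, if_neg (by linarith [hx.1])]
        simp only [Function.comp, cv, hmid x hx.1.le hx.2]) M36_sub
      (by
        intro x hx
        have : ‖x‖ ≤ 3 := hx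
        by_cases h8 : ‖x‖ ≤ 1
        · left; exact h8
        · right; constructor <;> linarith)
      (by
        intro x hx
        simp only [Function.comp, cv]
        rw [hoff x (fun h => by have : ‖x‖ ≤ 1 := hx; linarith [h.1])])
    refine this.trans ?_
    rw [mul_assoc, mul_assoc]
    gcongr
    exact le_self_add

end

section
variable {n : ℕ}

/-- minimal energy of non-trivial maps -/
def Em (n : ℕ) (p : ℝ) : ℝ≥0∞ :=
  ⨅ (f : Sph n → Sph n) (_ : Continuous f) (_ : ¬ NullH f), nu (muS n) p (cv f) Set.univ

lemma Em_le {p : ℝ} {f : Sph n → Sph n} (hf : Continuous f) (h : ¬ NullH f) : Em n p ≤ nu (muS n) p (cv f) Set.univ :=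
  iInf_le_of_le f (iInf_le_of_le hf (iInf_le_of_le h le_rfl))

lemma Em_fin (hn : 1 ≤ n) {p : ℝ} (hp : (n : ℝ) < p) : Em n p ≠ ⊤ :=
  ((Em_le continuous_id id_not_null).trans_lt (id_energy hn hp)).ne

lemma en_add_nu (p : ℝ) (u : Es n → Fs n) {B : Set (Es n)} (hB : MeasurableSet B) :
    en (muE n) p u B B + nu (muE n) p u Bᶜ ≤ nu (muE n) p u Set.univ := by
  rw [← nu_compl (muE n) p u hB]
  gcongr
  exact en_le_nu _ _ _ _ _

lemma dich_unit (hn : 1 ≤ n) {p : ℝ} (hp1 : 1 ≤ p) (hp : (n : ℝ) < p) : ∃ ε C : ℝ≥0∞, 0 < ε ∧ C ≠ ⊤ ∧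
    ∀ f : Sph n → Sph n, Continuous f → ¬ NullH f → ∀ δ : ℝ≥0∞, nu (muE n) p (cv f ∘ sig) Set.univ ≤ Em n p + δ →
    nu (muE n) p (cv f ∘ sig) (Ann n) ≤ ε →
      nu (muE n) p (cv f ∘ sig) {x | 1 < ‖x‖} ≤ δ + C * nu (muE n) p (cv f ∘ sig) (Ann n) ∨
      nu (muE n) p (cv f ∘ sig) {x | ‖x‖ ≤ 8} ≤ δ + C * nu (muE n) p (cv f ∘ sig) (Ann n) := by
  obtain ⟨ε, C, hε, hC, h⟩ := cut hn hp1 hp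
  refine ⟨ε, C, hε, hC, fun f hf hnull δ hE hA => ?_⟩
  obtain ⟨g, hg, hgn, h1⟩ := h f hf hnull hA
  have hm : Em n p ≤ nu (muE n) p (cv g ∘ sig) Set.univ := by
    have := Em_le (p := p) hg hgn
    rwa [nu_sig hn (by linarith) _ MeasurableSet.univ, Set.preimage_univ] at this
  have hmf := Em_fin hn hp
  have key : ∀ B : Set (Es n), MeasurableSet B → nu (muE n) p (cv g ∘ sig) Set.univ ≤
      en (muE n) p (cv f ∘ sig) B B + C * nu (muE n) p (cv f ∘ sig) (Ann n) →
      nu (muE n) p (cv f ∘ sig) Bᶜ ≤ δ + C * nu (muE n) p (cv f ∘ sig) (Ann n) := by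
    intro B hB h2
    have h3 := en_add_nu p (cv f ∘ sig) hB
    refine (ENNReal.add_le_add_iff_left hmf).1 ?_
    calc Em n p + nu (muE n) p (cv f ∘ sig) Bᶜ ≤
        (en (muE n) p (cv f ∘ sig) B B + C * nu (muE n) p (cv f ∘ sig) (Ann n)) + nu (muE n) p (cv f ∘ sig) Bᶜ := by
          gcongr; exact hm.trans h2
      _ = (en (muE n) p (cv f ∘ sig) B B + nu (muE n) p (cv f ∘ sig) Bᶜ) + C * nu (muE n) p (cv f ∘ sig) (Ann n) := by
          ring
      _ ≤ (Em n p + δ) + C * nu (muE n) p (cv f ∘ sig) (Ann n) := add_le_add (h3.trans hE) le_rfl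
      _ = _ := by ring
  rcases h1 with h1 | h1
  · left
    have := key _ (measurableSet_le measurable_norm measurable_const) h1
    convert this using 2
    ext x; simp
  · right
    have := key _ (measurableSet_lt measurable_const measurable_norm) h1
    convert this using 2
    ext x; simp

/-- annulus at scale `r` -/
def Anr (n : ℕ) (r : ℝ) : Set (Es n) := {x | r < ‖x‖ ∧ ‖x‖ ≤ 8 * r}

lemma Anr_meas (r : ℝ) : MeasurableSet (Anr n r) :=
  (measurableSet_lt measurable_const measurable_norm).inter
    (measurableSet_le measurable_norm measurable_const)

lemma cv_mobS (f : Sph n → Sph n) (a : Es n) (ρ : ℝ) : cv (f ∘ mobS a ρ) ∘ sig = (cv f ∘ sig) ∘ mob a ρ := by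
  funext x
  simp [cv, mobS_sig]

lemma mobS_null {f : Sph n → Sph n} (h : ¬ NullH f) (a : Es n) {ρ : ℝ} (hρ : 0 < ρ) : ¬ NullH (f ∘ mobS a ρ) :=
  fun h' => h (NullH.of_precomp (continuous_mobS _ (inv_pos.2 hρ)) (mobS_inv a hρ) h')

lemma dich (hn : 1 ≤ n) {p : ℝ} (hp1 : 1 ≤ p) (hp : (n : ℝ) < p) : ∃ ε C : ℝ≥0∞, 0 < ε ∧ C ≠ ⊤ ∧
    ∀ f : Sph n → Sph n, Continuous f → ¬ NullH f → ∀ δ : ℝ≥0∞, nu (muE n) p (cv f ∘ sig) Set.univ ≤ Em n p + δ →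
    ∀ r : ℝ, 0 < r → nu (muE n) p (cv f ∘ sig) (Anr n r) ≤ ε →
      nu (muE n) p (cv f ∘ sig) {x | r < ‖x‖} ≤ δ + C * nu (muE n) p (cv f ∘ sig) (Anr n r) ∨
      nu (muE n) p (cv f ∘ sig) {x | ‖x‖ ≤ 8 * r} ≤ δ + C * nu (muE n) p (cv f ∘ sig) (Anr n r) := by
  obtain ⟨ε, C, hε, hC, h⟩ := dich_unit hn hp1 hp
  refine ⟨ε, C, hε, hC, fun f hf hnull δ hE r hr hA => ?_⟩
  have hnm : ∀ x : Es n, ‖mob 0 r x‖ = r * ‖x‖ := by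
    intro x; simp [mob, norm_smul, abs_of_pos hr]
  have e1 : nu (muE n) p (cv f ∘ sig) (Anr n r) = nu (muE n) p ((cv f ∘ sig) ∘ mob 0 r) (Ann n) := by
    rw [nu_mob _ 0 hr (Anr_meas r)]
    congr 1
    ext x
    simp only [Anr, Ann, Set.mem_preimage, Set.mem_ofPred_eq, hnm]
    constructor
    · rintro ⟨h1, h2⟩; exact ⟨by nlinarith, by nlinarith⟩
    · rintro ⟨h1, h2⟩; exact ⟨by nlinarith, by nlinarith⟩
  have e2 : nu (muE n) p (cv f ∘ sig) {x | r < ‖x‖} = nu (muE n) p ((cv f ∘ sig) ∘ mob 0 r) {x | 1 < ‖x‖} := by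
    rw [nu_mob _ 0 hr (measurableSet_lt measurable_const measurable_norm)]
    congr 1
    ext x
    simp only [Set.mem_preimage, Set.mem_ofPred_eq, hnm]
    constructor <;> intro h <;> nlinarith
  have e3 : nu (muE n) p (cv f ∘ sig) {x | ‖x‖ ≤ 8 * r} = nu (muE n) p ((cv f ∘ sig) ∘ mob 0 r) {x | ‖x‖ ≤ 8} := by
    rw [nu_mob _ 0 hr (measurableSet_le measurable_norm measurable_const)]
    congr 1
    ext x
    simp only [Set.mem_preimage, Set.mem_ofPred_eq, hnm]
    constructor <;> intro h <;> nlinarith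
  have e4 : nu (muE n) p (cv f ∘ sig) Set.univ = nu (muE n) p ((cv f ∘ sig) ∘ mob 0 r) Set.univ := by
    rw [nu_mob _ 0 hr MeasurableSet.univ, Set.preimage_univ]
  rw [e1] at hA
  rw [e4] at hE
  rw [e1, e2, e3]
  have := h (f ∘ mobS 0 r) (hf.comp (continuous_mobS 0 hr)) (mobS_null hnull 0 hr) δ
  rw [cv_mobS] at this
  exact this hE hA

end

/-! ### Smoothing on the sphere -/
section
variable {n : ℕ}

lemma muS_fm (hn : 1 ≤ n) : IsFiniteMeasure (muS n) := ⟨muS_finite hn⟩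

/-- Ahlfors constant -/
def cS (n : ℕ) : ℝ≥0∞ := om n * ENNReal.ofReal ((1 / 2) ^ n)

lemma cS_pos : cS n ≠ 0 := mul_ne_zero om_pos (by simp)
lemma cS_fin : cS n ≠ ⊤ := ENNReal.mul_ne_top om_fin ENNReal.ofReal_ne_top

lemma ahlfors (hn : 1 ≤ n) (q : Sph n) {r : ℝ} (hr : 0 < r) (hr2 : r ≤ 2) :
    cS n * ENNReal.ofReal (r ^ n) ≤ muS n (Metric.closedBall q r) := by
  have h1 : muS n (Metric.closedBall q r) = muS n (Metric.closedBall (sig 0) r) := by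
    rw [← (muS_rot q).measure_preimage_emb (rot_emb q)]
    congr 1
    ext y
    simp only [Set.mem_preimage, Metric.mem_closedBall]
    have h := rot_dist q y (sig 0)
    rw [rot_zero] at h
    rw [h]
  rw [h1]
  have h2 : muS n (Metric.closedBall (sig 0) r) = ∫⁻ x in sig ⁻¹' (Metric.closedBall (sig 0) r), Wn x ∂(muE n) := by
    have := setLIntegral_muS hn (fun _ => 1) (B := Metric.closedBall (sig (0 : Es n)) r) Metric.isClosed_closedBall.measurableSet
    simpa using this
  have hb : Metric.ball (0 : Es n) (r / 2) ⊆ sig ⁻¹' (Metric.closedBall (sig 0) r) := by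
    intro x hx
    rw [Metric.mem_ball] at hx
    rw [Set.mem_preimage, Metric.mem_closedBall]
    apply le_of_sq_le_sq _ hr.le
    rw [dist_sig_sq]
    have h3 : wgt x ≤ 2 := by
      unfold wgt; rw [div_le_iff₀ (den_pos x)]; nlinarith [sq_nonneg ‖x‖]
    have h4 : wgt (0 : Es n) = 2 := by simp [wgt]
    have h5 := wgt_pos x
    have h6 := dist_nonneg (x := x) (y := 0)
    rw [h4]
    nlinarith [sq_nonneg (dist x 0)]
  rw [h2]
  calc cS n * ENNReal.ofReal (r ^ n) = muE n (Metric.ball 0 (r / 2)) := by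
        rw [Measure.addHaar_ball_of_pos _ _ (by positivity), cS, om]
        simp only [finrank_euclideanSpace, Fintype.card_fin]
        rw [mul_assoc, ← ENNReal.ofReal_mul (by positivity), mul_comm]
        congr 2
        rw [← mul_pow]
        congr 1
        ring
    _ = ∫⁻ x in Metric.ball (0 : Es n) (r / 2), 1 ∂(muE n) := by simp
    _ ≤ ∫⁻ x in Metric.ball (0 : Es n) (r / 2), Wn x ∂(muE n) := by
        refine setLIntegral_mono' measurableSet_ball fun x hx => ?_
        have hx1 : ‖x‖ < 1 := by
          rw [Metric.mem_ball, dist_zero_right] at hx; linarith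
        refine ENNReal.one_le_rpow ?_ (by exact_mod_cast hn)
        rw [← ENNReal.ofReal_one]
        apply ENNReal.ofReal_le_ofReal
        unfold wgt
        rw [le_div_iff₀ (den_pos x)]
        nlinarith [norm_nonneg x]
    _ ≤ _ := lintegral_mono_set hb

/-- bump -/
def psi (r : ℝ) (q y : Sph n) : ℝ := min 1 (max 0 (2 - dist q y / r))

lemma psi_nonneg (r : ℝ) (q y : Sph n) : 0 ≤ psi r q y := le_min zero_le_one (le_max_left _ _)
lemma psi_le (r : ℝ) (q y : Sph n) : psi r q y ≤ 1 := min_le_left _ _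
lemma psi_one {r : ℝ} (hr : 0 < r) {q y : Sph n} (h : dist q y ≤ r) : psi r q y = 1 := by
  unfold psi
  apply min_eq_left
  refine le_max_of_le_right ?_
  have : dist q y / r ≤ 1 := by rw [div_le_one hr]; exact h
  linarith
lemma psi_zero {r : ℝ} (hr : 0 < r) {q y : Sph n} (h : 2 * r ≤ dist q y) : psi r q y = 0 := by
  unfold psi
  rw [max_eq_left, min_eq_right zero_le_one]
  have : 2 ≤ dist q y / r := by rw [le_div_iff₀ hr]; exact h
  linarith
lemma psi_cont_y (r : ℝ) (q : Sph n) : Continuous (psi r q) := by unfold psi; fun_prop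
lemma psi_cont_q {X : Type*} [TopologicalSpace X] {r : X → ℝ} {q : X → Sph n} (hr : Continuous r) (h0 : ∀ x, r x ≠ 0)
    (hq : Continuous q) (y : Sph n) : Continuous (fun x => psi (r x) (q x) y) := by
  unfold psi
  exact continuous_const.min (continuous_const.max (continuous_const.sub ((hq.dist continuous_const).div hr h0)))

/-- mass -/
def Zr (r : ℝ) (q : Sph n) : ℝ≥0∞ := ∫⁻ y, ENNReal.ofReal (psi r q y) ∂(muS n)

lemma Zr_lower (hn : 1 ≤ n) {r : ℝ} (hr : 0 < r) (hr2 : r ≤ 2) (q : Sph n) : cS n * ENNReal.ofReal (r ^ n) ≤ Zr r q := by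
  refine (ahlfors hn q hr hr2).trans ?_
  rw [← setLIntegral_one]
  refine le_trans (setLIntegral_mono' Metric.isClosed_closedBall.measurableSet fun y hy => ?_) (setLIntegral_le_lintegral (Metric.closedBall q r) _)
  rw [psi_one hr (by rw [dist_comm]; exact hy), ENNReal.ofReal_one]

lemma Zr_pos (hn : 1 ≤ n) {r : ℝ} (hr : 0 < r) (hr2 : r ≤ 2) (q : Sph n) : Zr r q ≠ 0 := by
  have := Zr_lower hn hr hr2 q
  refine (lt_of_lt_of_le ?_ this).ne'
  rw [pos_iff_ne_zero]
  exact mul_ne_zero cS_pos (by simp [hr])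

lemma Zr_fin (hn : 1 ≤ n) (r : ℝ) (q : Sph n) : Zr r q ≠ ⊤ := by
  refine ne_top_of_le_ne_top (muS_finite hn).ne ?_
  rw [← setLIntegral_one, Measure.restrict_univ]
  refine lintegral_mono fun y => ?_
  rw [← ENNReal.ofReal_one]
  exact ENNReal.ofReal_le_ofReal (psi_le _ _ _)

/-- averaging measure -/
def Pr (r : ℝ) (q : Sph n) : Measure (Sph n) := (Zr r q)⁻¹ • (muS n).withDensity (fun y => ENNReal.ofReal (psi r q y))

lemma Pr_prob (hn : 1 ≤ n) {r : ℝ} (hr : 0 < r) (hr2 : r ≤ 2) (q : Sph n) : IsProbabilityMeasure (Pr r q) := ⟨by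
  rw [Pr, Measure.smul_apply, withDensity_apply _ MeasurableSet.univ, Measure.restrict_univ, smul_eq_mul]
  exact ENNReal.inv_mul_cancel (Zr_pos hn hr hr2 q) (Zr_fin hn r q)⟩

lemma Pr_le (hn : 1 ≤ n) {r : ℝ} (hr : 0 < r) (hr2 : r ≤ 2) (q : Sph n) :
    Pr r q ≤ (cS n * ENNReal.ofReal (r ^ n))⁻¹ • (muS n).restrict (Metric.closedBall q (2 * r)) := by
  rw [Measure.le_iff]
  intro s hs
  rw [Pr, Measure.smul_apply, withDensity_apply _ hs, Measure.smul_apply, smul_eq_mul, smul_eq_mul]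
  gcongr
  · exact Zr_lower hn hr hr2 q
  rw [Measure.restrict_apply hs]
  rw [← setLIntegral_one, Set.inter_comm, ← Measure.restrict_restrict Metric.isClosed_closedBall.measurableSet,
    ← lintegral_indicator Metric.isClosed_closedBall.measurableSet]
  refine lintegral_mono fun y => ?_
  by_cases hy : y ∈ Metric.closedBall q (2 * r)
  · rw [Set.indicator_of_mem hy, ← ENNReal.ofReal_one]
    exact ENNReal.ofReal_le_ofReal (psi_le _ _ _)
  · rw [psi_zero hr, ENNReal.ofReal_zero]; exact zero_le
    rw [Metric.mem_closedBall, dist_comm] at hy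
    linarith

/-- average -/
def wr (r : ℝ) (f : Sph n → Fs n) (q : Sph n) : Fs n := ∫ y, f y ∂(Pr r q)

lemma wr_eq (r : ℝ) (f : Sph n → Fs n) (q : Sph n) :
    wr r f q = (∫ y, psi r q y ∂(muS n))⁻¹ • ∫ y, psi r q y • f y ∂(muS n) := by
  have h1 : (Zr r q).toReal = ∫ y, psi r q y ∂(muS n) := by
    rw [integral_eq_lintegral_of_nonneg_ae (Filter.Eventually.of_forall fun y => psi_nonneg r q y)
      (psi_cont_y r q).aestronglyMeasurable]; rfl
  rw [wr, Pr, integral_smul_measure, ENNReal.toReal_inv, h1,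
    integral_withDensity_eq_integral_toReal_smul₀ ((psi_cont_y r q).measurable.ennreal_ofReal.aemeasurable)
      (Filter.Eventually.of_forall fun y => ENNReal.ofReal_lt_top)]
  congr 1
  refine integral_congr_ae (Filter.Eventually.of_forall fun y => ?_)
  simp only
  rw [ENNReal.toReal_ofReal (psi_nonneg _ _ _)]

lemma wr_cont (hn : 1 ≤ n) {X : Type*} [TopologicalSpace X] [FirstCountableTopology X] {r : X → ℝ} {q : X → Sph n}
    (hr : Continuous r) (h0 : ∀ x, 0 < r x) (h2 : ∀ x, r x ≤ 2)
    (hq : Continuous q) {f : Sph n → Fs n} (hf : Continuous f) (hf1 : ∀ y, ‖f y‖ = 1) :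
    Continuous (fun x => wr (r x) f (q x)) := by
  have := muS_fm hn
  simp only [wr_eq]
  have hp : ∀ y : Sph n, Continuous (fun x => psi (r x) (q x) y) := fun y => psi_cont_q hr (fun x => (h0 x).ne') hq y
  have hn1 : ∀ (x : X) (y : Sph n), ‖psi (r x) (q x) y‖ ≤ 1 := fun x y => by
    rw [Real.norm_of_nonneg (psi_nonneg _ _ _)]; exact psi_le _ _ _
  have hcz : Continuous (fun x => ∫ y, psi (r x) (q x) y ∂(muS n)) := by
    refine continuous_of_dominated (bound := fun _ => 1) ?_ ?_ (integrable_const _) ?_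
    · intro x; exact (psi_cont_y _ _).aestronglyMeasurable
    · intro x; exact Filter.Eventually.of_forall fun y => hn1 x y
    · exact Filter.Eventually.of_forall fun y => hp y
  have hnz : ∀ x, ∫ y, psi (r x) (q x) y ∂(muS n) ≠ 0 := by
    intro x
    have h1 : (Zr (r x) (q x)).toReal = ∫ y, psi (r x) (q x) y ∂(muS n) := by
      rw [integral_eq_lintegral_of_nonneg_ae (Filter.Eventually.of_forall fun y => psi_nonneg _ _ y)
        (psi_cont_y _ _).aestronglyMeasurable]; rfl
    rw [← h1]
    exact ENNReal.toReal_ne_zero.2 ⟨Zr_pos hn (h0 x) (h2 x) _, Zr_fin hn _ _⟩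
  refine (hcz.inv₀ hnz).smul ?_
  · refine continuous_of_dominated (bound := fun _ => 1) ?_ ?_ (integrable_const _) ?_
    · intro x; exact ((psi_cont_y _ _).smul hf).aestronglyMeasurable
    · intro x; refine Filter.Eventually.of_forall fun y => ?_
      rw [norm_smul, hf1, mul_one]; exact hn1 x y
    · exact Filter.Eventually.of_forall fun y => (hp y).smul continuous_const

/-- the main constant of this section -/
def CS (n : ℕ) : ℝ≥0∞ := (cS n)⁻¹ * (cS n)⁻¹ * ENNReal.ofReal (19 ^ (2 * (n : ℝ)))

lemma CS_fin : CS n ≠ ⊤ :=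
  ENNReal.mul_ne_top (ENNReal.mul_ne_top (ENNReal.inv_ne_top.2 cS_pos) (ENNReal.inv_ne_top.2 cS_pos)) ENNReal.ofReal_ne_top

lemma scale_const {r r' : ℝ} (hr : 0 < r) (hrr : r ≤ r') :
    (cS n * ENNReal.ofReal (r ^ n))⁻¹ * ((cS n * ENNReal.ofReal (r' ^ n))⁻¹ * ENNReal.ofReal ((19 * r) ^ (2 * (n : ℝ)))) ≤ CS n := by
  have hx : ENNReal.ofReal (r ^ n) ≠ 0 := by simp [hr]
  calc _ ≤ (cS n * ENNReal.ofReal (r ^ n))⁻¹ * ((cS n * ENNReal.ofReal (r ^ n))⁻¹ * ENNReal.ofReal ((19 * r) ^ (2 * (n : ℝ)))) := by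
        gcongr
    _ = CS n * ((ENNReal.ofReal (r ^ n))⁻¹ * ENNReal.ofReal (r ^ n)) * ((ENNReal.ofReal (r ^ n))⁻¹ * ENNReal.ofReal (r ^ n)) := by
        rw [ENNReal.mul_inv (Or.inl cS_pos) (Or.inl cS_fin), Real.mul_rpow (by norm_num) hr.le,
          ENNReal.ofReal_mul (by positivity)]
        have : r ^ (2 * (n : ℝ)) = r ^ n * r ^ n := by
          rw [two_mul, Real.rpow_add hr, Real.rpow_natCast]
        rw [this, ENNReal.ofReal_mul (by positivity), CS]
        ring
    _ = _ := by rw [ENNReal.inv_mul_cancel hx ENNReal.ofReal_ne_top]; simp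

lemma wr_diff (hn : 1 ≤ n) {p : ℝ} (hp : 1 ≤ p) {f : Sph n → Fs n} (hf : Continuous f) (hf1 : ∀ y, ‖f y‖ = 1)
    {r r' : ℝ} (hr : 0 < r) (hrr : r ≤ r') (h8 : r' ≤ 8 * r) (h2 : r' ≤ 2) {q q' : Sph n} (hq : dist q q' ≤ r) :
    ‖wr r f q - wr r' f q'‖ₑ ^ p ≤ CS n * nu (muS n) p f (Metric.closedBall q (2 * r)) := by
  have := Pr_prob hn hr (hrr.trans h2) q
  have := Pr_prob hn (hr.trans_le hrr) h2 q'
  have hr' := hr.trans_le hrr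
  refine (mean_two (integrable_unit hf hf1) (integrable_unit hf hf1) hp).trans ?_
  refine (dbl_le_en (by linarith) Metric.isClosed_closedBall.measurableSet Metric.isClosed_closedBall.measurableSet
    (Pr_le hn hr (hrr.trans h2) q) (Pr_le hn hr' h2 q') (d := 19 * r) ?_ ?_).trans ?_
  · intro x hx y hy
    rw [Metric.mem_closedBall] at hx hy
    have h1 := dist_triangle x q y
    have h3 := dist_triangle q q' y
    rw [dist_comm q' y] at h3
    linarith
  · exact ENNReal.inv_ne_top.2 (mul_ne_zero cS_pos (by simp [hr']))
  rw [← mul_assoc, ← mul_assoc]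
  refine mul_le_mul' ?_ (en_le_nu _ _ _ _ _)
  rw [mul_assoc]
  exact scale_const hr hrr

lemma wr_unit (hn : 1 ≤ n) {p : ℝ} (hp : 1 ≤ p) {f : Sph n → Fs n} (hf : Continuous f) (hf1 : ∀ y, ‖f y‖ = 1)
    {r : ℝ} (hr : 0 < r) (h2 : r ≤ 2) (q : Sph n) :
    ENNReal.ofReal (1 - ‖wr r f q‖) ^ p ≤ CS n * nu (muS n) p f (Metric.closedBall q (2 * r)) := by
  have := Pr_prob hn hr h2 q
  refine (mean_unit (integrable_unit hf hf1) hf1 hp).trans ?_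
  refine (dbl_le_en (by linarith) Metric.isClosed_closedBall.measurableSet Metric.isClosed_closedBall.measurableSet
    (Pr_le hn hr h2 q) (Pr_le hn hr h2 q) (d := 19 * r) ?_ ?_).trans ?_
  · intro x hx y hy
    rw [Metric.mem_closedBall] at hx hy
    have h1 := dist_triangle x q y
    rw [dist_comm q y] at h1
    linarith
  · exact ENNReal.inv_ne_top.2 (mul_ne_zero cS_pos (by simp [hr]))
  rw [← mul_assoc, ← mul_assoc]
  refine mul_le_mul' ?_ (en_le_nu _ _ _ _ _)
  rw [mul_assoc]
  exact scale_const hr le_rfl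

lemma wr_Lp (hn : 1 ≤ n) {p : ℝ} (hp : 1 ≤ p) {f : Sph n → Fs n} (hf : Continuous f) (hf1 : ∀ y, ‖f y‖ = 1)
    {r : ℝ} (hr : 0 < r) (h2 : r ≤ 2) :
    ∫⁻ q, ‖f q - wr r f q‖ₑ ^ p ∂(muS n) ≤
      (cS n)⁻¹ * ENNReal.ofReal (2 ^ (2 * (n : ℝ))) * ENNReal.ofReal (r ^ n) * nu (muS n) p f Set.univ := by
  have hx : ENNReal.ofReal (r ^ n) ≠ 0 := by simp [hr]
  have hfin : (cS n)⁻¹ * ENNReal.ofReal (2 ^ (2 * (n : ℝ))) * ENNReal.ofReal (r ^ n) ≠ ⊤ :=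
    ENNReal.mul_ne_top (ENNReal.mul_ne_top (ENNReal.inv_ne_top.2 cS_pos) ENNReal.ofReal_ne_top) ENNReal.ofReal_ne_top
  unfold nu
  rw [Measure.restrict_univ, ← lintegral_const_mul' _ _ hfin]
  refine lintegral_mono fun q => ?_
  have := Pr_prob hn hr h2 q
  calc ‖f q - wr r f q‖ₑ ^ p ≤ ∫⁻ y, ‖f q - f y‖ₑ ^ p ∂(Pr r q) := mean_one (integrable_unit hf hf1) hp _
    _ ≤ ∫⁻ y, ‖f q - f y‖ₑ ^ p ∂((cS n * ENNReal.ofReal (r ^ n))⁻¹ • (muS n).restrict (Metric.closedBall q (2 * r))) :=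
        lintegral_mono' (Pr_le hn hr h2 q) le_rfl
    _ = (cS n * ENNReal.ofReal (r ^ n))⁻¹ * ∫⁻ y in Metric.closedBall q (2 * r), ‖f q - f y‖ₑ ^ p ∂(muS n) := by
        rw [lintegral_smul_measure]; rfl
    _ ≤ (cS n * ENNReal.ofReal (r ^ n))⁻¹ * ∫⁻ y in Metric.closedBall q (2 * r),
          ENNReal.ofReal ((2 * r) ^ (2 * (n : ℝ))) * ker p f q y ∂(muS n) := by
        refine mul_le_mul' le_rfl ?_
        refine setLIntegral_mono' Metric.isClosed_closedBall.measurableSet fun y hy => ?_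
        exact pw_le_ker (by linarith) f (by rw [dist_comm]; exact hy)
    _ ≤ (cS n * ENNReal.ofReal (r ^ n))⁻¹ * (ENNReal.ofReal ((2 * r) ^ (2 * (n : ℝ))) * ∫⁻ y, ker p f q y ∂(muS n)) := by
        rw [lintegral_const_mul' _ _ ENNReal.ofReal_ne_top]
        gcongr
        exact Measure.restrict_le_self
    _ = (cS n)⁻¹ * ENNReal.ofReal (2 ^ (2 * (n : ℝ))) * ENNReal.ofReal (r ^ n) * (∫⁻ y, ker p f q y ∂(muS n)) *
          ((ENNReal.ofReal (r ^ n))⁻¹ * ENNReal.ofReal (r ^ n)) := by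
        rw [ENNReal.mul_inv (Or.inl cS_pos) (Or.inl cS_fin), Real.mul_rpow (by norm_num) hr.le,
          ENNReal.ofReal_mul (by positivity)]
        have : r ^ (2 * (n : ℝ)) = r ^ n * r ^ n := by
          rw [two_mul, Real.rpow_add hr, Real.rpow_natCast]
        rw [this, ENNReal.ofReal_mul (by positivity)]
        ring
    _ = _ := by rw [ENNReal.inv_mul_cancel hx ENNReal.ofReal_ne_top, mul_one]

end

/-! ### Small energy on balls -/
section
variable {n : ℕ}

lemma CS_pos : CS n ≠ 0 :=
  mul_ne_zero (mul_ne_zero (ENNReal.inv_ne_zero.2 cS_fin) (ENNReal.inv_ne_zero.2 cS_fin))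
    (by rw [ne_eq, ENNReal.ofReal_eq_zero, not_le]; positivity)

/-- small energy threshold -/
def epS (n : ℕ) (p : ℝ) : ℝ≥0∞ := ENNReal.ofReal (1 / 2) ^ p / CS n

lemma epS_pos (p : ℝ) (hp : 0 < p) : 0 < epS n p := by
  unfold epS
  refine ENNReal.div_pos ?_ CS_fin
  rw [ne_eq, ENNReal.rpow_eq_zero_iff]
  push Not
  refine ⟨fun h => ?_, fun h => absurd h ENNReal.ofReal_ne_top⟩
  rw [ENNReal.ofReal_eq_zero] at h; norm_num at h

lemma epS_fin (p : ℝ) (hp : 0 < p) : epS n p ≠ ⊤ := by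
  unfold epS
  exact ENNReal.div_ne_top (ENNReal.rpow_ne_top_of_nonneg hp.le ENNReal.ofReal_ne_top) CS_pos

lemma CS_epS (p : ℝ) : CS n * epS n p = ENNReal.ofReal (1 / 2) ^ p := by
  unfold epS
  rw [mul_comm, ENNReal.div_mul_cancel CS_pos CS_fin]

lemma wr_half (hn : 1 ≤ n) {p : ℝ} (hp : 1 ≤ p) {f : Sph n → Fs n} (hf : Continuous f) (hf1 : ∀ y, ‖f y‖ = 1)
    {r : ℝ} (hr : 0 < r) (h2 : r ≤ 2) (q : Sph n) (h : nu (muS n) p f (Metric.closedBall q (2 * r)) ≤ epS n p) :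
    1 / 2 ≤ ‖wr r f q‖ := by
  have h1 := wr_unit hn hp hf hf1 hr h2 q
  have h3 : ENNReal.ofReal (1 - ‖wr r f q‖) ^ p ≤ ENNReal.ofReal (1 / 2) ^ p := by
    rw [← CS_epS (n := n) p]
    exact h1.trans (mul_le_mul' le_rfl h)
  rw [ENNReal.rpow_le_rpow_iff (by linarith), ENNReal.ofReal_le_ofReal_iff (by norm_num)] at h3
  linarith

lemma wr_close (hn : 1 ≤ n) {f : Sph n → Fs n} (hf : Continuous f) (hf1 : ∀ y, ‖f y‖ = 1)
    {r : ℝ} (hr : 0 < r) (h2 : r ≤ 2) (q : Sph n) {c : ℝ}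
    (h : ∀ y, dist y q ≤ 2 * r → ‖f y - f q‖ ≤ c) : ‖wr r f q - f q‖ ≤ c := by
  have := Pr_prob hn hr h2 q
  have hi : Integrable f (Pr r q) := integrable_unit hf hf1
  have h1 : wr r f q - f q = ∫ y, (f y - f q) ∂(Pr r q) := by
    rw [integral_sub hi (integrable_const _)]; simp [wr]
  rw [h1]
  have h3 := norm_integral_le_of_norm_le_const (μ := Pr r q) (f := fun y => f y - f q) (C := c) ?_
  · simpa using h3
  have hac : Pr r q ≪ (muS n).restrict (Metric.closedBall q (2 * r)) :=
    (Measure.absolutelyContinuous_of_le (Pr_le hn hr h2 q)).trans Measure.smul_absolutelyContinuous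
  refine hac.ae_le ?_
  filter_upwards [ae_restrict_mem (Metric.isClosed_closedBall.measurableSet : MeasurableSet (Metric.closedBall q (2 * r)))] with y hy
  exact h y hy

lemma hom_wr (hn : 1 ≤ n) {p : ℝ} (hp : 1 ≤ p) {f : Sph n → Sph n} (hf : Continuous f)
    {R : ℝ} (hR : 0 < R) (h2 : R ≤ 2) (h : ∀ q, nu (muS n) p (cv f) (Metric.closedBall q (2 * R)) ≤ epS n p) :
    Homotopic f (fun q => prj (wr R (cv f) q)) := by
  have hc := cv_cont hf
  have h1 := cv_norm f
  have huc := CompactSpace.uniformContinuous_of_continuous hc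
  rw [Metric.uniformContinuous_iff] at huc
  obtain ⟨δ, hδ, hu⟩ := huc (1 / 2) (by norm_num)
  set r := min R (δ / 3) with hrdef
  have hr : 0 < r := lt_min hR (by linarith)
  have hrR : r ≤ R := min_le_left _ _
  have hrd : r ≤ δ / 3 := min_le_right _ _
  have hcl : ∀ q, ‖wr r (cv f) q - cv f q‖ ≤ 1 / 2 := fun q => by
    refine wr_close hn hc h1 hr (hrR.trans h2) q fun y hy => ?_
    have := hu (a := y) (b := q) (by linarith)
    rw [dist_eq_norm] at this; exact this.le
  have hw : Continuous (fun q => wr r (cv f) q) :=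
    wr_cont hn (r := fun _ : Sph n => r) (q := fun q => q) continuous_const (fun _ => hr) (fun _ => hrR.trans h2) continuous_id hc h1
  have s1 : Homotopic f (fun q => prj (wr r (cv f) q)) := by
    have := homotopic_prj_lin (a := cv f) (b := fun q => wr r (cv f) q) hc hw (fun x => by
      have := hcl x; rw [h1]; linarith)
    have e : (fun x => prj (cv f x)) = f := by
      funext x; exact prj_coe _
    rw [e] at this; exact this
  refine s1.trans' ?_
  set ρ : unitInterval × Sph n → ℝ := fun z => r + z.1 * (R - r) with hρ
  have hρ0 : ∀ z, r ≤ ρ z := fun z => by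
    have := mul_nonneg z.1.2.1 (sub_nonneg.2 hrR); simp only [hρ]; linarith
  have hρ1 : ∀ z, ρ z ≤ R := fun z => by
    have := mul_le_mul_of_nonneg_right z.1.2.2 (sub_nonneg.2 hrR); simp only [hρ]; linarith
  have hρc : Continuous ρ := by simp only [hρ]; fun_prop
  have := homotopic_prj (G := fun z : unitInterval × Sph n => wr (ρ z) (cv f) z.2)
    (wr_cont hn hρc (fun z => hr.trans_le (hρ0 z)) (fun z => (hρ1 z).trans h2) continuous_snd hc h1) (fun z => by
      have := wr_half hn hp hc h1 (hr.trans_le (hρ0 z)) ((hρ1 z).trans h2) z.2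
        ((nu_mono _ _ _ (Metric.closedBall_subset_closedBall (by linarith [hρ1 z]))).trans (h z.2))
      intro h0; rw [h0, norm_zero] at this; linarith)
  have e0 : ∀ x, ρ (0, x) = r := fun x => by simp [hρ]
  have e1 : ∀ x, ρ (1, x) = R := fun x => by simp [hρ]
  simp only [e0, e1] at this
  exact this

lemma dist_sph_le (x y : Sph n) : dist x y ≤ 2 := by
  have h := norm_sub_le (x : Fs n) y
  rw [sph_norm, sph_norm] at h
  rw [Subtype.dist_eq, dist_eq_norm]; linarith

lemma small_null (hn : 1 ≤ n) {p : ℝ} (hp : 1 ≤ p) {f : Sph n → Sph n} (hf : Continuous f)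
    (h : nu (muS n) p (cv f) Set.univ ≤ epS n p) : NullH f := by
  have h1 := hom_wr hn hp hf (R := 2) (by norm_num) le_rfl (fun q => (nu_mono _ _ _ (Set.subset_univ _)).trans h)
  refine ⟨prj (wr 2 (cv f) (pole n)), ?_⟩
  have : (fun q => prj (wr 2 (cv f) q)) = fun _ => prj (wr 2 (cv f) (pole n)) := by
    funext q
    rw [wr_eq, wr_eq]
    have e : ∀ q y : Sph n, psi 2 q y = 1 := fun q y => psi_one (by norm_num) (dist_sph_le q y)
    simp only [e]
  rwa [this] at h1

lemma Em_ge (hn : 1 ≤ n) {p : ℝ} (hp : 1 ≤ p) : epS n p ≤ Em n p := by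
  unfold Em
  refine le_iInf fun f => le_iInf fun hf => le_iInf fun h => ?_
  by_contra hlt
  exact h (small_null hn hp hf (not_le.1 hlt).le)
end

/-! ### Hole filling -/
section
variable {n : ℕ}

/-- conclusion of the dichotomy -/
def DichP (n : ℕ) (p : ℝ) (ε C : ℝ≥0∞) : Prop :=
    ∀ f : Sph n → Sph n, Continuous f → ¬ NullH f → ∀ δ : ℝ≥0∞, nu (muE n) p (cv f ∘ sig) Set.univ ≤ Em n p + δ →
    ∀ r : ℝ, 0 < r → nu (muE n) p (cv f ∘ sig) (Anr n r) ≤ ε →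
      nu (muE n) p (cv f ∘ sig) {x | r < ‖x‖} ≤ δ + C * nu (muE n) p (cv f ∘ sig) (Anr n r) ∨
      nu (muE n) p (cv f ∘ sig) {x | ‖x‖ ≤ 8 * r} ≤ δ + C * nu (muE n) p (cv f ∘ sig) (Anr n r)

lemma Em_le' (hn : 1 ≤ n) {p : ℝ} (hp : 1 ≤ p) {f : Sph n → Sph n} (hf : Continuous f) (h : ¬ NullH f) :
    Em n p ≤ nu (muE n) p (cv f ∘ sig) Set.univ := by
  have := Em_le (p := p) hf h
  rwa [nu_sig hn (by linarith) _ MeasurableSet.univ, Set.preimage_univ] at this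

lemma cb_meas (r : ℝ) : MeasurableSet {x : Es n | ‖x‖ ≤ r} := measurableSet_le measurable_norm measurable_const
lemma co_meas (r : ℝ) : MeasurableSet {x : Es n | r < ‖x‖} := measurableSet_lt measurable_const measurable_norm

lemma hole_step (hn : 1 ≤ n) {p : ℝ} (hp : 1 ≤ p) {ε C ε1 δ : ℝ≥0∞} (hD : DichP n p ε C) (hC : C ≠ ⊤) (h1 : ε1 ≤ ε)
    (h2 : (1 + C) * ε1 + δ < Em n p) {f : Sph n → Sph n} (hf : Continuous f) (hnu : ¬ NullH f)
    (hE : nu (muE n) p (cv f ∘ sig) Set.univ ≤ Em n p + δ) {r : ℝ} (hr : 0 < r)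
    (hb : nu (muE n) p (cv f ∘ sig) {x | ‖x‖ ≤ 8 * r} ≤ ε1) :
    nu (muE n) p (cv f ∘ sig) {x | ‖x‖ ≤ r} ≤ δ + C / (1 + C) * nu (muE n) p (cv f ∘ sig) {x | ‖x‖ ≤ 8 * r} := by
  set N : Set (Es n) → ℝ≥0∞ := nu (muE n) p (cv f ∘ sig) with hN
  have hA : N (Anr n r) ≤ ε1 := (nu_mono _ _ _ (fun x hx => hx.2)).trans hb
  have hsm : N {x | ‖x‖ ≤ r} ≤ ε1 := (nu_mono _ _ _ (fun x (hx : ‖x‖ ≤ r) => show ‖x‖ ≤ 8 * r by linarith)).trans hb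
  have hu : N {x | ‖x‖ ≤ 8 * r} = N {x | ‖x‖ ≤ r} + N (Anr n r) := by
    rw [hN, ← nu_union _ _ _ (Anr_meas r)]
    · congr 1; ext x
      simp only [Set.mem_union, Set.mem_ofPred_eq, Anr]
      constructor
      · intro h
        by_cases h' : ‖x‖ ≤ r
        · exact Or.inl h'
        · exact Or.inr ⟨not_le.1 h', h⟩
      · rintro (h | h)
        · linarith
        · exact h.2
    · rw [Set.disjoint_left]
      intro x (hx : ‖x‖ ≤ r) hx'
      exact absurd hx'.1 (not_lt.2 hx)
  rcases hD f hf hnu δ hE r hr (hA.trans h1) with h | h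
  · exfalso
    have h3 : Em n p ≤ (1 + C) * ε1 + δ := by
      calc Em n p ≤ N Set.univ := Em_le' hn hp hf hnu
        _ = N {x | ‖x‖ ≤ r} + N {x | ‖x‖ ≤ r}ᶜ := (nu_compl _ _ _ (cb_meas r)).symm
        _ ≤ ε1 + (δ + C * ε1) := by
            refine add_le_add hsm ?_
            have e : {x : Es n | ‖x‖ ≤ r}ᶜ = {x | r < ‖x‖} := by ext x; simp
            rw [e]
            exact h.trans (add_le_add le_rfl (mul_le_mul' le_rfl hA))
        _ = (1 + C) * ε1 + δ := by ring
    exact absurd h2 (not_lt.2 h3)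
  · have h' : N {x | ‖x‖ ≤ r} + N (Anr n r) ≤ δ + C * N (Anr n r) := hu ▸ h
    have h1C : (1 + C) ≠ ⊤ := by simp [hC]
    have h1C0 : (1 + C) ≠ 0 := by simp
    have h3 : N {x | ‖x‖ ≤ r} * (1 + C) ≤ δ + C * N {x | ‖x‖ ≤ 8 * r} := by
      rw [hu]
      calc N {x | ‖x‖ ≤ r} * (1 + C) = N {x | ‖x‖ ≤ r} + C * N {x | ‖x‖ ≤ r} := by ring
        _ ≤ (δ + C * N (Anr n r)) + C * N {x | ‖x‖ ≤ r} := add_le_add (le_self_add.trans h') le_rfl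
        _ = _ := by ring
    have h4 := (ENNReal.le_div_iff_mul_le (Or.inl h1C0) (Or.inl h1C)).2 h3
    refine h4.trans ?_
    rw [ENNReal.add_div]
    refine add_le_add ?_ (le_of_eq ?_)
    · exact ENNReal.div_le_of_le_mul (le_mul_of_one_le_right' (by simp))
    · rw [ENNReal.div_eq_inv_mul, ENNReal.div_eq_inv_mul, mul_assoc]

lemma hole_iter (hn : 1 ≤ n) {p : ℝ} (hp : 1 ≤ p) {ε C ε1 δ : ℝ≥0∞} (hD : DichP n p ε C) (hC : C ≠ ⊤) (h1 : ε1 ≤ ε)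
    (h2 : (1 + C) * ε1 + δ < Em n p) {f : Sph n → Sph n} (hf : Continuous f) (hnu : ¬ NullH f)
    (hE : nu (muE n) p (cv f ∘ sig) Set.univ ≤ Em n p + δ) {R : ℝ} (hR : 0 < R)
    (hb : nu (muE n) p (cv f ∘ sig) {x | ‖x‖ ≤ R} ≤ ε1) (j : ℕ) :
    nu (muE n) p (cv f ∘ sig) {x | ‖x‖ ≤ R / 8 ^ j} ≤ (C / (1 + C)) ^ j * ε1 + (1 + C) * δ := by
  have h1C : (1 + C) ≠ ⊤ := by simp [hC]
  have h1C0 : (1 + C) ≠ 0 := by simp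
  induction j with
  | zero => simpa using hb.trans le_self_add
  | succ j ih =>
    have e : 8 * (R / 8 ^ (j + 1)) = R / 8 ^ j := by rw [pow_succ]; field_simp
    have hle : R / 8 ^ j ≤ R := div_le_self hR.le (one_le_pow₀ (by norm_num))
    have := hole_step hn hp hD hC h1 h2 hf hnu hE (r := R / 8 ^ (j + 1)) (by positivity) (by
      rw [e]
      exact (nu_mono _ _ _ (fun x (hx : ‖x‖ ≤ R / 8 ^ j) => show ‖x‖ ≤ R by linarith)).trans hb)
    rw [e] at this
    refine this.trans ?_
    calc δ + C / (1 + C) * nu (muE n) p (cv f ∘ sig) {x | ‖x‖ ≤ R / 8 ^ j}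
        ≤ δ + C / (1 + C) * ((C / (1 + C)) ^ j * ε1 + (1 + C) * δ) := by gcongr
      _ = δ + (C / (1 + C)) ^ (j + 1) * ε1 + (C / (1 + C) * (1 + C)) * δ := by ring
      _ = δ + (C / (1 + C)) ^ (j + 1) * ε1 + C * δ := by rw [ENNReal.div_mul_cancel h1C0 h1C]
      _ = _ := by ring

lemma nu_wd {p : ℝ} (f : Es n → Fs n) {A : Set (Es n)} (hA : MeasurableSet A) :
    nu (muE n) p f A = (muE n).withDensity (fun x => ∫⁻ y, ker p f x y ∂(muE n)) A := by
  rw [withDensity_apply _ hA]; rfl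

lemma nu_small {p : ℝ} {f : Es n → Fs n} (hfin : nu (muE n) p f Set.univ ≠ ⊤) (hn : 1 ≤ n) {ε1 : ℝ≥0∞} (h : ε1 ≠ 0) :
    ∃ r : ℝ, 0 < r ∧ ∀ x : Es n, nu (muE n) p f (Metric.closedBall x r) ≤ ε1 := by
  unfold nu at hfin
  rw [Measure.restrict_univ] at hfin
  obtain ⟨d, hd, hs⟩ := exists_pos_setLIntegral_lt_of_measure_lt hfin h
  have ht : Filter.Tendsto (fun r : ℝ => ENNReal.ofReal (r ^ n) * om n) (nhds 0) (nhds (ENNReal.ofReal (0 ^ n) * om n)) := by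
    refine ENNReal.Tendsto.mul_const ?_ (Or.inr om_fin)
    exact ENNReal.tendsto_ofReal (Continuous.tendsto (by fun_prop) 0)
  have h0 : ENNReal.ofReal ((0 : ℝ) ^ n) * om n = 0 := by rw [zero_pow (by omega)]; simp
  rw [h0] at ht
  have hev := (ht.eventually_lt_const hd)
  rw [Metric.eventually_nhds_iff] at hev
  obtain ⟨e, he, hev⟩ := hev
  refine ⟨e / 2, by positivity, fun x => (hs _ ?_).le⟩
  have := hev (y := e / 2) (by rw [Real.dist_eq, sub_zero, abs_of_pos (by positivity)]; linarith)
  rw [Measure.addHaar_closedBall _ _ (by positivity)]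
  simpa [om] using this

lemma nu_large {p : ℝ} (f : Es n → Fs n) {ε1 : ℝ≥0∞} {r : ℝ} (hr : 0 < r)
    (h : ∀ k : ℕ, nu (muE n) p f (Metric.closedBall 0 (r * 2 ^ k)) ≤ ε1) : nu (muE n) p f Set.univ ≤ ε1 := by
  rw [nu_wd f MeasurableSet.univ]
  have hm : Monotone (fun k : ℕ => Metric.closedBall (0 : Es n) (r * 2 ^ k)) := by
    intro a b hab
    exact Metric.closedBall_subset_closedBall (by gcongr; norm_num)
  have hU : (⋃ k : ℕ, Metric.closedBall (0 : Es n) (r * 2 ^ k)) = Set.univ := by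
    rw [Set.eq_univ_iff_forall]
    intro x
    rw [Set.mem_iUnion]
    obtain ⟨k, hk⟩ := pow_unbounded_of_one_lt (‖x‖ / r) (one_lt_two)
    refine ⟨k, ?_⟩
    rw [Metric.mem_closedBall, dist_zero_right]
    rw [div_lt_iff₀ hr] at hk
    linarith
  rw [← hU, hm.measure_iUnion]
  refine iSup_le fun k => ?_
  rw [← nu_wd f Metric.isClosed_closedBall.measurableSet]
  exact h k

lemma find_scale (hn : 1 ≤ n) {p : ℝ} {f : Es n → Fs n} (hfin : nu (muE n) p f Set.univ ≠ ⊤) {ε1 : ℝ≥0∞} (h : ε1 ≠ 0)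
    (hb : ε1 < nu (muE n) p f Set.univ) : ∃ r : ℝ, 0 < r ∧ (∀ x : Es n, nu (muE n) p f (Metric.closedBall x r) ≤ ε1) ∧
      ∃ x : Es n, ε1 < nu (muE n) p f (Metric.closedBall x (2 * r)) := by
  obtain ⟨r, hr, hs⟩ := nu_small hfin hn h
  by_contra hcon
  push Not at hcon
  have key : ∀ k : ℕ, ∀ x : Es n, nu (muE n) p f (Metric.closedBall x (r * 2 ^ k)) ≤ ε1 := by
    intro k
    induction k with
    | zero => simpa using hs
    | succ k ih =>
      have := hcon (r * 2 ^ k) (by positivity) ih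
      intro x
      have h3 := this x
      rwa [show 2 * (r * 2 ^ k) = r * 2 ^ (k + 1) by ring] at h3
  exact absurd hb (not_lt.2 (nu_large f hr (fun k => key k 0)))

end

/-! ### Normalization -/
section
variable {n : ℕ}

lemma nu_ann {p : ℝ} (f : Es n → Fs n) {r : ℝ} (hr : 0 < r) :
    nu (muE n) p f {x | ‖x‖ ≤ 8 * r} = nu (muE n) p f {x | ‖x‖ ≤ r} + nu (muE n) p f (Anr n r) := by
  rw [← nu_union _ _ _ (Anr_meas r)]
  · congr 1; ext x
    simp only [Set.mem_union, Set.mem_ofPred_eq, Anr]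
    constructor
    · intro h
      by_cases h' : ‖x‖ ≤ r
      · exact Or.inl h'
      · exact Or.inr ⟨not_le.1 h', h⟩
    · rintro (h | h)
      · linarith
      · exact h.2
  · rw [Set.disjoint_left]
    intro x (hx : ‖x‖ ≤ r) hx'
    exact absurd hx'.1 (not_lt.2 hx)

lemma pigeon {p : ℝ} (f : Es n → Fs n) {ε2 : ℝ≥0∞} (J : ℕ) (h : ∀ j < J, ε2 ≤ nu (muE n) p f (Anr n (2 * 8 ^ j))) :
    J * ε2 ≤ nu (muE n) p f {x | ‖x‖ ≤ 2 * 8 ^ J} := by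
  induction J with
  | zero => simp
  | succ J ih =>
    rw [show (2 : ℝ) * 8 ^ (J + 1) = 8 * (2 * 8 ^ J) by ring, nu_ann f (by positivity)]
    push_cast
    rw [add_mul, one_mul]
    exact add_le_add (ih fun j hj => h j (by omega)) (h J (by omega))

lemma rescale_map (hn : 1 ≤ n) {p : ℝ} (hp : 1 ≤ p) {ε C ε1 ε2 δ : ℝ≥0∞} (hD : DichP n p ε C) (hδ : δ ≠ ⊤) (hEm : Em n p ≠ ⊤)
    (h10 : ε1 ≠ 0) (h1 : ε1 < Em n p) (h2 : ε2 ≤ ε) (h3 : δ + C * ε2 ≤ ε1) {J : ℕ} (hJ : Em n p + δ < J * ε2)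
    {f : Sph n → Sph n} (hf : Continuous f) (hnu : ¬ NullH f)
    (hE : nu (muE n) p (cv f ∘ sig) Set.univ ≤ Em n p + δ) :
    ∃ g : Sph n → Sph n, Continuous g ∧ ¬ NullH g ∧ nu (muE n) p (cv g ∘ sig) Set.univ ≤ Em n p + δ ∧
      (∀ x, nu (muE n) p (cv g ∘ sig) (Metric.closedBall x 1) ≤ ε1) ∧
      nu (muE n) p (cv g ∘ sig) {x | 2 * 8 ^ J < ‖x‖} ≤ ε1 := by
  have hfin : nu (muE n) p (cv f ∘ sig) Set.univ ≠ ⊤ := ne_top_of_le_ne_top (ENNReal.add_ne_top.2 ⟨hEm, hδ⟩) hE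
  obtain ⟨r, hr, hs, a, ha⟩ := find_scale hn hfin h10 (h1.trans_le (Em_le' hn hp hf hnu))
  have hg := hf.comp (continuous_mobS a hr)
  have hgn := mobS_null hnu a hr
  have hball : ∀ x t, nu (muE n) p (cv (f ∘ mobS a r) ∘ sig) (Metric.closedBall x t) =
      nu (muE n) p (cv f ∘ sig) (Metric.closedBall (mob a r x) (r * t)) := by
    intro x t
    rw [cv_mobS, nu_mob (cv f ∘ sig) a hr Metric.isClosed_closedBall.measurableSet]
    congr 1
    ext y
    simp only [Set.mem_preimage, Metric.mem_closedBall, mob, dist_eq_norm]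
    rw [add_sub_add_left_eq_sub, ← smul_sub, norm_smul, Real.norm_of_nonneg hr.le]
    rw [mul_le_mul_iff_right₀ hr]
  have huniv : nu (muE n) p (cv (f ∘ mobS a r) ∘ sig) Set.univ ≤ Em n p + δ := by
    rw [cv_mobS]
    rwa [nu_mob (cv f ∘ sig) a hr MeasurableSet.univ, Set.preimage_univ] at hE
  refine ⟨f ∘ mobS a r, hg, hgn, huniv, fun x => ?_, ?_⟩
  · rw [hball, mul_one]; exact hs _
  · have h0 : ε1 < nu (muE n) p (cv (f ∘ mobS a r) ∘ sig) (Metric.closedBall 0 2) := by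
      rw [hball, mul_comm r 2]
      simpa [mob] using ha
    set N : Set (Es n) → ℝ≥0∞ := nu (muE n) p (cv (f ∘ mobS a r) ∘ sig) with hN
    obtain ⟨j, hj, hjA⟩ : ∃ j < J, N (Anr n (2 * 8 ^ j)) < ε2 := by
      by_contra hcon
      push Not at hcon
      have := pigeon _ J hcon
      exact absurd hJ (not_lt.2 (this.trans ((nu_mono _ _ _ (Set.subset_univ _)).trans huniv)))
    rcases hD _ hg hgn δ huniv (2 * 8 ^ j) (by positivity) (hjA.le.trans h2) with h | h
    · refine le_trans (nu_mono _ _ _ ?_) (h.trans ((add_le_add le_rfl (mul_le_mul' le_rfl hjA.le)).trans h3))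
      intro x (hx : 2 * 8 ^ J < ‖x‖)
      show 2 * 8 ^ j < ‖x‖
      have : (8 : ℝ) ^ j ≤ 8 ^ J := pow_le_pow_right₀ (by norm_num) hj.le
      linarith
    · exfalso
      refine absurd h0 (not_lt.2 ?_)
      refine le_trans (nu_mono _ _ _ ?_) (h.trans ((add_le_add le_rfl (mul_le_mul' le_rfl hjA.le)).trans h3))
      intro x hx
      rw [Metric.mem_closedBall, dist_zero_right] at hx
      show ‖x‖ ≤ 8 * (2 * 8 ^ j)
      have : (1 : ℝ) ≤ 8 ^ j := one_le_pow₀ (by norm_num)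
      linarith

lemma wgt_lower {x : Es n} {L : ℝ} (h : ‖x‖ ≤ L) (hL : 0 ≤ L) : 2 / (1 + L) ^ 2 ≤ wgt x := by
  unfold wgt
  apply div_le_div_of_nonneg_left (by norm_num) (den_pos x)
  nlinarith [norm_nonneg x]

lemma chord_ball {L : ℝ} (hL : 0 ≤ L) (x y : Es n) (hx : ‖x‖ ≤ L) (h : dist (sig x) (sig y) ≤ 1 / (2 + L) ^ 2) : dist x y ≤ 1 := by
  by_contra hc
  push Not at hc
  set d := dist x y with hd
  have hy : ‖y‖ ≤ L + d := by
    have : ‖y‖ ≤ ‖x‖ + ‖x - y‖ := by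
      have := norm_sub_le x (x - y); rwa [sub_sub_cancel] at this
    rw [hd, dist_eq_norm]; linarith
  have w1 := wgt_lower hx hL
  have w2 := wgt_lower hy (by linarith)
  have h1 : 2 / (2 + L) ^ 2 ≤ wgt x := le_trans (div_le_div_of_nonneg_left (by norm_num) (by positivity) (by nlinarith)) w1
  have h2 : 2 / ((2 + L) * d) ^ 2 ≤ wgt y := le_trans (div_le_div_of_nonneg_left (by norm_num) (by positivity) (by
    have : 1 + (L + d) ≤ (2 + L) * d := by nlinarith
    gcongr)) w2
  have h3 := dist_sig_sq x y
  have h4 : dist (sig x) (sig y) ^ 2 ≤ (1 / (2 + L) ^ 2) ^ 2 := by gcongr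
  have h5 : 2 / (2 + L) ^ 2 * (2 / ((2 + L) * d) ^ 2) * d ^ 2 ≤ wgt x * wgt y * dist x y ^ 2 := by
    rw [← hd]; gcongr; exact (wgt_pos x).le
  have hd0 : d ≠ 0 := by linarith
  have h6 : 2 / (2 + L) ^ 2 * (2 / ((2 + L) * d) ^ 2) * d ^ 2 = 4 * (1 / (2 + L) ^ 2) ^ 2 := by
    field_simp; norm_num
  have h7 : 0 < (1 / (2 + L) ^ 2) ^ 2 := by positivity
  rw [h6, ← h3] at h5
  linarith

lemma ball_small (hn : 1 ≤ n) {p : ℝ} (hp : 1 ≤ p) {g : Sph n → Sph n} {ε1 : ℝ≥0∞} {L : ℝ} (hL : 0 ≤ L)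
    (h1 : ∀ x, nu (muE n) p (cv g ∘ sig) (Metric.closedBall x 1) ≤ ε1)
    (h2 : nu (muE n) p (cv g ∘ sig) {x | L < ‖x‖} ≤ ε1) (q : Sph n) :
    nu (muS n) p (cv g) (Metric.closedBall q (1 / (2 + L) ^ 2 / 2)) ≤ ε1 := by
  rw [nu_sig hn (by linarith) _ Metric.isClosed_closedBall.measurableSet]
  by_cases hc : ∃ x, ‖x‖ ≤ L ∧ sig x ∈ Metric.closedBall q (1 / (2 + L) ^ 2 / 2)
  · obtain ⟨x, hx, hxq⟩ := hc
    refine le_trans (nu_mono _ _ _ ?_) (h1 x)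
    intro y hy
    rw [Set.mem_preimage, Metric.mem_closedBall] at hy
    rw [Metric.mem_closedBall] at hxq ⊢
    rw [dist_comm]
    refine chord_ball hL x y hx ?_
    have := dist_triangle_right (sig x) (sig y) q
    linarith
  · push Not at hc
    refine le_trans (nu_mono _ _ _ ?_) h2
    intro y hy
    by_contra hy2
    exact hc y (not_lt.1 hy2) hy

lemma rot_ball (hn : 1 ≤ n) {p : ℝ} (hp : 1 ≤ p) (g : Sph n → Sph n) (q : Sph n) (t : ℝ) :
    nu (muS n) p (cv g) (Metric.closedBall q t) =
      nu (muE n) p (cv (g ∘ rot q) ∘ sig) (sig ⁻¹' Metric.closedBall (sig 0) t) := by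
  rw [nu_rot _ q Metric.isClosed_closedBall.measurableSet]
  have e : rot q ⁻¹' Metric.closedBall q t = Metric.closedBall (sig 0) t := by
    ext y
    simp only [Set.mem_preimage, Metric.mem_closedBall]
    have h := rot_dist q y (sig 0)
    rw [rot_zero] at h
    rw [h]
  rw [e, nu_sig hn (by linarith) _ Metric.isClosed_closedBall.measurableSet]
  rfl

lemma dist_sig0 (x : Es n) : dist (sig x) (sig 0) ^ 2 = 4 * ‖x‖ ^ 2 / (1 + ‖x‖ ^ 2) := by
  rw [dist_sig_sq, dist_zero_right]
  simp only [wgt, norm_zero]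
  have := den_pos x
  field_simp
  ring

lemma sig0_in {t : ℝ} (ht : 0 ≤ t) : {x : Es n | ‖x‖ ≤ t / 2} ⊆ sig ⁻¹' Metric.closedBall (sig 0) t := by
  intro x (hx : ‖x‖ ≤ t / 2)
  rw [Set.mem_preimage, Metric.mem_closedBall]
  apply le_of_sq_le_sq _ ht
  rw [dist_sig0, div_le_iff₀ (den_pos x)]
  nlinarith [norm_nonneg x, sq_nonneg (t * ‖x‖)]

lemma sig0_out {t : ℝ} (ht : 0 ≤ t) (ht1 : t ≤ 1) : sig ⁻¹' Metric.closedBall (sig 0) t ⊆ {x : Es n | ‖x‖ ≤ t} := by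
  intro x hx
  rw [Set.mem_preimage, Metric.mem_closedBall] at hx
  show ‖x‖ ≤ t
  have h1 : dist (sig x) (sig 0) ^ 2 ≤ t ^ 2 := by gcongr
  rw [dist_sig0, div_le_iff₀ (den_pos x)] at h1
  apply le_of_sq_le_sq _ ht
  have : t ^ 2 ≤ 1 := by nlinarith
  nlinarith [sq_nonneg ‖x‖]

lemma rot_null {f : Sph n → Sph n} (h : ¬ NullH f) (q : Sph n) : ¬ NullH (f ∘ rot q) :=
  fun h' => h (NullH.of_precomp (rotE q).continuous (rot_rot q) h')

lemma sphere_decay (hn : 1 ≤ n) {p : ℝ} (hp : 1 ≤ p) {ε C ε1 δ : ℝ≥0∞} (hD : DichP n p ε C) (hC : C ≠ ⊤) (h1 : ε1 ≤ ε)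
    (h2 : (1 + C) * ε1 + δ < Em n p) {g : Sph n → Sph n} (hg : Continuous g) (hnu : ¬ NullH g)
    (hE : nu (muS n) p (cv g) Set.univ ≤ Em n p + δ) {R : ℝ} (hR : 0 < R) (hR1 : R ≤ 1)
    (hb : ∀ q, nu (muS n) p (cv g) (Metric.closedBall q (2 * R)) ≤ ε1) (q : Sph n) (j : ℕ) :
    nu (muS n) p (cv g) (Metric.closedBall q (R / 8 ^ j)) ≤ (C / (1 + C)) ^ j * ε1 + (1 + C) * δ := by
  rw [rot_ball hn hp]
  have hRj : R / 8 ^ j ≤ R := div_le_self hR.le (one_le_pow₀ (by norm_num))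
  refine (nu_mono _ _ _ (sig0_out (by positivity) (by linarith))).trans ?_
  refine hole_iter hn hp hD hC h1 h2 (hg.comp (rotE q).continuous) (rot_null hnu q) ?_ hR ?_ j
  · rw [nu_rot _ q MeasurableSet.univ, nu_sig hn (by linarith) _ (by simp)] at hE
    exact hE
  · have := hb q
    rw [rot_ball hn hp] at this
    refine (nu_mono _ _ _ ?_).trans this
    refine subset_trans ?_ (sig0_in (by positivity))
    intro x (hx : ‖x‖ ≤ R)
    show ‖x‖ ≤ 2 * R / 2
    linarith

/-- Normalized almost minimizers. -/
lemma normalized (hn : 1 ≤ n) {p : ℝ} (hp1 : 1 ≤ p) (hp : (n : ℝ) < p) :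
    ∃ (R : ℝ) (θ K δ0 ε1 : ℝ≥0∞), 0 < R ∧ R ≤ 1 ∧ θ < 1 ∧ K ≠ ⊤ ∧ 0 < δ0 ∧ ε1 + K * δ0 ≤ epS n p ∧
      ∀ δ ≤ δ0, 0 < δ → ∃ g : Sph n → Sph n, Continuous g ∧ ¬ NullH g ∧ nu (muS n) p (cv g) Set.univ ≤ Em n p + δ ∧
        ∀ (q : Sph n) (j : ℕ), nu (muS n) p (cv g) (Metric.closedBall q (R / 8 ^ j)) ≤ θ ^ j * ε1 + K * δ := by
  obtain ⟨ε, C, hε, hC, hD⟩ := dich hn hp1 hp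
  have hEm := Em_fin hn hp
  have hp0 : 0 < p := by linarith
  have hS := epS_pos (n := n) p hp0
  have hSf := epS_fin (n := n) p hp0
  have h1C : (1 + C) ≠ ⊤ := by simp [hC]
  have h1C0 : (1 + C) ≠ 0 := by simp
  have h1C1 : 1 ≤ 1 + C := le_self_add
  -- basic small number
  set e0 : ℝ≥0∞ := epS n p / 4 / (1 + C) with he0
  have he0p : 0 < e0 := ENNReal.div_pos (ENNReal.div_pos hS.ne' (by norm_num)).ne' h1C
  have he0m : (1 + C) * e0 = epS n p / 4 := ENNReal.mul_div_cancel h1C0 h1C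
  set ε1 := min ε e0 with hε1
  have h1p : 0 < ε1 := lt_min hε he0p
  have h1e : ε1 ≤ e0 := min_le_right _ _
  have h1f : ε1 ≠ ⊤ := by
    have h4 : epS n p / 4 ≠ ⊤ := ENNReal.div_ne_top hSf (by norm_num)
    refine ne_top_of_le_ne_top h4 (h1e.trans ?_)
    rw [← he0m]; exact le_mul_of_one_le_left' h1C1
  set ε2 := min ε (ε1 / 2 / (1 + C)) with hε2
  have h2p : 0 < ε2 := lt_min hε (ENNReal.div_pos (ENNReal.div_pos h1p.ne' (by norm_num)).ne' h1C)
  have h2C : C * ε2 ≤ ε1 / 2 := by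
    calc C * ε2 ≤ (1 + C) * (ε1 / 2 / (1 + C)) := mul_le_mul' le_add_self (min_le_right _ _)
      _ = _ := ENNReal.mul_div_cancel h1C0 h1C
  set δ0 := ε1 / 2 with hδ0
  have hd0p : 0 < δ0 := ENNReal.div_pos h1p.ne' (by norm_num)
  have hd01 : δ0 ≤ ε1 := ENNReal.half_le_self
  have hd0f : δ0 ≠ ⊤ := ne_top_of_le_ne_top h1f hd01
  have hK : (1 + C) * ε1 ≤ epS n p / 4 := by rw [← he0m]; exact mul_le_mul' le_rfl h1e
  have hepsS : ε1 ≤ epS n p / 4 := (le_mul_of_one_le_left' h1C1).trans hK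
  have h44 : epS n p / 4 + epS n p / 4 = epS n p / 2 := by
    rw [ENNReal.div_add_div_same, ← two_mul]
    rw [show (4 : ℝ≥0∞) = 2 * 2 by norm_num]
    exact ENNReal.mul_div_mul_left _ _ (by norm_num) (by norm_num)
  have hhalf : epS n p / 2 < Em n p := (ENNReal.half_lt_self hS.ne' hSf).trans_le (Em_ge hn hp1)
  obtain ⟨J, hJ⟩ := ENNReal.exists_nat_mul_gt h2p.ne' (ENNReal.add_ne_top.2 ⟨hEm, hd0f⟩)
  set L : ℝ := 2 * 8 ^ J with hL
  have hL0 : 0 ≤ L := by positivity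
  refine ⟨1 / (2 + L) ^ 2 / 2 / 2, C / (1 + C), 1 + C, δ0, ε1, by positivity, ?_, ?_, h1C, hd0p, ?_, ?_⟩
  · rw [div_div, div_div, div_le_one (by positivity)]
    nlinarith
  · rw [ENNReal.div_lt_iff (Or.inl h1C0) (Or.inl h1C), one_mul]
    rw [add_comm]
    exact ENNReal.lt_add_right hC (by norm_num)
  · calc ε1 + (1 + C) * δ0 ≤ epS n p / 4 + epS n p / 4 := add_le_add hepsS ((mul_le_mul' le_rfl hd01).trans hK)
      _ ≤ _ := by rw [h44]; exact ENNReal.half_le_self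
  · intro δ hδ hδp
    have hδf : δ ≠ ⊤ := ne_top_of_le_ne_top hd0f hδ
    have hlt : Em n p < Em n p + δ := ENNReal.lt_add_right hEm hδp.ne'
    obtain ⟨f, hf, hfn, hfE⟩ : ∃ f : Sph n → Sph n, Continuous f ∧ ¬ NullH f ∧ nu (muS n) p (cv f) Set.univ < Em n p + δ := by
      conv at hlt => lhs; unfold Em
      simp only [iInf_lt_iff] at hlt
      obtain ⟨f, hf, hfn, h⟩ := hlt
      exact ⟨f, hf, hfn, h⟩
    have hfE' : nu (muE n) p (cv f ∘ sig) Set.univ ≤ Em n p + δ := by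
      rw [nu_sig hn hp0 _ MeasurableSet.univ, Set.preimage_univ] at hfE; exact hfE.le
    have hsum : (1 + C) * ε1 + δ < Em n p := by
      refine lt_of_le_of_lt ?_ hhalf
      rw [← h44]
      exact add_le_add hK (hδ.trans (hd01.trans hepsS))
    obtain ⟨g, hg, hgn, hgE, hg1, hg2⟩ := rescale_map hn hp1 (ε1 := ε1) (ε2 := ε2) (δ := δ) hD hδf hEm h1p.ne'
      (lt_of_le_of_lt (hepsS.trans (le_self_add.trans h44.le)) hhalf) (min_le_left _ _)
      ((add_le_add hδ h2C).trans (by rw [hδ0, ENNReal.add_halves])) (J := J)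
      (lt_of_le_of_lt (add_le_add le_rfl hδ) hJ) hf hfn hfE'
    have hgE' : nu (muS n) p (cv g) Set.univ ≤ Em n p + δ := by
      rw [nu_sig hn hp0 _ MeasurableSet.univ, Set.preimage_univ]; exact hgE
    refine ⟨g, hg, hgn, hgE', fun q j => ?_⟩
    refine sphere_decay hn hp1 hD hC (min_le_left _ _) hsum hg hgn hgE' (by positivity) ?_ ?_ q j
    · rw [div_div, div_div, div_le_one (by positivity)]
      nlinarith
    · intro q
      rw [mul_div_cancel₀ _ (by norm_num : (2:ℝ) ≠ 0)]
      exact ball_small hn hp1 hL0 hg1 hg2 q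

end

/-! ### Compactness -/
section
variable {n : ℕ}

lemma asc_arz (w : ℕ → Sph n → Fs n) (hc : ∀ k, Continuous (w k)) (hb : ∀ k q, ‖w k q‖ ≤ 1)
    (hmod : ∀ ε > 0, ∃ d > 0, ∃ N : ℕ, ∀ k ≥ N, ∀ q q', dist q q' < d → ‖w k q - w k q'‖ < ε) :
    ∃ F : Sph n → Fs n, Continuous F ∧ ∃ φ : ℕ → ℕ, StrictMono φ ∧
      ∀ ε > 0, ∃ N : ℕ, ∀ k ≥ N, ∀ q, ‖w (φ k) q - F q‖ < ε := by
  let W : ℕ → BoundedContinuousFunction (Sph n) (Fs n) := fun k => BoundedContinuousFunction.mkOfCompact ⟨w k, hc k⟩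
  have hW : ∀ k q, W k q = w k q := fun k q => rfl
  have hK := BoundedContinuousFunction.arzela_ascoli (Metric.closedBall (0 : Fs n) 1) (isCompact_closedBall _ _)
    (Set.range W) (by
      rintro f x ⟨k, rfl⟩
      rw [Metric.mem_closedBall, dist_zero_right]; exact hb k x) (by
      intro x
      rw [Metric.equicontinuousAt_iff]
      intro ε hε
      obtain ⟨d, hd, N, hN⟩ := hmod ε hε
      have h1 : ∀ᶠ y in nhds x, ∀ k ∈ Set.Iio N, dist (w k x) (w k y) < ε := by
        rw [Filter.eventually_all_finite (Set.finite_Iio N)]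
        intro k _
        have := Metric.tendsto_nhds.1 ((hc k).tendsto x) ε hε
        filter_upwards [this] with y hy
        rwa [dist_comm]
      rw [Metric.eventually_nhds_iff] at h1
      obtain ⟨e, he, h1⟩ := h1
      refine ⟨min d e, lt_min hd he, fun y hy => ?_⟩
      rintro ⟨_, k, rfl⟩
      show dist (w k x) (w k y) < ε
      by_cases hk : k < N
      · exact h1 (hy.trans_le (min_le_right _ _)) k hk
      · rw [dist_eq_norm]
        exact hN k (not_lt.1 hk) x y (by rw [dist_comm]; exact hy.trans_le (min_le_left _ _)))
  obtain ⟨F, _, φ, hφ, ht⟩ := hK.tendsto_subseq (x := W) (fun k => subset_closure ⟨k, rfl⟩)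
  refine ⟨F, F.continuous, φ, hφ, fun ε hε => ?_⟩
  obtain ⟨N, hN⟩ := Metric.tendsto_atTop.1 ht ε hε
  refine ⟨N, fun k hk q => ?_⟩
  rw [← dist_eq_norm]
  exact (BoundedContinuousFunction.dist_coe_le_dist (f := W (φ k)) (g := F) q).trans_lt (hN k hk)

lemma tele {W : ℕ → Fs n} {A t b : ℝ} (hA : 0 ≤ A) (ht : 0 ≤ t) (ht1 : t < 1) (hb : 0 ≤ b)
    (h : ∀ i, ‖W (i + 1) - W i‖ ≤ A * t ^ (i + 1) + b) {j k : ℕ} (hjk : j ≤ k) :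
    ‖W k - W j‖ ≤ A * (t ^ j - t ^ k) / (1 - t) + k * b := by
  induction k, hjk using Nat.le_induction with
  | base => simp; positivity
  | succ k hk ih =>
    have h1 : ‖W (k + 1) - W j‖ ≤ ‖W (k + 1) - W k‖ + ‖W k - W j‖ := by
      have := norm_add_le (W (k + 1) - W k) (W k - W j); rwa [sub_add_sub_cancel] at this
    have h2 := h k
    have h0 : 0 < 1 - t := by linarith
    have h3 : A * (t ^ j - t ^ (k + 1)) / (1 - t) = A * (t ^ j - t ^ k) / (1 - t) + A * t ^ k := by
      rw [pow_succ]; field_simp; ring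
    have h4 : A * t ^ (k + 1) ≤ A * t ^ k := by
      apply mul_le_mul_of_nonneg_left _ hA
      exact pow_le_pow_of_le_one ht ht1.le (by omega)
    rw [h3]; push_cast
    linarith

lemma root_bound {p : ℝ} (hp : 1 ≤ p) {c θ ε1 K δ : ℝ≥0∞} {b x : ℝ} (hb : 0 ≤ b) (hc : c ≠ ⊤) (hε : ε1 ≠ ⊤) (hθ : θ < 1)
    (hδ : c * (K * δ) ≤ ENNReal.ofReal b ^ p) {j : ℕ} (h : ENNReal.ofReal x ^ p ≤ c * (θ ^ j * ε1 + K * δ)) :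
    x ≤ ((c * ε1) ^ p⁻¹).toReal * ((θ ^ p⁻¹).toReal) ^ j + b := by
  have hp0 : 0 < p := by linarith
  have hpi : 0 ≤ p⁻¹ := by positivity
  have h1 : ENNReal.ofReal x ≤ (c * (θ ^ j * ε1 + K * δ)) ^ p⁻¹ := (ENNReal.le_rpow_inv_iff hp0).2 h
  have h2 : (c * (θ ^ j * ε1 + K * δ)) ^ p⁻¹ ≤ (c * ε1) ^ p⁻¹ * (θ ^ p⁻¹) ^ j + ENNReal.ofReal b := by
    calc (c * (θ ^ j * ε1 + K * δ)) ^ p⁻¹ = (θ ^ j * (c * ε1) + c * (K * δ)) ^ p⁻¹ := by congr 1; ring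
      _ ≤ (θ ^ j * (c * ε1)) ^ p⁻¹ + (c * (K * δ)) ^ p⁻¹ := ENNReal.rpow_add_le_add_rpow _ _ hpi (inv_le_one_of_one_le₀ hp)
      _ ≤ (c * ε1) ^ p⁻¹ * (θ ^ p⁻¹) ^ j + ENNReal.ofReal b := by
          refine add_le_add (le_of_eq ?_) ((ENNReal.rpow_inv_le_iff hp0).2 hδ)
          rw [ENNReal.mul_rpow_of_nonneg _ _ hpi, mul_comm]
          congr 1
          rw [← ENNReal.rpow_natCast, ← ENNReal.rpow_natCast, ← ENNReal.rpow_mul, ← ENNReal.rpow_mul, mul_comm]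
  have f1 : (c * ε1) ^ p⁻¹ ≠ ⊤ := ENNReal.rpow_ne_top_of_nonneg hpi (ENNReal.mul_ne_top hc hε)
  have f2 : θ ^ p⁻¹ ≠ ⊤ := ENNReal.rpow_ne_top_of_nonneg hpi hθ.ne_top
  have h3 : (c * ε1) ^ p⁻¹ * (θ ^ p⁻¹) ^ j + ENNReal.ofReal b =
      ENNReal.ofReal (((c * ε1) ^ p⁻¹).toReal * ((θ ^ p⁻¹).toReal) ^ j + b) := by
    rw [ENNReal.ofReal_add (by positivity) hb, ENNReal.ofReal_mul (by positivity), ENNReal.ofReal_pow (by positivity),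
      ENNReal.ofReal_toReal f1, ENNReal.ofReal_toReal f2]
  rw [h3] at h2
  exact (ENNReal.ofReal_le_ofReal_iff (by positivity)).1 (h1.trans h2)

lemma wr_norm_le (hn : 1 ≤ n) {f : Sph n → Fs n} (hf1 : ∀ y, ‖f y‖ = 1)
    {r : ℝ} (hr : 0 < r) (h2 : r ≤ 2) (q : Sph n) : ‖wr r f q‖ ≤ 1 := by
  have := Pr_prob hn hr h2 q
  have h3 := norm_integral_le_of_norm_le_const (μ := Pr r q) (f := f) (C := 1) (Filter.Eventually.of_forall fun y => (hf1 y).le)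
  simpa [wr] using h3

/-- Fatou -/
lemma fatou_nu (hn : 1 ≤ n) {p : ℝ} (hp : 0 < p) {F : Sph n → Fs n} {u : ℕ → Sph n → Fs n} (hu : ∀ k, Continuous (u k))
    (h : ∀ᵐ q ∂(muS n), Filter.Tendsto (fun k => u k q) Filter.atTop (nhds (F q))) :
    nu (muS n) p F Set.univ ≤ Filter.liminf (fun k => nu (muS n) p (u k) Set.univ) Filter.atTop := by
  have := muS_fm hn
  unfold nu
  simp only [Measure.restrict_univ]
  calc ∫⁻ x, ∫⁻ y, ker p F x y ∂(muS n) ∂(muS n)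
      ≤ ∫⁻ x, Filter.liminf (fun k => ∫⁻ y, ker p (u k) x y ∂(muS n)) Filter.atTop ∂(muS n) := by
        refine lintegral_mono_ae ?_
        filter_upwards [h] with x hx
        calc ∫⁻ y, ker p F x y ∂(muS n) ≤ ∫⁻ y, Filter.liminf (fun k => ker p (u k) x y) Filter.atTop ∂(muS n) := by
              refine lintegral_mono_ae ?_
              filter_upwards [h] with y hy
              have ht : Filter.Tendsto (fun k => ker p (u k) x y) Filter.atTop (nhds (ker p F x y)) := by
                unfold ker
                refine ENNReal.Tendsto.mul_const ?_ (Or.inr Dk_ne_top)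
                refine ENNReal.tendsto_ofReal ?_
                exact ((hx.sub hy).norm).rpow_const (Or.inr hp.le)
              exact ht.liminf_eq.ge
          _ ≤ _ := lintegral_liminf_le fun k => measurable_ker_right (hu k).measurable x
    _ ≤ _ := lintegral_liminf_le fun k => measurable_inner (hu k).measurable

end

/-! ### Existence of a minimizer -/
section
variable {n : ℕ}

lemma exists_min (hn : 1 ≤ n) {p : ℝ} (hp1 : 1 ≤ p) (hp : (n : ℝ) < p) :
    ∃ f : Sph n → Sph n, Continuous f ∧ ¬ NullH f ∧ nu (muS n) p (cv f) Set.univ ≤ Em n p := by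
  obtain ⟨R, θ, K, δ0, ε1, hR, hR1, hθ, hK, hδ0, hS, hmain⟩ := normalized hn hp1 hp
  have hp0 : 0 < p := by linarith
  have hpi : 0 ≤ p⁻¹ := by positivity
  have hfm := muS_fm hn
  have hEm := Em_fin hn hp
  have hSf := epS_fin (n := n) p hp0
  have hepsF : ε1 ≠ ⊤ := ne_top_of_le_ne_top hSf (le_self_add.trans hS)
  set D : ℝ≥0∞ := CS n * K + 1 with hDdef
  have hD0 : D ≠ 0 := by simp [hDdef]
  have hDf : D ≠ ⊤ := by rw [hDdef]; exact ENNReal.add_ne_top.2 ⟨ENNReal.mul_ne_top CS_fin hK, by simp⟩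
  -- choice of the deltas
  set b : ℕ → ℝ := fun k => 1 / ((k : ℝ) + 1) ^ 2 with hb
  have hb0 : ∀ k, 0 < b k := fun k => by simp only [hb]; positivity
  set δ : ℕ → ℝ≥0∞ := fun k => min (min δ0 1) (min (ENNReal.ofReal (1 / ((k : ℝ) + 1))) (ENNReal.ofReal (b k) ^ p / D)) with hδ
  have hδp : ∀ k, 0 < δ k := fun k => by
    refine lt_min (lt_min hδ0 one_pos) (lt_min ?_ ?_)
    · rw [ENNReal.ofReal_pos]; positivity
    · refine ENNReal.div_pos ?_ hDf
      rw [ne_eq, ENNReal.rpow_eq_zero_iff]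
      push Not
      refine ⟨fun h => ?_, fun h => absurd h ENNReal.ofReal_ne_top⟩
      rw [ENNReal.ofReal_eq_zero] at h; exact absurd (hb0 k) (not_lt.2 h)
  have hδle : ∀ k, δ k ≤ δ0 := fun k => (min_le_left _ _).trans (min_le_left _ _)
  have hδ1 : ∀ k, δ k ≤ 1 := fun k => (min_le_left _ _).trans (min_le_right _ _)
  have hδk : ∀ k, δ k ≤ ENNReal.ofReal (1 / ((k : ℝ) + 1)) := fun k => (min_le_right _ _).trans (min_le_left _ _)
  have hδb : ∀ k, CS n * (K * δ k) ≤ ENNReal.ofReal (b k) ^ p := fun k => by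
    calc CS n * (K * δ k) = (CS n * K) * δ k := by ring
      _ ≤ D * (ENNReal.ofReal (b k) ^ p / D) := mul_le_mul' le_self_add ((min_le_right _ _).trans (min_le_right _ _))
      _ = _ := ENNReal.mul_div_cancel hD0 hDf
  choose g hg hgn hgE hgd using fun k => hmain (δ k) (hδle k) (hδp k)
  have hcv := fun k => cv_cont (hg k)
  have hcv1 := fun k => cv_norm (g k)
  -- radii
  set ρ : ℕ → ℝ := fun j => R / 8 ^ j / 2 with hρ
  have hρ0 : ∀ j, 0 < ρ j := fun j => by simp only [hρ]; positivity
  have h2ρ : ∀ j, 2 * ρ j = R / 8 ^ j := fun j => by simp only [hρ]; ring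
  have hρ2 : ∀ j, ρ j ≤ 2 := fun j => by
    have : R / 8 ^ j ≤ R := div_le_self hR.le (one_le_pow₀ (by norm_num))
    have := h2ρ j
    linarith
  have hρs : ∀ j, ρ j = 8 * ρ (j + 1) := fun j => by simp only [hρ]; rw [pow_succ]; field_simp
  have hρl : ∀ j, ρ (j + 1) ≤ ρ j := fun j => by rw [hρs j]; linarith [hρ0 (j + 1)]
  have hd : ∀ k q j, nu (muS n) p (cv (g k)) (Metric.closedBall q (2 * ρ j)) ≤ θ ^ j * ε1 + K * δ k := fun k q j => by
    rw [h2ρ]; exact hgd k q j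
  -- real constants
  set A : ℝ := ((CS n * ε1) ^ p⁻¹).toReal with hA
  set t : ℝ := (θ ^ p⁻¹).toReal with ht
  have hA0 : 0 ≤ A := ENNReal.toReal_nonneg
  have ht0 : 0 ≤ t := ENNReal.toReal_nonneg
  have ht1 : t < 1 := by
    have h1 : θ ^ p⁻¹ < 1 := ENNReal.rpow_lt_one hθ (by positivity)
    rw [ht, ← ENNReal.toReal_one]
    exact (ENNReal.toReal_lt_toReal h1.ne_top (by simp)).2 h1
  have h1t : 0 < 1 - t := by linarith
  have key : ∀ k q j (x : ℝ), ENNReal.ofReal x ^ p ≤ CS n * nu (muS n) p (cv (g k)) (Metric.closedBall q (2 * ρ j)) →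
      x ≤ A * t ^ j + b k := fun k q j x hx =>
    root_bound hp1 (hb0 k).le CS_fin hepsF hθ (hδb k) (hx.trans (mul_le_mul' le_rfl (hd k q j)))
  have same : ∀ k j q q', dist q q' ≤ ρ j → ‖wr (ρ j) (cv (g k)) q - wr (ρ j) (cv (g k)) q'‖ ≤ A * t ^ j + b k := by
    intro k j q q' hq
    refine key k q j _ ?_
    rw [ofReal_norm]
    exact wr_diff hn hp1 (hcv k) (hcv1 k) (hρ0 j) le_rfl (by linarith [hρ0 j]) (hρ2 j) hq
  have step : ∀ k q j, ‖wr (ρ (j + 1)) (cv (g k)) q - wr (ρ j) (cv (g k)) q‖ ≤ A * t ^ (j + 1) + b k := by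
    intro k q j
    refine key k q (j + 1) _ ?_
    rw [ofReal_norm]
    exact wr_diff hn hp1 (hcv k) (hcv1 k) (hρ0 (j + 1)) (hρl j) (hρs j).le (hρ2 j) (by rw [dist_self]; exact (hρ0 _).le)
  set w : ℕ → Sph n → Fs n := fun k q => wr (ρ k) (cv (g k)) q with hw
  have hwc : ∀ k, Continuous (w k) := fun k =>
    wr_cont hn (r := fun _ : Sph n => ρ k) (q := fun q => q) continuous_const (fun _ => hρ0 k) (fun _ => hρ2 k) continuous_id (hcv k) (hcv1 k)
  have hw1 : ∀ k q, ‖w k q‖ ≤ 1 := fun k q => wr_norm_le hn (hcv1 k) (hρ0 k) (hρ2 k) q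
  have hwl : ∀ k q, 1 - ‖w k q‖ ≤ A * t ^ k + b k := fun k q =>
    key k q k _ (wr_unit hn hp1 (hcv k) (hcv1 k) (hρ0 k) (hρ2 k) q)
  have hkb : ∀ k : ℕ, (k : ℝ) * b k ≤ 1 / ((k : ℝ) + 1) := fun k => by
    simp only [hb]
    rw [mul_one_div, div_le_div_iff₀ (by positivity) (by positivity)]
    nlinarith [(Nat.cast_nonneg k : (0 : ℝ) ≤ k)]
  have hb1 : ∀ k : ℕ, b k ≤ 1 / ((k : ℝ) + 1) := fun k => by
    simp only [hb]
    apply one_div_le_one_div_of_le (by positivity)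
    nlinarith [(Nat.cast_nonneg k : (0 : ℝ) ≤ k)]
  set M : ℝ := 2 * (A / (1 - t)) + A with hM
  have hmod1 : ∀ k j q q', j ≤ k → dist q q' ≤ ρ j → ‖w k q - w k q'‖ ≤ M * t ^ j + 3 * (1 / ((k : ℝ) + 1)) := by
    intro k j q q' hjk hq
    have e1 : ∀ q, ‖w k q - wr (ρ j) (cv (g k)) q‖ ≤ A / (1 - t) * t ^ j + 1 / ((k : ℝ) + 1) := fun q => by
      have := tele (W := fun i => wr (ρ i) (cv (g k)) q) hA0 ht0 ht1 (hb0 k).le (step k q) hjk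
      refine this.trans (add_le_add ?_ (hkb k))
      rw [div_mul_eq_mul_div]
      gcongr
      have : 0 ≤ t ^ k := by positivity
      linarith
    have e2 := same k j q q' hq
    have h1 := e1 q
    have h2 := e1 q'
    have h3 := hb1 k
    have tri : ‖w k q - w k q'‖ ≤ ‖w k q - wr (ρ j) (cv (g k)) q‖ + ‖wr (ρ j) (cv (g k)) q - wr (ρ j) (cv (g k)) q'‖
        + ‖w k q' - wr (ρ j) (cv (g k)) q'‖ := by
      rw [norm_sub_rev (w k q') _]
      have := norm_add₃_le (a := w k q - wr (ρ j) (cv (g k)) q) (b := wr (ρ j) (cv (g k)) q - wr (ρ j) (cv (g k)) q')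
        (c := wr (ρ j) (cv (g k)) q' - w k q')
      rwa [sub_add_sub_cancel, sub_add_sub_cancel] at this
    have e : M * t ^ j = 2 * (A / (1 - t) * t ^ j) + A * t ^ j := by rw [hM]; ring
    rw [e]
    linarith
  have tt : Filter.Tendsto (fun k : ℕ => t ^ k) Filter.atTop (nhds 0) := tendsto_pow_atTop_nhds_zero_of_lt_one ht0 ht1
  have t1 : Filter.Tendsto (fun k : ℕ => 1 / ((k : ℝ) + 1)) Filter.atTop (nhds 0) := tendsto_one_div_add_atTop_nhds_zero_nat
  obtain ⟨F, hF, φ, hφ, hconv⟩ := asc_arz w hwc hw1 (by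
    intro ε hε
    have hj : ∀ᶠ j : ℕ in Filter.atTop, M * t ^ j < ε / 2 := by
      have := tt.const_mul M
      rw [mul_zero] at this
      exact this.eventually_lt_const (by linarith)
    have hN : ∀ᶠ k : ℕ in Filter.atTop, 3 * (1 / ((k : ℝ) + 1)) < ε / 2 := by
      have := t1.const_mul 3
      rw [mul_zero] at this
      exact this.eventually_lt_const (by linarith)
    obtain ⟨j, hj⟩ := hj.exists
    obtain ⟨N, hN⟩ := Filter.eventually_atTop.1 hN
    refine ⟨ρ j, hρ0 j, max j N, fun k hk q q' hq => ?_⟩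
    have h1 := hmod1 k j q q' ((le_max_left _ _).trans hk) hq.le
    have h2 := hN k ((le_max_right _ _).trans hk)
    linarith)
  have hpt : ∀ q, Filter.Tendsto (fun k => w (φ k) q) Filter.atTop (nhds (F q)) := fun q => by
    rw [Metric.tendsto_atTop]
    intro ε hε
    obtain ⟨N, hN⟩ := hconv ε hε
    exact ⟨N, fun k hk => by rw [dist_eq_norm]; exact hN k hk q⟩
  have hF1 : ∀ q, ‖F q‖ = 1 := by
    intro q
    have l1 := (hpt q).norm
    have lo : Filter.Tendsto (fun k : ℕ => 1 - (A * t ^ (φ k) + 1 / ((φ k : ℝ) + 1))) Filter.atTop (nhds 1) := by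
      have h1 := ((tt.const_mul A).add t1).comp hφ.tendsto_atTop
      have h2 := h1.const_sub 1
      simpa using h2
    have l2 := tendsto_of_tendsto_of_tendsto_of_le_of_le lo (tendsto_const_nhds (x := (1 : ℝ)))
      (f := fun k => ‖w (φ k) q‖) (fun k => by
        have h1 := hwl (φ k) q
        have h2 := hb1 (φ k)
        show 1 - (A * t ^ (φ k) + 1 / ((φ k : ℝ) + 1)) ≤ ‖w (φ k) q‖
        linarith) (fun k => hw1 _ q)
    exact tendsto_nhds_unique l1 l2
  have hF0 : ∀ q, F q ≠ 0 := fun q h => by have := hF1 q; rw [h, norm_zero] at this; norm_num at this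
  set f : Sph n → Sph n := fun q => prj (F q) with hf
  have hfc : Continuous f := prj_comp_cont hF hF0
  have hcvf : cv f = F := by
    funext q
    show (prj (F q) : Fs n) = F q
    rw [prj_val (hF0 q), hF1]; simp
  refine ⟨f, hfc, ?_, ?_⟩
  · intro hnull
    obtain ⟨N, hN⟩ := hconv 1 one_pos
    have s1 : Homotopic f (fun q => prj (w (φ N) q)) :=
      homotopic_prj_lin hF (hwc _) (fun q => by rw [hF1]; exact hN N le_rfl q)
    have s2 : Homotopic (g (φ N)) (fun q => prj (w (φ N) q)) := by
      refine hom_wr hn hp1 (hg _) (hρ0 _) (hρ2 _) (fun q => ?_)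
      refine (hd (φ N) q (φ N)).trans (le_trans ?_ hS)
      refine add_le_add ?_ (mul_le_mul' le_rfl (hδle _))
      exact mul_le_of_le_one_left' (pow_le_one' hθ.le _)
    exact hgn (φ N) (NullH.congr (s2.trans' s1.symm') hnull)
  · rw [hcvf]
    -- almost everywhere convergence
    have hae : ∀ᵐ q ∂(muS n), Filter.Tendsto (fun k => cv (g (φ k)) q) Filter.atTop (nhds (F q)) := by
      have hmeas : ∀ k, Measurable (fun q => ‖cv (g k) q - w k q‖ₑ ^ p) := fun k =>
        (((hcv k).sub (hwc k)).enorm.measurable).pow_const p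
      set c0 : ℝ≥0∞ := (cS n)⁻¹ * ENNReal.ofReal (2 ^ (2 * (n : ℝ))) with hc0
      have hc0f : c0 ≠ ⊤ := ENNReal.mul_ne_top (ENNReal.inv_ne_top.2 cS_pos) ENNReal.ofReal_ne_top
      have hIntg : ∀ k, ∫⁻ q, ‖cv (g k) q - w k q‖ₑ ^ p ∂(muS n) ≤ c0 * (Em n p + 1) * ENNReal.ofReal ((1 / 8) ^ k) := by
        intro k
        refine (wr_Lp hn hp1 (hcv k) (hcv1 k) (hρ0 k) (hρ2 k)).trans ?_
        calc c0 * ENNReal.ofReal (ρ k ^ n) * nu (muS n) p (cv (g k)) Set.univ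
            ≤ c0 * ENNReal.ofReal ((1 / 8) ^ k) * (Em n p + 1) := by
              refine mul_le_mul' (mul_le_mul' le_rfl (ENNReal.ofReal_le_ofReal ?_)) ((hgE k).trans (add_le_add le_rfl (hδ1 k)))
              have h8 : (0 : ℝ) < 8 ^ k := by positivity
              have h1 : ρ k ≤ (1 / 8) ^ k := by
                simp only [hρ]
                rw [one_div_pow, div_div, div_le_div_iff₀ (by positivity) (by positivity)]
                nlinarith
              have h2 : ρ k ≤ 1 := h1.trans (pow_le_one₀ (by norm_num) (by norm_num))
              calc ρ k ^ n ≤ ρ k ^ 1 := pow_le_pow_of_le_one (hρ0 k).le h2 hn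
                _ ≤ _ := by rw [pow_one]; exact h1
          _ = _ := by ring
      have hsum : ∫⁻ q, ∑' k, ‖cv (g k) q - w k q‖ₑ ^ p ∂(muS n) ≠ ⊤ := by
        rw [lintegral_tsum (fun k => (hmeas k).aemeasurable)]
        refine ne_top_of_le_ne_top ?_ (ENNReal.tsum_le_tsum hIntg)
        rw [ENNReal.tsum_mul_left]
        refine ENNReal.mul_ne_top (ENNReal.mul_ne_top hc0f (ENNReal.add_ne_top.2 ⟨hEm, by simp⟩)) ?_
        have hs : Summable (fun k : ℕ => (1 / 8 : ℝ) ^ k) := summable_geometric_of_lt_one (by norm_num) (by norm_num)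
        rw [← ENNReal.ofReal_tsum_of_nonneg (fun k => by positivity) hs]
        exact ENNReal.ofReal_ne_top
      filter_upwards [ae_lt_top (Measurable.ennreal_tsum hmeas) hsum] with q hq
      have h0 := ENNReal.tendsto_atTop_zero_of_tsum_ne_top hq.ne
      have h1 : Filter.Tendsto (fun k => ‖cv (g k) q - w k q‖ₑ) Filter.atTop (nhds 0) := by
        have := (ENNReal.continuous_rpow_const (y := p⁻¹)).tendsto (0 : ℝ≥0∞) |>.comp h0
        rw [ENNReal.zero_rpow_of_pos (by positivity)] at this
        refine this.congr fun k => ?_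
        simp only [Function.comp_apply]
        rw [ENNReal.rpow_rpow_inv hp0.ne']
      have h2 : Filter.Tendsto (fun k => cv (g k) q - w k q) Filter.atTop (nhds 0) := by
        rw [tendsto_zero_iff_enorm_tendsto_zero]; exact h1
      have h3 := (h2.comp hφ.tendsto_atTop).add (hpt q)
      simpa using h3
    refine (fatou_nu hn hp0 (fun k => hcv (φ k)) hae).trans ?_
    have hlim : Filter.Tendsto (fun k : ℕ => Em n p + ENNReal.ofReal (1 / ((φ k : ℝ) + 1))) Filter.atTop (nhds (Em n p)) := by
      have h1 := ENNReal.tendsto_ofReal (t1.comp hφ.tendsto_atTop)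
      rw [ENNReal.ofReal_zero] at h1
      have h2 := (tendsto_const_nhds (x := Em n p)).add h1
      rw [add_zero] at h2
      exact h2
    rw [← hlim.liminf_eq]
    exact Filter.liminf_le_liminf (Filter.Eventually.of_forall fun k => (hgE (φ k)).trans (add_le_add le_rfl (hδk _)))

end

/-- there exists a homotopically nontrivial continuous map `𝕊ⁿ → 𝕊ⁿ` of finite
`E_{s,n/s}`-energy which minimizes the energy in its homotopy class. -/
theorem stmt13 (n : ℕ) (hn : 1 ≤ n) (s : ℝ) (hs : 0 < s) (hs1 : s < 1)
    (hns : 2 ≤ (n : ℝ) / s) :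
    ∃ u : Sph n → Sph n, Continuous u ∧
      (¬ ∃ c : Sph n, Homotopic u (fun _ => c)) ∧
      sphEnergy n s u < ⊤ ∧
      (∀ v : Sph n → Sph n, Continuous v → Homotopic u v →
        sphEnergy n s u ≤ sphEnergy n s v) := by
  have hn0 : (0 : ℝ) < n := by exact_mod_cast hn
  have hp : (n : ℝ) < n / s := by rw [lt_div_iff₀ hs]; nlinarith
  have hp1 : (1 : ℝ) ≤ n / s := by linarith
  obtain ⟨f, hf, hfn, hfE⟩ := exists_min hn hp1 hp
  refine ⟨f, hf, hfn, ?_, fun v hv huv => ?_⟩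
  · rw [sphEnergy_eq]
    exact hfE.trans_lt (Em_fin hn hp).lt_top
  · rw [sphEnergy_eq, sphEnergy_eq]
    exact hfE.trans (Em_le hv (fun h => hfn (NullH.congr huv h)))
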